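/- Let p and q be primes with p ≡ 5 (mod 8) and q ≡ 3 (mod 8), and set d = pq. Then the order of the 2-Sylow subgroup of the ideal class group of L_{1,d} = ℚ(ζ₈, √d) equals 2·h₂(-pq). -/

import Mathlib

open IntermediateField NumberField

/-- The quadratic field `ℚ(√m)` realized inside `ℂ` (for `m` of either sign). -/
noncomputable def quadField (m : ℤ) : IntermediateField ℚ ℂ :=
  IntermediateField.adjoin ℚ {z : ℂ | z ^ 2 = (m : ℂ)}

/-- The 2-class group of a number field `K ⊆ ℂ`: the 2-primary component
(= 2-Sylow subgroup) of the ideal class group of its ring of integers. -/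
noncomputable def twoClassGroup (K : IntermediateField ℚ ℂ) :
    Subgroup (ClassGroup (𝓞 K)) :=
  CommGroup.primaryComponent _ 2

/-- `h₂(m)`: the 2-class number of the quadratic field `ℚ(√m)`. -/
noncomputable def h2 (m : ℤ) : ℕ := Nat.card (twoClassGroup (quadField m))

/-- `L_{n,d} = ℚ(ζ_{2^{n+2}}, √d)`, the `n`-th layer of the cyclotomic
`ℤ₂`-extension of `ℚ(√d, √-1)`. -/
noncomputable def Lfield (n : ℕ) (d : ℤ) : IntermediateField ℚ ℂ :=
  IntermediateField.adjoin ℚ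
    ({z : ℂ | z ^ 2 ^ (n + 2) = 1} ∪ {z : ℂ | z ^ 2 = (d : ℂ)})

/-- `ℚ(ζ_{2^{n+2}} + ζ_{2^{n+2}}⁻¹, √d) = ℚ(2cos(2π/2^{n+2}), √d)`.
For `d > 0` this is the maximal real subfield `L_{n,d}⁺` of `L_{n,d}`;
for `d < 0` it is the `n`-th layer `K_{n,|d|}` of the cyclotomic
`ℤ₂`-extension of the imaginary quadratic field `ℚ(√d)`. -/
noncomputable def LplusField (n : ℕ) (d : ℤ) : IntermediateField ℚ ℂ :=
  IntermediateField.adjoin ℚ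
    ({((2 * Real.cos (2 * Real.pi / 2 ^ (n + 2)) : ℝ) : ℂ)} ∪ {z : ℂ | z ^ 2 = (d : ℂ)})

open IntermediateField NumberField

/-! ### Group theoretic preliminaries -/

lemma aux_index_two_nsmul (M : Type*) [AddCommGroup M] [Module.Finite ℤ M] :
    (nsmulAddMonoidHom (α := M) 2).range.index =
      2 ^ Module.finrank ℤ M * Nat.card {x : M // 2 • x = 0} := by
  classical
  set T := (Submodule.torsion ℤ M) with hT
  have hfin : Finite T := Module.finite_of_fg_torsion T (Submodule.torsion_isTorsion)
  set f := nsmulAddMonoidHom (α := M) 2 with hf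
  set A := f.range with hA
  have hmem : ∀ x : M, x ∈ T ↔ ∃ n : ℤ, n ≠ 0 ∧ n • x = 0 := by
    intro x
    rw [hT, Submodule.mem_torsion_iff]
    constructor
    · rintro ⟨a, ha⟩
      exact ⟨a, nonZeroDivisors.ne_zero a.2, ha⟩
    · rintro ⟨n, hn, h⟩
      exact ⟨⟨n, mem_nonZeroDivisors_of_ne_zero hn⟩, h⟩
  have h1 : A.relIndex (A ⊔ T.toAddSubgroup) * (A ⊔ T.toAddSubgroup).index = A.index :=
    AddSubgroup.relIndex_mul_index le_sup_left
  have h2 : (A ⊔ T.toAddSubgroup).index = 2 ^ Module.finrank ℤ M := by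
    have e1 : A ⊔ T.toAddSubgroup =
        (nsmulAddMonoidHom (α := M ⧸ T) 2).range.comap (T.mkQ.toAddMonoidHom) := by
      ext x
      simp only [AddSubgroup.mem_sup, AddSubgroup.mem_comap, AddMonoidHom.mem_range, hA, hf,
        nsmulAddMonoidHom_apply, LinearMap.toAddMonoidHom_coe, Submodule.mkQ_apply]
      constructor
      · rintro ⟨_, ⟨y, rfl⟩, z, hz, rfl⟩
        refine ⟨Submodule.Quotient.mk y, ?_⟩
        rw [Submodule.Quotient.mk_add, (Submodule.Quotient.mk_eq_zero T).2 hz, add_zero]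
        rfl
      · rintro ⟨y, hy⟩
        obtain ⟨y, rfl⟩ := Submodule.Quotient.mk_surjective _ y
        refine ⟨2 • y, ⟨y, rfl⟩, x - 2 • y, ?_, by abel⟩
        have := hy
        rw [eq_comm] at this
        exact (Submodule.Quotient.eq T).1 this
    rw [e1, AddSubgroup.index_comap_of_surjective _ (by exact Submodule.mkQ_surjective T),
      AddSubgroup.index_range_nsmul, finrank_quotient_eq_of_le_torsion (le_of_eq hT)]
  have h3 : A.relIndex (A ⊔ T.toAddSubgroup) = Nat.card {x : M // 2 • x = 0} := by
    rw [AddSubgroup.relIndex_sup_left]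
    have e2 : A.addSubgroupOf T.toAddSubgroup =
        (nsmulAddMonoidHom (α := T.toAddSubgroup) 2).range := by
      ext ⟨x, hx⟩
      simp only [AddSubgroup.mem_addSubgroupOf, AddMonoidHom.mem_range, hA, hf,
        nsmulAddMonoidHom_apply]
      constructor
      · rintro ⟨y, hy⟩
        have hyT : y ∈ T := by
          obtain ⟨n, hn, h⟩ := (hmem x).1 hx
          refine (hmem y).2 ⟨n * 2, by positivity, ?_⟩
          rw [mul_smul, ← h, ← hy]
          simp [ofNat_zsmul]
        exact ⟨⟨y, hyT⟩, Subtype.ext hy⟩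
      · rintro ⟨y, hy⟩
        exact ⟨y, congrArg Subtype.val hy⟩
    have : Finite T.toAddSubgroup := hfin
    rw [AddSubgroup.relIndex, e2, AddSubgroup.index_range]
    refine Nat.card_congr ⟨fun x => ⟨x.1.1, ?_⟩, fun x => ⟨⟨x.1, ?_⟩, ?_⟩, ?_, ?_⟩
    · have := x.2
      rw [AddMonoidHom.mem_ker] at this
      exact congrArg Subtype.val this
    · exact (hmem _).2 ⟨2, by norm_num, by rw [ofNat_zsmul]; exact x.2⟩
    · rw [AddMonoidHom.mem_ker]
      exact Subtype.ext x.2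
    · intro x; rfl
    · intro x; rfl
  rw [← h1, h2, h3, mul_comm]

/-- index of squares in a finitely generated abelian group with exactly two elements of
order dividing two -/
lemma aux_index_sq (G : Type*) [CommGroup G] [Module.Finite ℤ (Additive G)]
    (h2 : Nat.card {x : G // x ^ 2 = 1} = 2) :
    (powMonoidHom 2 : G →* G).range.index = 2 ^ (Module.finrank ℤ (Additive G) + 1) := by
  have := aux_index_two_nsmul (Additive G)
  rw [pow_succ]
  refine this.trans ?_
  congr 1

lemma aux_primary_card (G : Type*) [CommGroup G] [Finite G] :
    ∃ m : ℕ, Nat.card G = Nat.card (CommGroup.primaryComponent G 2) * m ∧ ¬ 2 ∣ m := by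
  have : Fact (Nat.Prime 2) := ⟨Nat.prime_two⟩
  refine ⟨(CommGroup.primaryComponent G 2).index, (Subgroup.card_mul_index _).symm, ?_⟩
  intro h
  obtain ⟨x, hx⟩ := exists_prime_orderOf_dvd_card' (G := G ⧸ CommGroup.primaryComponent G 2) 2 h
  obtain ⟨g, rfl⟩ := QuotientGroup.mk_surjective x
  have h1 : (QuotientGroup.mk (s := CommGroup.primaryComponent G 2) g) ^ 2 = 1 := by
    have := pow_orderOf_eq_one (QuotientGroup.mk (s := CommGroup.primaryComponent G 2) g)
    rwa [hx] at this
  rw [← QuotientGroup.mk_pow, QuotientGroup.eq_one_iff, CommGroup.mem_primaryComponent] at h1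
  obtain ⟨k, hk⟩ := h1
  have h3 : g ∈ CommGroup.primaryComponent G 2 :=
    CommGroup.mem_primaryComponent.2 ⟨k + 1, by rw [pow_succ', pow_mul, hk]⟩
  rw [(QuotientGroup.eq_one_iff g).2 h3, orderOf_one] at hx
  omega

lemma aux_primary_isPow (G : Type*) [CommGroup G] [Finite G] :
    ∃ n : ℕ, Nat.card (CommGroup.primaryComponent G 2) = 2 ^ n := by
  have : Fact (Nat.Prime 2) := ⟨Nat.prime_two⟩
  have : IsPGroup 2 (CommGroup.primaryComponent G 2) := by
    rintro ⟨g, k, hk⟩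
    exact ⟨k, Subtype.ext hk⟩
  exact IsPGroup.iff_card.1 this

lemma aux_primary_le (G : Type*) [CommGroup G] [Finite G] (C : Subgroup G)
    (hC : CommGroup.primaryComponent G 2 ≤ C) :
    ∃ m : ℕ, Nat.card C = Nat.card (CommGroup.primaryComponent G 2) * m ∧ ¬ 2 ∣ m := by
  obtain ⟨m, hm, hm2⟩ := aux_primary_card G
  refine ⟨(CommGroup.primaryComponent G 2).relIndex C, ?_, ?_⟩
  · have := Subgroup.relIndex_mul_relIndex (⊥ : Subgroup G) _ C bot_le hC
    rw [Subgroup.relIndex_bot_left, Subgroup.relIndex_bot_left] at this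
    exact this.symm
  · intro h
    apply hm2
    have h1 := Subgroup.relIndex_mul_index hC
    have h2 : (CommGroup.primaryComponent G 2).index = m := by
      have := Subgroup.card_mul_index (CommGroup.primaryComponent G 2)
      rw [hm] at this
      exact Nat.eq_of_mul_eq_mul_left Nat.card_pos this
    rw [← h2, ← h1]
    exact h.mul_right _

/-- comparison of 2-parts -/
lemma aux_two_part {a b x y : ℕ} {i j : ℕ} (ma mb : ℕ) (ha : ¬ 2 ∣ ma) (hb : ¬ 2 ∣ mb)
    (hx : ∃ n, x = 2 ^ n) (hy : ∃ n, y = 2 ^ n)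
    (hax : a = x * ma) (hby : b = y * mb) (h : a * 2 ^ i = b * 2 ^ j) :
    x * 2 ^ i = y * 2 ^ j := by
  obtain ⟨n, rfl⟩ := hx
  obtain ⟨m, rfl⟩ := hy
  subst hax hby
  have hma : ma ≠ 0 := by rintro rfl; simp at ha
  have hmb : mb ≠ 0 := by rintro rfl; simp at hb
  have e : 2 ^ (n + i) * ma = 2 ^ (m + j) * mb := by
    rw [pow_add, pow_add]; linarith
  have e2 := congrArg (padicValNat 2) e
  have : Fact (Nat.Prime 2) := ⟨Nat.prime_two⟩
  rw [padicValNat.mul (by positivity) hma, padicValNat.mul (by positivity) hmb,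
    padicValNat.prime_pow, padicValNat.prime_pow, padicValNat.eq_zero_of_not_dvd ha,
    padicValNat.eq_zero_of_not_dvd hb] at e2
  rw [← pow_add, ← pow_add]
  congr 1

lemma aux_no_order_four {G : Type*} [CommGroup G] (h : ∀ c : G, c ^ 4 = 1 → c ^ 2 = 1)
    (c : G) (hc : c ∈ CommGroup.primaryComponent G 2) : c ^ 2 = 1 := by
  obtain ⟨k, hk⟩ := hc
  induction k with
  | zero => simp at hk; simp [hk]
  | succ k ih =>
    rcases k with _ | k
    · simpa using hk
    · apply ih
      have : (c ^ 2 ^ k) ^ 4 = 1 := by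
        rw [← pow_mul, ← hk]; congr 1; ring
      have := h _ this
      rw [← pow_mul] at this
      rw [pow_succ]; exact this

set_option linter.unusedSectionVars false

/-! ### Quadratic extensions of number fields -/

/-- `τ` is the nontrivial automorphism of the quadratic extension `K / F`. -/
structure IsQ (F K : Type*) [Field F] [Field K] [Algebra F K] (τ : K ≃+* K) : Prop where
  fin : Module.finrank F K = 2
  fix : ∀ x : F, τ (algebraMap F K x) = algebraMap F K x
  ne : ∃ x, τ x ≠ x

/-- the action of a field automorphism on integers -/
noncomputable def TI {K : Type*} [Field K] (τ : K ≃+* K) : 𝓞 K →+* 𝓞 K :=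
  RingOfIntegers.mapRingHom (τ : K →+* K)

lemma TI_coe {K : Type*} [Field K] (τ : K ≃+* K) (x : 𝓞 K) : ((TI τ x : 𝓞 K) : K) = τ x := rfl

lemma TI_injective {K : Type*} [Field K] (τ : K ≃+* K) : Function.Injective (TI τ) := by
  intro x y hxy
  apply RingOfIntegers.ext
  exact τ.injective (congrArg (fun z : 𝓞 K => (z : K)) hxy)

lemma TI_surjective {K : Type*} [Field K] (τ : K ≃+* K) : Function.Surjective (TI τ) := by
  intro x
  refine ⟨TI τ.symm x, ?_⟩
  apply RingOfIntegers.ext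
  rw [TI_coe, TI_coe]
  exact τ.apply_symm_apply _

lemma TI_mul_map {K : Type*} [Field K] (σ τ : K ≃+* K) (I : Ideal (𝓞 K)) :
    (I.map (TI σ)).map (TI τ) = I.map (TI (σ.trans τ)) := by
  rw [Ideal.map_map]; rfl

lemma TI_map_ne_bot {K : Type*} [Field K] (τ : K ≃+* K) {I : Ideal (𝓞 K)} (hI : I ≠ ⊥) :
    I.map (TI τ) ≠ ⊥ := by
  rwa [Ne, Ideal.map_eq_bot_iff_of_injective (TI_injective τ)]

lemma TI_map_prime {K : Type*} [Field K] (τ : K ≃+* K) (I : Ideal (𝓞 K)) [I.IsPrime] :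
    (I.map (TI τ)).IsPrime := by
  apply Ideal.map_isPrime_of_surjective (TI_surjective τ)
  rw [(RingHom.injective_iff_ker_eq_bot _).1 (TI_injective τ)]
  exact bot_le

namespace IsQ

section field
variable {F K : Type*} [Field F] [Field K] [CharZero F] [Algebra F K] {τ : K ≃+* K}

/-- as an algebra equivalence -/
noncomputable def alg (h : IsQ F K τ) : K ≃ₐ[F] K := AlgEquiv.ofRingEquiv (f := τ) h.fix

lemma alg_apply (h : IsQ F K τ) (x : K) : h.alg x = τ x := rfl

lemma isGalois (h : IsQ F K τ) : IsGalois F K := by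
  have : Algebra.IsQuadraticExtension F K := ⟨h.fin⟩
  have : Algebra.IsSeparable F K := inferInstance
  exact ⟨⟩

lemma finDim (h : IsQ F K τ) : FiniteDimensional F K :=
  FiniteDimensional.of_finrank_pos (by rw [h.fin]; norm_num)

lemma alg_ne (h : IsQ F K τ) : (1 : K ≃ₐ[F] K) ≠ h.alg := by
  intro e
  obtain ⟨x, hx⟩ := h.ne
  exact hx (by rw [← h.alg_apply, ← e]; rfl)

lemma univ_eq (h : IsQ F K τ) [Fintype (K ≃ₐ[F] K)] [DecidableEq (K ≃ₐ[F] K)] :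
    (Finset.univ : Finset (K ≃ₐ[F] K)) = {1, h.alg} := by
  have := h.isGalois
  have := h.finDim
  symm
  rw [Finset.eq_univ_iff_forall]
  rw [← Finset.eq_univ_iff_forall]
  apply Finset.eq_univ_of_card
  rw [Finset.card_pair h.alg_ne, ← Nat.card_eq_fintype_card, IsGalois.card_aut_eq_finrank, h.fin]

lemma norm_eq (h : IsQ F K τ) (x : K) : algebraMap F K (Algebra.norm F x) = x * τ x := by
  classical
  have := h.isGalois
  have := h.finDim
  rw [Algebra.norm_eq_prod_automorphisms F (L := K) x]
  rw [show (Finset.univ : Finset (K ≃ₐ[F] K)) = {1, h.alg} by convert h.univ_eq,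
    Finset.prod_pair h.alg_ne]
  rfl

lemma exists_of_fixed (h : IsQ F K τ) {x : K} (hx : τ x = x) : ∃ y : F, algebraMap F K y = x := by
  classical
  have := h.isGalois
  have := h.finDim
  have : Fintype (K ≃ₐ[F] K) := Fintype.ofFinite _
  rw [← Set.mem_range, IsGalois.mem_range_algebraMap_iff_fixed]
  intro f
  have := Finset.mem_univ f
  rw [h.univ_eq] at this
  simp only [Finset.mem_insert, Finset.mem_singleton] at this
  rcases this with rfl | rfl
  · rfl
  · exact hx

lemma invol (h : IsQ F K τ) (x : K) : τ (τ x) = x := by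
  by_cases hx : x = 0
  · simp [hx]
  have e := h.norm_eq x
  have e2 : τ (x * τ x) = x * τ x := by rw [← e, h.fix]
  rw [map_mul, mul_comm] at e2
  have : τ x ≠ 0 := by simpa using hx
  exact mul_right_cancel₀ this e2

lemma exists_theta (h : IsQ F K τ) : ∃ θ : K, θ ≠ 0 ∧ τ θ = -θ := by
  obtain ⟨x, hx⟩ := h.ne
  refine ⟨τ x - x, sub_ne_zero.2 hx, ?_⟩
  rw [map_sub, h.invol]; ring

/-- Hilbert 90 -/
lemma hilbert90 (h : IsQ F K τ) {x : K} (hx : x * τ x = 1) : ∃ y : K, y ≠ 0 ∧ x * τ y = y := by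
  by_cases h1 : 1 + x = 0
  · obtain ⟨θ, h0, hθ⟩ := h.exists_theta
    refine ⟨θ, h0, ?_⟩
    rw [hθ, eq_neg_of_add_eq_zero_right h1]; ring
  · refine ⟨1 + x, h1, ?_⟩
    rw [map_add, map_one, mul_add, hx]; ring

end field

section nf
variable {F K : Type*} [Field F] [Field K] [NumberField F] [NumberField K] [Algebra F K]
  {τ : K ≃+* K}

lemma TI_invol (h : IsQ F K τ) (x : 𝓞 K) : TI τ (TI τ x) = x := by
  apply RingOfIntegers.ext
  exact h.invol _

lemma TI_fix (h : IsQ F K τ) (x : 𝓞 F) :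
    TI τ (algebraMap (𝓞 F) (𝓞 K) x) = algebraMap (𝓞 F) (𝓞 K) x := by
  apply RingOfIntegers.ext
  exact h.fix _

lemma map_map_TI (h : IsQ F K τ) (I : Ideal (𝓞 K)) : (I.map (TI τ)).map (TI τ) = I := by
  rw [Ideal.map_map]
  convert Ideal.map_id I
  ext x
  exact h.invol _

lemma map_TI_algebraMap (h : IsQ F K τ) (I : Ideal (𝓞 F)) :
    (I.map (algebraMap (𝓞 F) (𝓞 K))).map (TI τ) = I.map (algebraMap (𝓞 F) (𝓞 K)) := by
  rw [Ideal.map_map]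
  congr 1
  ext x
  exact h.fix _

lemma absNorm_map_TI (σ : K ≃+* K) (I : Ideal (𝓞 K)) :
    Ideal.absNorm (I.map (TI σ)) = Ideal.absNorm I := by
  rw [Ideal.absNorm_apply, Ideal.absNorm_apply, Submodule.cardQuot_apply, Submodule.cardQuot_apply]
  exact (Nat.card_congr
    (Ideal.quotientEquiv I _ (RingOfIntegers.mapRingEquiv σ) rfl).toEquiv).symm

lemma intNorm_eq (h : IsQ F K τ) (x : 𝓞 K) :
    algebraMap (𝓞 F) (𝓞 K) (Algebra.intNorm (𝓞 F) (𝓞 K) x) = x * TI τ x := by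
  apply RingOfIntegers.ext
  have e := Algebra.algebraMap_intNorm (A := 𝓞 F) (K := F) (L := K) (B := 𝓞 K) x
  have e2 := h.norm_eq (x : K)
  change algebraMap F K (algebraMap (𝓞 F) F _) = _
  rw [e]
  exact e2

lemma finrankInt (h : IsQ F K τ) : Module.finrank (𝓞 F) (𝓞 K) = 2 := by
  rw [← h.fin]
  exact (IsFractionRing.finrank_eq (𝓞 F) F (𝓞 K) K).symm

/-- the norm of an ideal, extended back -/
lemma mul_map_eq (h : IsQ F K τ) (I : Ideal (𝓞 K)) :
    I * I.map (TI τ) = (Ideal.relNorm (𝓞 F) I).map (algebraMap (𝓞 F) (𝓞 K)) := by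
  have hle : (Ideal.relNorm (𝓞 F) I).map (algebraMap (𝓞 F) (𝓞 K)) ≤ I * I.map (TI τ) := by
    rw [Ideal.map_le_iff_le_comap, Ideal.relNorm_apply, Ideal.map, Ideal.span_le]
    rintro _ ⟨x, hx, rfl⟩
    rw [SetLike.mem_coe, Ideal.mem_comap, h.intNorm_eq]
    exact Ideal.mul_mem_mul hx (Ideal.mem_map_of_mem _ hx)
  by_cases hI : I = ⊥
  · subst hI; simp
  symm
  have hd := Ideal.dvd_iff_le.2 hle
  obtain ⟨J, hJ⟩ := hd
  have e := congrArg Ideal.absNorm hJ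
  rw [Ideal.absNorm_algebraMap, Ideal.absNorm_relNorm, map_mul, map_mul, absNorm_map_TI,
    h.finrankInt, ← pow_two] at e
  have h0 : Ideal.absNorm I ^ 2 ≠ 0 := by
    apply pow_ne_zero
    rwa [Ne, Ideal.absNorm_eq_zero_iff]
  have : Ideal.absNorm J = 1 := by
    have e' : Ideal.absNorm I ^ 2 * 1 = Ideal.absNorm I ^ 2 * Ideal.absNorm J := by rw [mul_one]; exact e
    exact (mul_left_cancel₀ h0 e').symm
  rw [Ideal.absNorm_eq_one_iff] at this
  rw [hJ, this, Ideal.mul_top]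

lemma prime_cases (h : IsQ F K τ) {P : Ideal (𝓞 K)} [hPp : P.IsPrime] (hP : P ≠ ⊥)
    (hfix : P.map (TI τ) = P) :
    (∃ p : Ideal (𝓞 F), p.map (algebraMap (𝓞 F) (𝓞 K)) = P) ∨
    ((∃ p : Ideal (𝓞 F), p.IsPrime ∧ p ≠ ⊥ ∧ p.map (algebraMap (𝓞 F) (𝓞 K)) = P ^ 2) ∧
      ∀ x, x - TI τ x ∈ P) := by
  set p := P.under (𝓞 F) with hp
  have hlo : P.LiesOver p := ⟨rfl⟩
  have hpp : p.IsPrime := inferInstance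
  obtain ⟨s, hs⟩ := Ideal.exists_relNorm_eq_pow_of_isPrime (R := 𝓞 F) P p
  have e := h.mul_map_eq P
  rw [hfix, hs, Ideal.map_pow, ← pow_two] at e
  have hle : p.map (algebraMap (𝓞 F) (𝓞 K)) ≤ P := Ideal.map_le_iff_le_comap.2 le_rfl
  obtain ⟨Q, hQ⟩ := Ideal.dvd_iff_le.2 hle
  have hP1 : P ≠ ⊤ := hPp.ne_top
  rcases s with _ | _ | s
  · exfalso
    rw [pow_zero, Ideal.one_eq_top] at e
    apply hP1
    rw [Ideal.eq_top_iff_one]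
    have : (1 : 𝓞 K) ∈ P ^ 2 := by rw [e]; trivial
    exact Ideal.pow_le_self two_ne_zero this
  · right
    rw [zero_add, pow_one] at e hs
    refine ⟨⟨p, hpp, ?_, e.symm⟩, ?_⟩
    · intro h0
      rw [h0, Ideal.map_bot] at e
      exact pow_ne_zero 2 hP e
    have hp0 : p ≠ ⊥ := by
      intro h0
      rw [h0, Ideal.map_bot] at e
      exact pow_ne_zero 2 hP e
    have hn : Ideal.absNorm P = Ideal.absNorm p := by
      rw [← hs, Ideal.absNorm_relNorm]
    have hinj : Function.Injective (Ideal.quotientMap P (algebraMap (𝓞 F) (𝓞 K)) (le_refl p)) :=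
      Ideal.quotientMap_injective
    have : Finite (𝓞 K ⧸ P) := Ideal.finiteQuotientOfFreeOfNeBot P hP
    have : Finite (𝓞 F ⧸ p) := Ideal.finiteQuotientOfFreeOfNeBot p hp0
    have hbij := (Nat.bijective_iff_injective_and_card _).2 ⟨hinj, by
      rw [Ideal.absNorm_apply, Ideal.absNorm_apply, Submodule.cardQuot_apply,
        Submodule.cardQuot_apply] at hn
      exact hn.symm⟩
    intro x
    obtain ⟨y, hy⟩ := hbij.2 (Ideal.Quotient.mk P x)
    obtain ⟨a, rfl⟩ := Ideal.Quotient.mk_surjective y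
    rw [Ideal.quotientMap_mk, Ideal.Quotient.eq] at hy
    have h2 := Ideal.mem_map_of_mem (TI τ) hy
    rw [hfix, map_sub, h.TI_fix] at h2
    have h3 := Ideal.sub_mem P h2 hy
    rw [sub_sub_sub_cancel_left] at h3
    exact h3
  · left
    refine ⟨p, ?_⟩
    rw [hQ, mul_pow, pow_add, pow_add, mul_comm, ] at e
    have e3 : P ^ 2 * 1 = P ^ 2 * (Q ^ (s + 2) * P ^ s) := by
      rw [mul_one]
      refine e.trans ?_
      ring
    have e4 := mul_left_cancel₀ (pow_ne_zero 2 hP) e3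
    have : Q = 1 := by
      apply Ideal.isUnit_iff.1 _ |>.trans Ideal.one_eq_top.symm
      apply isUnit_of_dvd_one
      rw [e4]
      exact Dvd.dvd.mul_right (dvd_pow_self Q (by omega)) _
    rw [hQ, this, mul_one]

lemma inv_induction (h : IsQ F K τ) (Q : Ideal (𝓞 K) → Prop)
    (hmul : ∀ I J, I ≠ ⊥ → J ≠ ⊥ → Q I → Q J → Q (I * J))
    (hj : ∀ b : Ideal (𝓞 F), b ≠ ⊥ → Q (b.map (algebraMap (𝓞 F) (𝓞 K))))
    (hram : ∀ P : Ideal (𝓞 K), P.IsPrime → P ≠ ⊥ → P.map (TI τ) = P →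
      (∃ p : Ideal (𝓞 F), p.IsPrime ∧ p ≠ ⊥ ∧ p.map (algebraMap (𝓞 F) (𝓞 K)) = P ^ 2) →
      (∀ x, x - TI τ x ∈ P) → Q P) :
    ∀ I : Ideal (𝓞 K), I ≠ ⊥ → I.map (TI τ) = I → Q I := by
  intro I
  induction hn : Ideal.absNorm I using Nat.strong_induction_on generalizing I with
  | _ n ih =>
  intro hI hfix
  by_cases hI1 : I = ⊤
  · have := hj ⊤ (by exact top_ne_bot)
    rw [Ideal.map_top] at this
    rwa [hI1]
  obtain ⟨P, hPm, hPI⟩ := Ideal.exists_le_maximal I hI1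
  have hPp : P.IsPrime := hPm.isPrime
  have hP : P ≠ ⊥ := fun h0 => hI (le_bot_iff.1 (h0 ▸ hPI))
  have key : ∀ J J' : Ideal (𝓞 K), I = J * J' → J ≠ ⊤ → J.map (TI τ) = J → Q J → Q I := by
    intro J J' e hJ hJfix hQJ
    have hJ0 : J ≠ ⊥ := by rintro rfl; exact hI (by rw [e, Ideal.bot_mul])
    have hJ'0 : J' ≠ ⊥ := by rintro rfl; exact hI (by rw [e, Ideal.mul_bot])
    have hJ'fix : J'.map (TI τ) = J' := by
      have e2 := hfix
      rw [e, Ideal.map_mul, hJfix] at e2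
      exact mul_left_cancel₀ hJ0 e2
    rw [e]
    refine hmul _ _ hJ0 hJ'0 hQJ (ih _ ?_ J' rfl hJ'0 hJ'fix)
    rw [← hn, e, map_mul]
    have h1 : Ideal.absNorm J ≠ 1 := by rwa [Ne, Ideal.absNorm_eq_one_iff]
    have h2 : Ideal.absNorm J ≠ 0 := by rwa [Ne, Ideal.absNorm_eq_zero_iff]
    have h3 : Ideal.absNorm J' ≠ 0 := by rwa [Ne, Ideal.absNorm_eq_zero_iff]
    have h4 : 2 ≤ Ideal.absNorm J := by omega
    nlinarith [Nat.pos_of_ne_zero h3]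
  obtain ⟨J, hJ⟩ := Ideal.dvd_iff_le.2 hPI
  by_cases hPfix : P.map (TI τ) = P
  · refine key P J hJ hPp.ne_top hPfix ?_
    rcases h.prime_cases hP hPfix with ⟨p, hp⟩ | ⟨h1, h2⟩
    · rw [← hp]
      refine hj p ?_
      rintro rfl
      exact hP (by rw [← hp, Ideal.map_bot])
    · exact hram P hPp hP hPfix h1 h2
  · have hτP : P.map (TI τ) ∣ I := by
      refine Ideal.dvd_iff_le.2 ?_
      rw [← hfix]
      exact Ideal.map_mono hPI
    have hτPp := TI_map_prime τ P
    have hτP0 := TI_map_ne_bot τ hP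
    have h1 : P.map (TI τ) ∣ J := by
      rw [hJ] at hτP
      rcases (Ideal.prime_of_isPrime hτP0 hτPp).dvd_or_dvd hτP with h3 | h3
      · exfalso
        have hm : (P.map (TI τ)).IsMaximal := hτPp.isMaximal hτP0
        exact hPfix (hPm.eq_of_le hm.ne_top (Ideal.dvd_iff_le.1 h3)).symm
      · exact h3
    obtain ⟨J', hJ'⟩ := h1
    refine key (P * P.map (TI τ)) J' (by rw [hJ, hJ', mul_assoc]) ?_ ?_ ?_
    · intro h5
      apply hPp.ne_top
      rw [eq_top_iff, ← h5]
      exact (Ideal.mul_le_left : P * P.map (TI τ) ≤ P)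
    · rw [Ideal.map_mul, h.map_map_TI, mul_comm]
    · rw [h.mul_map_eq]
      apply hj
      rwa [Ne, Ideal.relNorm_eq_bot_iff]

end nf
end IsQ

lemma aux_relIndex_two {G : Type*} [CommGroup G] (H : Subgroup G) (t : G) (h1 : t ∉ H)
    (h2 : t ^ 2 ∈ H) : H.relIndex (H ⊔ Subgroup.zpowers t) = 2 := by
  rw [Subgroup.relIndex_eq_two_iff]
  refine ⟨t, Subgroup.mem_sup_right (Subgroup.mem_zpowers t), ?_⟩
  intro b hb
  rw [Subgroup.mem_sup] at hb
  obtain ⟨a, ha, c, hc, rfl⟩ := hb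
  obtain ⟨n, rfl⟩ := Subgroup.mem_zpowers_iff.1 hc
  have hev : ∀ k : ℤ, t ^ (k + k) ∈ H := by
    intro k
    have : t ^ (k + k) = (t ^ 2) ^ k := by
      rw [← zpow_natCast, ← zpow_mul]; congr 1; push_cast; ring
    rw [this]; exact H.zpow_mem h2 k
  have hod : ∀ k : ℤ, t ^ (2 * k + 1) ∉ H := by
    intro k hk
    rw [two_mul, zpow_add_one] at hk
    exact h1 ((Subgroup.mul_mem_cancel_left H (hev k)).1 hk)
  have e : a * t ^ n * t = a * t ^ (n + 1) := by rw [mul_assoc, zpow_add_one]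
  rw [e, Subgroup.mul_mem_cancel_left H ha, Subgroup.mul_mem_cancel_left H ha]
  rcases Int.even_or_odd n with ⟨k, rfl⟩ | ⟨k, rfl⟩
  · right
    refine ⟨hev k, ?_⟩
    have := hod k
    rwa [two_mul] at this
  · left
    refine ⟨?_, hod k⟩
    have := hev (k + 1)
    convert this using 2
    ring

lemma aux_relIndex_four {G : Type*} [CommGroup G] (J U : Subgroup G) (s t : G)
    (hU : U = J ⊔ Subgroup.zpowers s ⊔ Subgroup.zpowers t)
    (hs : s ^ 2 ∈ J) (ht : t ^ 2 ∈ J) (h1 : s ∉ J) (h2 : t ∉ J) (h3 : s * t ∉ J) :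
    J.relIndex U = 4 := by
  have e := Subgroup.relIndex_mul_relIndex J (J ⊔ Subgroup.zpowers s) U le_sup_left
    (by rw [hU]; exact le_sup_left)
  rw [aux_relIndex_two J s h1 hs, hU, aux_relIndex_two _ t ?_ (Subgroup.mem_sup_left ht)] at e
  · rw [hU, ← e]
  · intro h
    obtain ⟨a, ha, c, hc, e⟩ := Subgroup.mem_sup.1 h
    obtain ⟨n, rfl⟩ := Subgroup.mem_zpowers_iff.1 hc
    have hev : ∀ k : ℤ, s ^ (k + k) ∈ J := by
      intro k
      have : s ^ (k + k) = (s ^ 2) ^ k := by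
        rw [← zpow_natCast, ← zpow_mul]; congr 1; push_cast; ring
      rw [this]; exact J.zpow_mem hs k
    rcases Int.even_or_odd n with ⟨k, rfl⟩ | ⟨k, rfl⟩
    · exact h2 (e ▸ J.mul_mem ha (hev k))
    · apply h3
      rw [← e]
      have : s * (a * s ^ (2 * k + 1)) = a * s ^ ((k + 1) + (k + 1)) := by
        rw [mul_left_comm, ← zpow_one_add]; congr 2; ring
      rw [this]
      exact J.mul_mem ha (hev _)

/-- the group theoretic core of the ambiguous class number formula -/
theorem aux_ambiguous {G GF X XF : Type*} [CommGroup G] [CommGroup GF] [CommGroup X]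
    [CommGroup XF] (j : GF →* G) (t : G →* G) (pr : X →* G) (prF : XF →* GF) (i : XF →* X)
    (tX : X →* X) (hj : Function.Injective j) (htX : ∀ x, tX (tX x) = x) (htt : ∀ I, t (t I) = I)
    (hpr : ∀ x, t (pr x) = pr (tX x))
    (hprF : ∀ x, j (prF x) = pr (i x)) (hi : ∀ x, tX x = x ↔ ∃ y, i y = x)
    (htj : ∀ b, t (j b) = j b)
    (h90 : ∀ x, x * tX x = 1 → ∃ y, x * tX y = y)
    (hnorm : ∀ x, x * tX x ∈ pr.ker → ∃ u ∈ pr.ker, u * tX u = x * tX x)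
    (U C : Subgroup G) (hU : ∀ I, I ∈ U ↔ t I = I) (hC : ∀ I, I ∈ C ↔ ∃ x, t I = I * pr x)
    (E N' : Subgroup X) (hE : E = pr.ker) (hN : ∀ u, u ∈ N' ↔ u ∈ E ∧ u * tX u = 1)
    (νE EF2 : Subgroup X) (hνE : ∀ x, x ∈ νE ↔ ∃ u ∈ E, u * tX u = x)
    (hEF2 : ∀ x, x ∈ EF2 ↔ ∃ u, u ∈ E ∧ tX u = u ∧ u * u = x) :
    pr.range.relIndex C * (powMonoidHom 2 : N' →* N').range.index =
      j.range.relIndex U * prF.range.index * EF2.relIndex νE := by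
  set P := pr.range with hP
  have hEt : ∀ u ∈ E, tX u ∈ E := by
    intro u hu
    rw [hE, MonoidHom.mem_ker] at *
    rw [← hpr, hu, map_one]
  -- C = U ⊔ P
  have hCU : C = U ⊔ P := by
    ext I
    rw [hC, Subgroup.mem_sup]
    constructor
    · rintro ⟨x, hx⟩
      have h1 : x * tX x ∈ pr.ker := by
        have h2 := congrArg t hx
        rw [map_mul, htt, hpr, hx, mul_assoc, ← map_mul] at h2
        exact MonoidHom.mem_ker.2 (mul_eq_left.1 h2.symm)
      obtain ⟨u, hu, hux⟩ := hnorm x h1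
      obtain ⟨y, hy⟩ := h90 (x * u⁻¹) (by
        rw [map_mul, map_inv, mul_mul_mul_comm, ← hux, ← mul_inv, mul_inv_cancel])
      refine ⟨I * pr y, ?_, pr y⁻¹, ⟨_, rfl⟩, by rw [map_inv, mul_inv_cancel_right]⟩
      rw [hU, map_mul, hx, hpr, mul_assoc, ← map_mul]
      congr 1
      have h3 : pr (x * u⁻¹ * tX y) = pr (x * tX y) := by
        rw [map_mul, map_mul, map_inv, MonoidHom.mem_ker.1 hu, inv_one, mul_one, map_mul]
      rw [← h3, hy]
    · rintro ⟨J, hJ, _, ⟨y, rfl⟩, rfl⟩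
      refine ⟨tX y * y⁻¹, ?_⟩
      rw [map_mul, (hU J).1 hJ, hpr, map_mul, map_inv]
      rw [mul_assoc]; congr 1; rw [mul_comm (pr (tX y)), mul_inv_cancel_left]
  have e1 : P.relIndex C = (U ⊓ P).relIndex U := by
    rw [hCU, sup_comm, Subgroup.relIndex_sup_left, inf_comm, Subgroup.inf_relIndex_right]
  set JP := prF.range.map j with hJP
  have hJU : j.range ≤ U := by
    rintro _ ⟨b, rfl⟩
    exact (hU _).2 (htj b)
  have hJPJ : JP ≤ j.range := Subgroup.map_le_range _ _
  have hJPP : JP ≤ P := by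
    rintro _ ⟨_, ⟨x, rfl⟩, rfl⟩
    exact ⟨i x, (hprF x).symm⟩
  have e2 : JP.relIndex (U ⊓ P) * (U ⊓ P).relIndex U = JP.relIndex U :=
    Subgroup.relIndex_mul_relIndex _ _ _ (le_inf (hJPJ.trans hJU) hJPP) inf_le_left
  have e3 : JP.relIndex j.range * j.range.relIndex U = JP.relIndex U :=
    Subgroup.relIndex_mul_relIndex _ _ _ hJPJ hJU
  have e4 : JP.relIndex j.range = prF.range.index := by
    rw [hJP, MonoidHom.range_eq_map j, Subgroup.relIndex_map_map_of_injective _ _ hj,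
      Subgroup.relIndex_top_right]
  -- φ
  let φ : X →* X := MonoidHom.mk' (fun x => x * (tX x)⁻¹) (by
    intro a b; rw [map_mul, mul_inv]; exact mul_mul_mul_comm _ _ _ _)
  let ν : X →* X := MonoidHom.mk' (fun x => x * tX x) (by
    intro a b; rw [map_mul]; exact mul_mul_mul_comm _ _ _ _)
  have hφ : ∀ x, φ x = x * (tX x)⁻¹ := fun x => rfl
  have hν : ∀ x, ν x = x * tX x := fun x => rfl
  have hN'm := hN
  set D := E.map φ with hD
  have e5 : JP.relIndex (U ⊓ P) = D.relIndex N' := by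
    set Y := E.comap φ with hY
    have hYm : ∀ x, x ∈ Y ↔ pr x ∈ U := by
      intro x
      rw [hY, Subgroup.mem_comap, hE, MonoidHom.mem_ker, hφ, hU, hpr, map_mul, map_inv,
        mul_inv_eq_one, eq_comm]
    have y1 : U ⊓ P = Y.map pr := by
      ext I
      constructor
      · rintro ⟨h1, ⟨x, rfl⟩⟩
        exact ⟨x, (hYm x).2 h1, rfl⟩
      · rintro ⟨x, hx, rfl⟩
        exact ⟨(hYm x).1 hx, x, rfl⟩
    have y2 : N' = Y.map φ := by
      ext u
      rw [hN'm]
      constructor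
      · rintro ⟨h1, h2⟩
        obtain ⟨y, hy⟩ := h90 u h2
        have : φ y = u := by rw [hφ, mul_inv_eq_iff_eq_mul, hy]
        exact ⟨y, by rw [SetLike.mem_coe, hY, Subgroup.mem_comap, this]; exact h1, this⟩
      · rintro ⟨y, hy, rfl⟩
        refine ⟨hy, ?_⟩
        rw [hφ, map_mul, map_inv, htX, mul_mul_mul_comm, mul_comm y]
        rw [mul_mul_mul_comm, mul_inv_cancel, mul_inv_cancel, one_mul]
    rw [y1, y2, ← Subgroup.relIndex_comap, ← Subgroup.relIndex_comap]
    congr 1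
    ext x
    rw [Subgroup.mem_comap, Subgroup.mem_comap]
    constructor
    · rintro ⟨_, ⟨z, rfl⟩, hz⟩
      rw [hprF] at hz
      have hzf : tX (i z) = i z := (hi _).2 ⟨z, rfl⟩
      refine ⟨x * (i z)⁻¹, ?_, ?_⟩
      · rw [SetLike.mem_coe, hE, MonoidHom.mem_ker, map_mul, map_inv, hz, mul_inv_cancel]
      · rw [hφ, hφ, map_mul, map_inv, hzf, mul_inv, inv_inv, mul_mul_mul_comm, inv_mul_cancel,
          mul_one]
    · rintro ⟨u, hu, hx⟩
      have this : tX (x * u⁻¹) = x * u⁻¹ := by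
        have h5 : φ (x * u⁻¹) = 1 := by rw [map_mul, map_inv, hx, mul_inv_cancel]
        rw [hφ, mul_inv_eq_one] at h5
        exact h5.symm
      obtain ⟨z, hz⟩ := (hi _).1 this
      refine ⟨prF z, ⟨z, rfl⟩, ?_⟩
      have hu' : pr u = 1 := by rw [hE] at hu; exact hu
      rw [hprF, hz, map_mul, map_inv, hu', inv_one, mul_one]
  set N2 := N'.map φ with hN2
  have e6 : (powMonoidHom 2 : N' →* N').range.index = N2.relIndex N' := by
    rw [← Subgroup.relIndex_top_right, ← Subgroup.relIndex_map_map_of_injective _ _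
      N'.subtype_injective]
    congr 1
    · ext x
      constructor
      · rintro ⟨_, ⟨u, rfl⟩, rfl⟩
        have hu := ((hN u.1).1 u.2).2
        refine ⟨u.1, u.2, ?_⟩
        rw [hφ, inv_eq_of_mul_eq_one_left hu]
        simp [pow_two]
      · rintro ⟨u, hu', rfl⟩
        have hu := ((hN u).1 hu').2
        refine ⟨_, ⟨⟨u, hu'⟩, rfl⟩, ?_⟩
        rw [hφ, inv_eq_of_mul_eq_one_left hu]
        simp [pow_two]
    · rw [← MonoidHom.range_eq_map, Subgroup.range_subtype]
  have hN'E : N' ≤ E := fun x hx => ((hN'm x).1 hx).1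
  have hDN : D ≤ N' := by
    rintro _ ⟨u, hu, rfl⟩
    rw [hN'm]
    refine ⟨E.mul_mem hu (E.inv_mem (hEt u hu)), ?_⟩
    rw [hφ, map_mul, map_inv, htX, mul_mul_mul_comm, mul_comm (tX u)⁻¹, ← mul_inv, mul_comm u,
      mul_inv_cancel]
  have e7 : N2.relIndex D * D.relIndex N' = N2.relIndex N' :=
    Subgroup.relIndex_mul_relIndex _ _ _ (Subgroup.map_mono hN'E) hDN
  have e8 : N2.relIndex D = EF2.relIndex νE := by
    have z1 : νE = E.map ν := by
      ext x; rw [hνE]; rfl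
    have z2 : EF2 = (E ⊓ φ.ker).map ν := by
      ext x
      rw [hEF2]
      constructor
      · rintro ⟨u, h1, h2, rfl⟩
        refine ⟨u, ⟨h1, ?_⟩, ?_⟩
        · change u ∈ φ.ker
          rw [MonoidHom.mem_ker, hφ, h2, mul_inv_cancel]
        · rw [hν, h2]
      · rintro ⟨u, ⟨h1, h2⟩, rfl⟩
        change u ∈ φ.ker at h2
        rw [MonoidHom.mem_ker, hφ, mul_inv_eq_one] at h2
        exact ⟨u, h1, h2.symm, by rw [hν, ← h2]⟩
    rw [z1, z2, hN2, hD, ← Subgroup.relIndex_comap, ← Subgroup.relIndex_comap]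
    rw [← Subgroup.inf_relIndex_right, ← Subgroup.inf_relIndex_right (Subgroup.comap ν _)]
    congr 1
    ext x
    simp only [Subgroup.mem_inf, Subgroup.mem_comap, Subgroup.mem_map]
    constructor
    · rintro ⟨⟨n, hn, hx⟩, hxE⟩
      refine ⟨⟨x * n⁻¹, ⟨E.mul_mem hxE (E.inv_mem (hN'E hn)), ?_⟩, ?_⟩, hxE⟩
      · rw [MonoidHom.mem_ker, map_mul, map_inv, hx, mul_inv_cancel]
      · rw [map_mul, map_inv, hν n, ((hN'm n).1 hn).2, inv_one, mul_one]
    · rintro ⟨⟨n, ⟨hn, hn2⟩, hx⟩, hxE⟩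
      refine ⟨⟨x * n⁻¹, ?_, ?_⟩, hxE⟩
      · rw [hN'm]
        refine ⟨E.mul_mem hxE (E.inv_mem hn), ?_⟩
        rw [← hν, map_mul, map_inv, hx, mul_inv_cancel]
      · rw [map_mul, map_inv, MonoidHom.mem_ker.1 hn2, inv_one, mul_one]
  rw [e6, ← e7, e1, e8, ← e5]
  calc _ = (JP.relIndex (U ⊓ P) * (U ⊓ P).relIndex U) * EF2.relIndex νE := by ring
    _ = _ := by rw [e2, ← e3, e4]; ring

open scoped nonZeroDivisors

/-! ### Classes of ideals -/

section cls
variable {R : Type*} [CommRing R] [IsDedekindDomain R]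

open Classical in
/-- class of an ideal (trivial for the zero ideal) -/
noncomputable def cls (I : Ideal R) : ClassGroup R :=
  if h : I = ⊥ then 1 else ClassGroup.mk0 ⟨I, mem_nonZeroDivisors_of_ne_zero h⟩

lemma cls_eq {I : Ideal R} (h : I ≠ ⊥) :
    cls I = ClassGroup.mk0 ⟨I, mem_nonZeroDivisors_of_ne_zero h⟩ := by
  rw [cls, dif_neg h]

lemma cls_mul {I J : Ideal R} (hI : I ≠ ⊥) (hJ : J ≠ ⊥) : cls (I * J) = cls I * cls J := by
  rw [cls_eq hI, cls_eq hJ, cls_eq (mul_ne_zero hI hJ), ← map_mul]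
  rfl

lemma cls_pow {I : Ideal R} (hI : I ≠ ⊥) (n : ℕ) : cls (I ^ n) = cls I ^ n := by
  rw [cls_eq hI, cls_eq (pow_ne_zero n hI), ← map_pow]
  rfl

lemma cls_surj (c : ClassGroup R) : ∃ I : Ideal R, I ≠ ⊥ ∧ cls I = c := by
  obtain ⟨⟨I, hI⟩, rfl⟩ := ClassGroup.mk0_surjective c
  have : I ≠ ⊥ := nonZeroDivisors.ne_zero hI
  exact ⟨I, this, cls_eq this⟩

lemma cls_eq_iff {I J : Ideal R} (hI : I ≠ ⊥) (hJ : J ≠ ⊥) : cls I = cls J ↔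
    ∃ x y : R, x ≠ 0 ∧ y ≠ 0 ∧ Ideal.span {x} * I = Ideal.span {y} * J := by
  rw [cls_eq hI, cls_eq hJ, ClassGroup.mk0_eq_mk0_iff]
  constructor
  · rintro ⟨x, y, hx, hy, h⟩; exact ⟨x, y, hx, hy, h⟩
  · rintro ⟨x, y, hx, hy, h⟩; exact ⟨x, y, hx, hy, h⟩

lemma cls_span (x : R) : cls (Ideal.span {x}) = 1 := by
  by_cases h : Ideal.span {x} = ⊥
  · rw [cls, dif_pos h]
  · rw [cls_eq h, ClassGroup.mk0_eq_one_iff]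
    exact ⟨x, rfl⟩

lemma cls_eq_one {I : Ideal R} (hI : I ≠ ⊥) (h : cls I = 1) : ∃ x, x ≠ 0 ∧ I = Ideal.span {x} := by
  rw [cls_eq hI, ClassGroup.mk0_eq_one_iff] at h
  obtain ⟨x, hx⟩ := h
  refine ⟨x, ?_, hx⟩
  rintro rfl
  apply hI
  rw [hx]
  simp

lemma cls_of_pid [IsPrincipalIdealRing R] (c : ClassGroup R) : c = 1 := by
  obtain ⟨I, hI, rfl⟩ := cls_surj c
  obtain ⟨x, hx⟩ := (IsPrincipalIdealRing.principal I).principal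
  rw [hx]; exact cls_span x

end cls

section
variable {F K : Type*} [Field F] [Field K] [NumberField F] [NumberField K] [Algebra F K]
  {τ : K ≃+* K}

lemma jmap_ne_bot {b : Ideal (𝓞 F)} (hb : b ≠ ⊥) : b.map (algebraMap (𝓞 F) (𝓞 K)) ≠ ⊥ := by
  rwa [Ne, Ideal.map_eq_bot_iff_of_injective (FaithfulSMul.algebraMap_injective _ _)]

lemma relNorm_ne_bot {b : Ideal (𝓞 K)} (hb : b ≠ ⊥) : Ideal.relNorm (𝓞 F) b ≠ ⊥ := by
  rwa [Ne, Ideal.relNorm_eq_bot_iff]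

lemma cls_map_congr (σ : K ≃+* K) {I J : Ideal (𝓞 K)} (hI : I ≠ ⊥) (hJ : J ≠ ⊥)
    (h : cls I = cls J) : cls (I.map (TI σ)) = cls (J.map (TI σ)) := by
  obtain ⟨x, y, hx, hy, e⟩ := (cls_eq_iff hI hJ).1 h
  refine (cls_eq_iff (TI_map_ne_bot σ hI) (TI_map_ne_bot σ hJ)).2 ⟨TI σ x, TI σ y, ?_, ?_, ?_⟩
  · rwa [Ne, map_eq_zero_iff _ (TI_injective σ)]
  · rwa [Ne, map_eq_zero_iff _ (TI_injective σ)]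
  · have := congrArg (Ideal.map (TI σ)) e
    rwa [Ideal.map_mul, Ideal.map_mul, Ideal.map_span, Ideal.map_span, Set.image_singleton,
      Set.image_singleton] at this

lemma cls_jmap_congr {I J : Ideal (𝓞 F)} (hI : I ≠ ⊥) (hJ : J ≠ ⊥)
    (h : cls I = cls J) : cls (I.map (algebraMap (𝓞 F) (𝓞 K))) =
      cls (J.map (algebraMap (𝓞 F) (𝓞 K))) := by
  obtain ⟨x, y, hx, hy, e⟩ := (cls_eq_iff hI hJ).1 h
  have hinj := FaithfulSMul.algebraMap_injective (𝓞 F) (𝓞 K)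
  refine (cls_eq_iff (jmap_ne_bot hI) (jmap_ne_bot hJ)).2
    ⟨algebraMap (𝓞 F) (𝓞 K) x, algebraMap (𝓞 F) (𝓞 K) y, ?_, ?_, ?_⟩
  · rwa [Ne, map_eq_zero_iff _ hinj]
  · rwa [Ne, map_eq_zero_iff _ hinj]
  · have := congrArg (Ideal.map (algebraMap (𝓞 F) (𝓞 K))) e
    rwa [Ideal.map_mul, Ideal.map_mul, Ideal.map_span, Ideal.map_span, Set.image_singleton,
      Set.image_singleton] at this

lemma IsQ.cls_inv (h : IsQ F K τ) {I : Ideal (𝓞 K)} (hI : I ≠ ⊥)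
    (h1 : cls ((Ideal.relNorm (𝓞 F) I).map (algebraMap (𝓞 F) (𝓞 K))) = 1) :
    cls (I.map (TI τ)) = (cls I)⁻¹ := by
  rw [← h.mul_map_eq, cls_mul hI (TI_map_ne_bot τ hI)] at h1
  exact (inv_eq_of_mul_eq_one_right h1).symm

/-- the norm of ideals descends to classes -/
lemma relNorm_cls_congr {I J : Ideal (𝓞 K)} (hI : I ≠ ⊥) (hJ : J ≠ ⊥)
    (h : cls I = cls J) : cls (Ideal.relNorm (𝓞 F) I) = cls (Ideal.relNorm (𝓞 F) J) := by
  obtain ⟨x, y, hx, hy, e⟩ := (cls_eq_iff hI hJ).1 h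
  have e2 := congrArg (Ideal.relNorm (𝓞 F)) e
  rw [map_mul, map_mul, Ideal.relNorm_singleton, Ideal.relNorm_singleton] at e2
  refine (cls_eq_iff (relNorm_ne_bot hI) (relNorm_ne_bot hJ)).2 ⟨_, _, ?_, ?_, e2⟩
  · rwa [Ne, Algebra.intNorm_eq_zero]
  · rwa [Ne, Algebra.intNorm_eq_zero]

lemma relNorm_primary {I : Ideal (𝓞 K)} (hI : I ≠ ⊥)
    (h : cls I ∈ CommGroup.primaryComponent (ClassGroup (𝓞 K)) 2) :
    cls (Ideal.relNorm (𝓞 F) I) ∈ CommGroup.primaryComponent (ClassGroup (𝓞 F)) 2 := by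
  obtain ⟨n, hn⟩ := h
  refine ⟨n, ?_⟩
  rw [← cls_pow hI, ← cls_span (1 : 𝓞 K)] at hn
  rw [← cls_pow (relNorm_ne_bot hI), ← map_pow,
    relNorm_cls_congr (F := F) (pow_ne_zero _ hI) (by simp) hn, Ideal.relNorm_singleton, cls_span]

end

/-! ### Fractional ideals -/
section frac
variable {F K : Type*} [Field F] [Field K] [NumberField F] [NumberField K] [Algebra F K]
  {τ : K ≃+* K}

/-- action on fractional ideals -/
noncomputable def tF (τ : K ≃+* K) : FractionalIdeal (𝓞 K)⁰ K →+* FractionalIdeal (𝓞 K)⁰ K :=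
  FractionalIdeal.extendedHom' K
    (nonZeroDivisors_le_comap_nonZeroDivisors_of_injective (TI τ) (TI_injective τ))

lemma loc_map_eq (τ : K ≃+* K) (hf : (𝓞 K)⁰ ≤ (𝓞 K)⁰.comap (TI τ)) (x : K) :
    IsLocalization.map (M := (𝓞 K)⁰) (S := K) K (TI τ) hf x = τ x := by
  have : IsLocalization.map (M := (𝓞 K)⁰) (S := K) K (TI τ) hf = (τ : K →+* K) := by
    apply IsLocalization.ringHom_ext (𝓞 K)⁰
    ext y
    simp only [RingHom.comp_apply, IsLocalization.map_eq]
    rfl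
  rw [this]; rfl

lemma tF_coeIdeal (τ : K ≃+* K) (I : Ideal (𝓞 K)) :
    tF τ (I : FractionalIdeal (𝓞 K)⁰ K) = (I.map (TI τ) : Ideal (𝓞 K)) :=
  FractionalIdeal.extended_coeIdeal_eq_map K _ I

lemma tF_spanSingleton (τ : K ≃+* K) (x : K) :
    tF τ (FractionalIdeal.spanSingleton (𝓞 K)⁰ x) =
      FractionalIdeal.spanSingleton (𝓞 K)⁰ (τ x) := by
  refine (FractionalIdeal.extended_spanSingleton K _ x).trans ?_
  rw [loc_map_eq]

end frac

section units
variable {F K : Type*} [Field F] [Field K] [NumberField F] [NumberField K] [Algebra F K]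
  {τ : K ≃+* K}

/-- the inclusion of units into the multiplicative group of the field -/
noncomputable def uK (K : Type*) [Field K] [NumberField K] : (𝓞 K)ˣ →* Kˣ :=
  Units.map (algebraMap (𝓞 K) K : 𝓞 K →* K)

lemma uK_coe (u : (𝓞 K)ˣ) : ((uK K u : Kˣ) : K) = ((u : 𝓞 K) : K) := rfl

lemma uK_injective : Function.Injective (uK K) :=
  Units.map_injective (FaithfulSMul.algebraMap_injective (𝓞 K) K)

/-- norm on units -/
noncomputable def nU (F K : Type*) [Field F] [Field K] [NumberField F] [NumberField K]
    [Algebra F K] : (𝓞 K)ˣ →* (𝓞 F)ˣ := Units.map (Algebra.intNorm (𝓞 F) (𝓞 K))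

lemma nU_spec (h : IsQ F K τ) (u : (𝓞 K)ˣ) :
    algebraMap (𝓞 F) (𝓞 K) (nU F K u : 𝓞 F) = u * TI τ u := h.intNorm_eq _

/-- inclusion on units -/
noncomputable def iU (F K : Type*) [Field F] [Field K] [NumberField F] [NumberField K]
    [Algebra F K] : (𝓞 F)ˣ →* (𝓞 K)ˣ := Units.map (algebraMap (𝓞 F) (𝓞 K) : 𝓞 F →* 𝓞 K)

lemma iU_injective : Function.Injective (iU F K) :=
  Units.map_injective (FaithfulSMul.algebraMap_injective (𝓞 F) (𝓞 K))

lemma nU_iU (h : IsQ F K τ) (v : (𝓞 F)ˣ) : nU F K (iU F K v) = v ^ 2 := by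
  apply iU_injective (K := K)
  ext1
  change algebraMap (𝓞 F) (𝓞 K) (nU F K (iU F K v) : 𝓞 F) = algebraMap (𝓞 F) (𝓞 K) ((v : 𝓞 F) ^ 2)
  rw [nU_spec h, map_pow, pow_two]
  congr 1
  exact h.TI_fix _

lemma finrank_ker (h : IsQ F K τ) : Module.finrank ℤ (Additive (nU F K).ker) +
    Units.rank F = Units.rank K := by
  let f : Additive (𝓞 K)ˣ →ₗ[ℤ] Additive (𝓞 F)ˣ := (MonoidHom.toAdditive (nU F K)).toIntLinearMap
  have e1 := Submodule.finrank_quotient_add_finrank (LinearMap.ker f)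
  rw [Units.finrank_eq, (f.quotKerEquivRange).finrank_eq] at e1
  have e2 := Submodule.finrank_quotient_add_finrank (LinearMap.range f)
  rw [Units.finrank_eq] at e2
  have e3 : Module.finrank ℤ (Additive (𝓞 F)ˣ ⧸ LinearMap.range f) = 0 := by
    rw [Module.finrank_eq_zero_iff_isTorsion]
    intro x
    obtain ⟨v, rfl⟩ := Submodule.Quotient.mk_surjective _ x
    refine ⟨⟨2, mem_nonZeroDivisors_of_ne_zero (by norm_num)⟩, ?_⟩
    change (2 : ℤ) • (Submodule.Quotient.mk v : Additive (𝓞 F)ˣ ⧸ LinearMap.range f) = 0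
    rw [← Submodule.Quotient.mk_smul, Submodule.Quotient.mk_eq_zero]
    refine ⟨Additive.ofMul (iU F K v.toMul), ?_⟩
    change Additive.ofMul (nU F K (iU F K v.toMul)) = _
    rw [nU_iU h, ofMul_pow, ofNat_zsmul]
    rfl
  have e4 : Module.finrank ℤ (LinearMap.ker f) = Module.finrank ℤ (Additive (nU F K).ker) := by
    apply LinearEquiv.finrank_eq
    refine AddEquiv.toIntLinearEquiv ?_
    exact AddEquiv.mk ⟨fun x => Additive.ofMul ⟨x.1.toMul, x.2⟩, fun x => ⟨Additive.ofMul x.toMul.1,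
      x.toMul.2⟩, fun _ => rfl, fun _ => rfl⟩ (fun _ _ => rfl)
  omega

lemma two_torsion_card (R : Type*) [CommRing R] [IsDomain R] [CharZero R] (H : Subgroup Rˣ)
    (hH : -1 ∈ H) : Nat.card {x : H // x ^ 2 = 1} = 2 := by
  have h0 : (-1 : Rˣ) ≠ 1 := by
    intro h
    have := congrArg Units.val h
    norm_num at this
  rw [Nat.card_eq_two_iff]
  refine ⟨⟨1, one_pow 2⟩, ⟨⟨-1, hH⟩, Subtype.ext (by simp)⟩, ?_, ?_⟩
  · intro h
    have := congrArg (fun z => z.1.1) h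
    exact h0 this.symm
  · ext ⟨⟨x, hx⟩, hx2⟩
    simp only [Set.mem_insert_iff, Set.mem_singleton_iff, Set.mem_univ, iff_true]
    have : (x : R) ^ 2 = 1 := by
      have := congrArg (fun z : H => ((z : Rˣ) : R)) hx2
      simpa using this
    rcases mul_self_eq_one_iff.1 ((pow_two _).symm.trans this) with h | h
    · left; apply Subtype.ext; apply Subtype.ext; ext1; exact h
    · right; apply Subtype.ext; apply Subtype.ext; ext1; simpa using h

lemma index_sq_ker (h : IsQ F K τ) :
    (powMonoidHom 2 : (nU F K).ker →* (nU F K).ker).range.index * 2 ^ Units.rank F =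
      2 ^ (Units.rank K + 1) := by
  have : Module.Finite ℤ (Additive (nU F K).ker) := by
    let f : Additive (𝓞 K)ˣ →ₗ[ℤ] Additive (𝓞 F)ˣ :=
      (MonoidHom.toAdditive (nU F K)).toIntLinearMap
    have : Module.Finite ℤ (LinearMap.ker f) := inferInstance
    refine Module.Finite.equiv (M := LinearMap.ker f) (AddEquiv.toIntLinearEquiv ?_)
    exact AddEquiv.mk ⟨fun x => Additive.ofMul ⟨x.1.toMul, x.2⟩, fun x => ⟨Additive.ofMul x.toMul.1,
      x.toMul.2⟩, fun _ => rfl, fun _ => rfl⟩ (fun _ _ => rfl)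
  rw [aux_index_sq, ← pow_add, ← finrank_ker h]
  · congr 1; ring
  · apply two_torsion_card
    rw [MonoidHom.mem_ker]
    have : (-1 : (𝓞 K)ˣ) = iU F K (-1) := by
      ext1; simp [iU]
    rw [this, nU_iU h]
    simp

lemma index_sq_units (K : Type*) [Field K] [NumberField K] :
    (powMonoidHom 2 : (𝓞 K)ˣ →* (𝓞 K)ˣ).range.index = 2 ^ (Units.rank K + 1) := by
  rw [aux_index_sq, Units.finrank_eq]
  have := two_torsion_card (𝓞 K) ⊤ trivial
  refine Eq.trans ?_ this
  refine Nat.card_congr ⟨fun x => ⟨⟨x.1, trivial⟩, Subtype.ext x.2⟩,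
    fun x => ⟨x.1.1, congrArg Subtype.val x.2⟩, fun _ => rfl, fun _ => rfl⟩

end units

section T
variable {F K : Type*} [Field F] [Field K] [NumberField F] [NumberField K] [Algebra F K]
  {τ : K ≃+* K}

/-- nonzero ideal as a unit fractional ideal -/
noncomputable def uI {K : Type*} [Field K] [NumberField K] (I : Ideal (𝓞 K)) (hI : I ≠ ⊥) :
    (FractionalIdeal (𝓞 K)⁰ K)ˣ :=
  Units.mk0 (I : FractionalIdeal (𝓞 K)⁰ K) (by rwa [Ne, FractionalIdeal.coeIdeal_eq_zero])

lemma uI_coe {I : Ideal (𝓞 K)} (hI : I ≠ ⊥) :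
    (uI I hI : FractionalIdeal (𝓞 K)⁰ K) = I := rfl

lemma mk_uI {I : Ideal (𝓞 K)} (hI : I ≠ ⊥) : ClassGroup.mk K (uI I hI) = cls I := by
  rw [cls_eq hI, ← ClassGroup.mk_mk0 K]
  congr 1

/-- extension of fractional ideals -/
noncomputable def jF (F K : Type*) [Field F] [Field K] [NumberField F] [NumberField K]
    [Algebra F K] : (FractionalIdeal (𝓞 F)⁰ F)ˣ →* (FractionalIdeal (𝓞 K)⁰ K)ˣ :=
  Units.map (FractionalIdeal.extendedHom K (𝓞 K) :
    FractionalIdeal (𝓞 F)⁰ F →+* FractionalIdeal (𝓞 K)⁰ K)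

lemma jF_coe (b : (FractionalIdeal (𝓞 F)⁰ F)ˣ) : (jF F K b : FractionalIdeal (𝓞 K)⁰ K) =
  FractionalIdeal.extendedHom K (𝓞 K) (b : FractionalIdeal (𝓞 F)⁰ F) := rfl

lemma jF_uI {b : Ideal (𝓞 F)} (hb : b ≠ ⊥) :
    jF F K (uI b hb) = uI (b.map (algebraMap (𝓞 F) (𝓞 K))) (jmap_ne_bot hb) := by
  ext1
  rw [jF_coe, uI_coe, uI_coe, FractionalIdeal.extendedHom_coeIdeal_eq_map]

lemma jF_injective : Function.Injective (jF F K) :=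
  Units.map_injective (FractionalIdeal.extendedHom_injective (𝓞 F) F K (𝓞 K))

/-- every unit fractional ideal is integral up to a principal ideal from `F` -/
lemma exists_integral (I : (FractionalIdeal (𝓞 K)⁰ K)ˣ) :
    ∃ (n : ℤ) (hn : n ≠ 0) (J : Ideal (𝓞 K)) (hJ : J ≠ ⊥),
      I * uI (Ideal.span {(n : 𝓞 K)}) (by simpa using hn) = uI J hJ := by
  obtain ⟨a, J, ha, hJ⟩ := FractionalIdeal.exists_eq_spanSingleton_mul
    (I : FractionalIdeal (𝓞 K)⁰ K)
  obtain ⟨n, hn, b, hb⟩ : ∃ n : ℤ, n ≠ 0 ∧ ∃ b : 𝓞 K, a * b = n := by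
    refine ⟨Algebra.intNorm ℤ (𝓞 K) a, by rwa [Ne, Algebra.intNorm_eq_zero], ?_⟩
    obtain ⟨b, hb⟩ := Algebra.dvd_algebraMap_intNorm_self ℤ (𝓞 K) a
    exact ⟨b, by rw [← hb]; rfl⟩
  have hb0 : b ≠ 0 := by
    rintro rfl
    rw [mul_zero] at hb
    exact hn (by exact_mod_cast hb.symm)
  have hJ0 : J ≠ ⊥ := by
    rintro rfl
    have := I.ne_zero
    rw [hJ] at this
    simp at this
  refine ⟨n, hn, Ideal.span {b} * J, mul_ne_zero (by simpa using hb0) hJ0, ?_⟩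
  ext1
  rw [Units.val_mul, hJ, uI_coe, uI_coe, FractionalIdeal.coeIdeal_mul,
    FractionalIdeal.coeIdeal_span_singleton, FractionalIdeal.coeIdeal_span_singleton, ← hb,
    map_mul, mul_right_comm]
  congr 1
  rw [FractionalIdeal.spanSingleton_mul_spanSingleton]
  congr 1
  rw [inv_mul_cancel_left₀]
  rwa [Ne, FaithfulSMul.algebraMap_eq_zero_iff]

/-- action on unit fractional ideals -/
noncomputable def tU (τ : K ≃+* K) : (FractionalIdeal (𝓞 K)⁰ K)ˣ →* (FractionalIdeal (𝓞 K)⁰ K)ˣ :=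
  Units.map (tF τ : FractionalIdeal (𝓞 K)⁰ K →* FractionalIdeal (𝓞 K)⁰ K)

lemma tU_coe (I : (FractionalIdeal (𝓞 K)⁰ K)ˣ) :
    (tU τ I : FractionalIdeal (𝓞 K)⁰ K) = tF τ (I : FractionalIdeal (𝓞 K)⁰ K) := rfl

lemma tU_uI {I : Ideal (𝓞 K)} (hI : I ≠ ⊥) :
    tU τ (uI I hI) = uI (I.map (TI τ)) (TI_map_ne_bot τ hI) := by
  ext1
  rw [tU_coe, uI_coe, uI_coe, tF_coeIdeal]

lemma uI_inj {I J : Ideal (𝓞 K)} (hI : I ≠ ⊥) (hJ : J ≠ ⊥) : uI I hI = uI J hJ ↔ I = J := by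
  constructor
  · intro h
    have := congrArg Units.val h
    rwa [uI_coe, uI_coe, FractionalIdeal.coeIdeal_inj] at this
  · rintro rfl; rfl

lemma uI_mul {I J : Ideal (𝓞 K)} (hI : I ≠ ⊥) (hJ : J ≠ ⊥) :
    uI (I * J) (mul_ne_zero hI hJ) = uI I hI * uI J hJ := by
  ext1
  rw [Units.val_mul, uI_coe, uI_coe, uI_coe, FractionalIdeal.coeIdeal_mul]

lemma span_int_fix (σ : K ≃+* K) (n : ℤ) :
    (Ideal.span {(n : 𝓞 K)}).map (TI σ) = Ideal.span {(n : 𝓞 K)} := by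
  rw [Ideal.map_span, Set.image_singleton, map_intCast]

lemma tU_tU (h : IsQ F K τ) (I : (FractionalIdeal (𝓞 K)⁰ K)ˣ) : tU τ (tU τ I) = I := by
  obtain ⟨n, hn, J, hJ, e⟩ := exists_integral I
  have e2 := congrArg (fun z => tU τ (tU τ z)) e
  simp only [map_mul, tU_uI, h.map_map_TI] at e2
  rw [← e] at e2
  exact mul_right_cancel e2

lemma tU_jF (h : IsQ F K τ) (I : (FractionalIdeal (𝓞 F)⁰ F)ˣ) : tU τ (jF F K I) = jF F K I := by
  obtain ⟨n, hn, J, hJ, e⟩ := exists_integral I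
  have e1 := congrArg (jF F K) e
  have e2 := congrArg (fun z => tU τ (jF F K z)) e
  simp only [map_mul, tU_uI, jF_uI, h.map_TI_algebraMap] at e2 e1
  rw [← e1] at e2
  exact mul_right_cancel e2

lemma not_mem_jF {P1 : Ideal (𝓞 K)} (hP1 : P1 ≠ ⊥) {p1 : Ideal (𝓞 F)} (hp1 : p1 ≠ ⊥)
    (e1 : p1.map (algebraMap (𝓞 F) (𝓞 K)) = P1 ^ 2) (hsq : ∀ b : Ideal (𝓞 F), b ^ 2 ≠ p1) :
    uI P1 hP1 ∉ (jF F K).range := by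
  rintro ⟨b, hb⟩
  have h1 : FractionalIdeal.extendedHom K (𝓞 K) (b : FractionalIdeal (𝓞 F)⁰ F) ≤ 1 := by
    rw [← jF_coe, hb, uI_coe]
    exact FractionalIdeal.coeIdeal_le_one
  rw [FractionalIdeal.extendedHom_le_one_iff] at h1
  obtain ⟨c, hc⟩ := FractionalIdeal.le_one_iff_exists_coeIdeal.1 h1
  have hc0 : c ≠ ⊥ := by
    rintro rfl
    apply b.ne_zero
    rw [← hc]; simp
  have hbc : b = uI c hc0 := by ext1; rw [uI_coe, hc]
  apply hsq c
  rw [← uI_inj (pow_ne_zero 2 hc0) hp1]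
  apply jF_injective (K := K)
  rw [jF_uI, jF_uI, uI_inj, e1, Ideal.map_pow]
  congr 1
  rw [hbc, jF_uI, uI_inj] at hb
  exact hb

lemma sq_ne_prime {R : Type*} [CommRing R] [IsDedekindDomain R] {p : Ideal R} (hp : p.IsPrime)
    (h0 : p ≠ ⊥) (b : Ideal R) : b ^ 2 ≠ p := by
  intro h
  have h1 := (Ideal.prime_of_isPrime h0 hp).irreducible
  rw [← h] at h1
  exact not_irreducible_pow (by norm_num) h1

lemma sq_ne_prime_mul {R : Type*} [CommRing R] [IsDedekindDomain R] {p q : Ideal R}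
    (hp : p.IsPrime) (h0 : p ≠ ⊥) (hq : q.IsPrime) (hq0 : q ≠ ⊥) (hpq : p ≠ q)
    (b : Ideal R) : b ^ 2 ≠ p * q := by
  intro h
  have hpp := (Ideal.prime_of_isPrime h0 hp)
  have h1 : p ∣ b := hpp.dvd_of_dvd_pow (n := 2) (h ▸ dvd_mul_right p q)
  obtain ⟨c, rfl⟩ := h1
  have h2 : p * (p * c ^ 2) = p * q := by rw [← h]; ring
  have h3 := mul_left_cancel₀ h0 h2
  have h4 : q ≤ p := Ideal.dvd_iff_le.1 ⟨c ^ 2, h3.symm⟩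
  exact hpq ((hq.isMaximal hq0).eq_of_le hp.ne_top h4).symm

theorem relIndex_inv (h : IsQ F K τ) {P1 P2 : Ideal (𝓞 K)} {p1 p2 : Ideal (𝓞 F)}
    (hp1 : p1.IsPrime) (hp2 : p2.IsPrime) (h10 : p1 ≠ ⊥) (h20 : p2 ≠ ⊥) (hp12 : p1 ≠ p2)
    (e1 : p1.map (algebraMap (𝓞 F) (𝓞 K)) = P1 ^ 2)
    (e2 : p2.map (algebraMap (𝓞 F) (𝓞 K)) = P2 ^ 2)
    (hram : ∀ P : Ideal (𝓞 K), P.IsPrime → P ≠ ⊥ → (∀ x, x - TI τ x ∈ P) → P = P1 ∨ P = P2)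
    (U : Subgroup (FractionalIdeal (𝓞 K)⁰ K)ˣ) (hU : ∀ I, I ∈ U ↔ tU τ I = I) :
    (jF F K).range.relIndex U = 4 := by
  have hP1 : P1 ≠ ⊥ := by
    rintro rfl
    exact jmap_ne_bot (K := K) h10 (by rw [e1]; simp)
  have hP2 : P2 ≠ ⊥ := by
    rintro rfl
    exact jmap_ne_bot (K := K) h20 (by rw [e2]; simp)
  have hf1 : P1.map (TI τ) = P1 := by
    have := h.map_TI_algebraMap p1
    rw [e1, Ideal.map_pow] at this
    exact (pow_left_inj two_ne_zero).1 this
  have hf2 : P2.map (TI τ) = P2 := by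
    have := h.map_TI_algebraMap p2
    rw [e2, Ideal.map_pow] at this
    exact (pow_left_inj two_ne_zero).1 this
  have hjU : (jF F K).range ≤ U := by
    rintro _ ⟨b, rfl⟩
    exact (hU _).2 (tU_jF h b)
  apply aux_relIndex_four _ U (uI P1 hP1) (uI P2 hP2)
  · apply le_antisymm
    · set H := (jF F K).range ⊔ Subgroup.zpowers (uI P1 hP1) ⊔ Subgroup.zpowers (uI P2 hP2) with hH
      have key := h.inv_induction (fun I => ∀ hI : I ≠ ⊥, uI I hI ∈ H) ?_ ?_ ?_
      · intro I hI
        obtain ⟨n, hn, J, hJ, e⟩ := exists_integral I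
        rw [hU] at hI
        have hJf : J.map (TI τ) = J := by
          have := congrArg (tU τ) e
          rw [map_mul, hI, tU_uI, tU_uI] at this
          simp only [span_int_fix] at this
          rw [e, uI_inj] at this
          exact this.symm
        have h1 := key J hJ hJf hJ
        rw [← e] at h1
        refine (Subgroup.mul_mem_cancel_right H ?_).1 h1
        refine Subgroup.mem_sup_left (Subgroup.mem_sup_left
          ⟨uI (Ideal.span {(n : 𝓞 F)}) (by simpa using hn), ?_⟩)
        rw [jF_uI, uI_inj, Ideal.map_span, Set.image_singleton, map_intCast]
      · intro I J hI hJ h1 h2 _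
        rw [uI_mul hI hJ]
        exact H.mul_mem (h1 hI) (h2 hJ)
      · intro b hb _
        exact Subgroup.mem_sup_left (Subgroup.mem_sup_left ⟨uI b hb, jF_uI hb⟩)
      · intro P hP hP0 _ _ hx _
        rcases hram P hP hP0 hx with rfl | rfl
        · exact Subgroup.mem_sup_left (Subgroup.mem_sup_right (Subgroup.mem_zpowers _))
        · exact Subgroup.mem_sup_right (Subgroup.mem_zpowers _)
    · refine sup_le (sup_le hjU ?_) ?_
      · rw [Subgroup.zpowers_le, hU, tU_uI, uI_inj, hf1]
      · rw [Subgroup.zpowers_le, hU, tU_uI, uI_inj, hf2]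
  · refine ⟨uI p1 h10, ?_⟩
    rw [jF_uI, pow_two, ← uI_mul, uI_inj, e1, pow_two]
  · refine ⟨uI p2 h20, ?_⟩
    rw [jF_uI, pow_two, ← uI_mul, uI_inj, e2, pow_two]
  · exact not_mem_jF hP1 h10 e1 (sq_ne_prime hp1 h10)
  · exact not_mem_jF hP2 h20 e2 (sq_ne_prime hp2 h20)
  · rw [← uI_mul]
    exact not_mem_jF (mul_ne_zero hP1 hP2) (mul_ne_zero h10 h20)
      (by rw [Ideal.map_mul, e1, e2, mul_pow]) (sq_ne_prime_mul hp1 h10 hp2 h20 hp12)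

end T

section T2
variable {F K : Type*} [Field F] [Field K] [NumberField F] [NumberField K] [Algebra F K]
  {τ : K ≃+* K}

lemma ker_toPrincipal : (toPrincipalIdeal (𝓞 K) K).ker = (uK K).range := by
  ext x
  rw [MonoidHom.mem_ker, toPrincipalIdeal_eq_iff]
  constructor
  · intro hx
    have aux : ∀ y : Kˣ, FractionalIdeal.spanSingleton (𝓞 K)⁰ (y : K) = 1 →
        ∃ a : 𝓞 K, (a : K) = y := by
      intro y hy
      have : (y : K) ∈ (1 : FractionalIdeal (𝓞 K)⁰ K) := by
        rw [← hy]; exact FractionalIdeal.mem_spanSingleton_self _ _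
      exact (FractionalIdeal.mem_one_iff _).1 this
    rw [Units.val_one] at hx
    obtain ⟨a, ha⟩ := aux x hx
    obtain ⟨b, hb⟩ := aux x⁻¹ (by
      have := FractionalIdeal.spanSingleton_mul_spanSingleton (S := (𝓞 K)⁰) (x : K) ((x⁻¹ : Kˣ) : K)
      rw [hx, one_mul] at this
      rw [this]; simp)
    refine ⟨Units.mkOfMulEqOne a b ?_, ?_⟩
    · apply RingOfIntegers.ext
      change (a : K) * (b : K) = 1
      rw [ha, hb]; simp
    · ext1; exact ha
  · rintro ⟨u, rfl⟩
    rw [uK_coe, Units.val_one, ← FractionalIdeal.coeIdeal_span_singleton,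
      Ideal.span_singleton_eq_top.2 u.isUnit]
    simp

lemma range_toPrincipal : (toPrincipalIdeal (𝓞 K) K).range = (ClassGroup.mk (R := 𝓞 K) K).ker := by
  ext I
  rw [MonoidHom.mem_ker, ClassGroup.mk_eq_one_iff, mem_principal_ideals_iff,
    FractionalIdeal.isPrincipal_iff]
  simp only [eq_comm]

lemma mk_surj : Function.Surjective (ClassGroup.mk (R := 𝓞 K) K) := by
  intro c
  obtain ⟨I, hI, rfl⟩ := cls_surj c
  exact ⟨uI I hI, mk_uI hI⟩

lemma uK_iU (v : (𝓞 F)ˣ) : ((uK K (iU F K v) : Kˣ) : K) = algebraMap F K ((v : 𝓞 F) : F) := by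
  rw [uK_coe]; rfl

lemma sqIndex_transfer {G H : Type*} [CommGroup G] [CommGroup H] (e : G ≃* H) :
    (powMonoidHom 2 : G →* G).range.index = (powMonoidHom 2 : H →* H).range.index := by
  rw [← Subgroup.index_map_equiv _ e]
  congr 1
  ext x
  simp only [Subgroup.mem_map, MonoidHom.mem_range, powMonoidHom_apply]
  constructor
  · rintro ⟨_, ⟨y, rfl⟩, rfl⟩
    exact ⟨e y, by simp⟩
  · rintro ⟨y, rfl⟩
    exact ⟨_, ⟨e.symm y, rfl⟩, by simp⟩

lemma frac_map_eq (x : F) : IsFractionRing.map (K := F) (L := K)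
    (FaithfulSMul.algebraMap_injective (𝓞 F) (𝓞 K)) x = algebraMap F K x := by
  have : IsFractionRing.map (K := F) (L := K)
    (FaithfulSMul.algebraMap_injective (𝓞 F) (𝓞 K)) = algebraMap F K := by
    apply IsLocalization.ringHom_ext (𝓞 F)⁰
    ext y
    simp only [RingHom.comp_apply, IsFractionRing.map, IsLocalization.map_eq]
    rfl
  rw [this]

lemma int_of_algebraMap (z : F) (t : 𝓞 K) (hz : algebraMap F K z = (t : K)) : IsIntegral ℤ z := by
  have h1 : IsIntegral ℤ (t : K) := RingOfIntegers.isIntegral_coe t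
  rw [← hz] at h1
  exact (isIntegral_algebraMap_iff (FaithfulSMul.algebraMap_injective F K)).1 h1

lemma fixed_unit (h : IsQ F K τ) (u : (𝓞 K)ˣ) (hu : τ ((u : 𝓞 K) : K) = ((u : 𝓞 K) : K)) :
    ∃ w : (𝓞 F)ˣ, iU F K w = u := by
  have hinv : (((u⁻¹ : (𝓞 K)ˣ) : 𝓞 K) : K) = (((u : 𝓞 K) : K))⁻¹ := by
    apply eq_inv_of_mul_eq_one_left
    rw [← map_mul, Units.inv_mul, map_one]
  obtain ⟨y, hy⟩ := h.exists_of_fixed hu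
  obtain ⟨y', hy'⟩ := h.exists_of_fixed (x := (((u⁻¹ : (𝓞 K)ˣ) : 𝓞 K) : K))
    (by rw [hinv, map_inv₀, hu])
  refine ⟨Units.mkOfMulEqOne ⟨y, int_of_algebraMap _ _ hy⟩ ⟨y', int_of_algebraMap _ _ hy'⟩ ?_, ?_⟩
  · apply RingOfIntegers.ext
    apply FaithfulSMul.algebraMap_injective F K
    change algebraMap F K (y * y') = algebraMap F K 1
    rw [map_mul, hy, hy', ← map_mul, Units.mul_inv, map_one, map_one]
  · ext1
    apply RingOfIntegers.ext
    exact hy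

theorem theoremT (h : IsQ F K τ)
    (H1 : ∀ I : Ideal (𝓞 K), I ≠ ⊥ → cls I ∈ CommGroup.primaryComponent (ClassGroup (𝓞 K)) 2 →
      cls (I.map (TI τ)) = cls I)
    (H2 : ∀ v : (𝓞 F)ˣ, (∃ x : K, x * τ x = algebraMap F K ((v : 𝓞 F) : F)) → v ∈ (nU F K).range)
    {P1 P2 : Ideal (𝓞 K)} {p1 p2 : Ideal (𝓞 F)}
    (hp1 : p1.IsPrime) (hp2 : p2.IsPrime) (h10 : p1 ≠ ⊥) (h20 : p2 ≠ ⊥) (hp12 : p1 ≠ p2)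
    (e1 : p1.map (algebraMap (𝓞 F) (𝓞 K)) = P1 ^ 2)
    (e2 : p2.map (algebraMap (𝓞 F) (𝓞 K)) = P2 ^ 2)
    (hram : ∀ P : Ideal (𝓞 K), P.IsPrime → P ≠ ⊥ → (∀ x, x - TI τ x ∈ P) → P = P1 ∨ P = P2)
    (H4 : (powMonoidHom 2 : (𝓞 F)ˣ →* (𝓞 F)ˣ).range.relIndex (nU F K).range = 2) :
    Nat.card (CommGroup.primaryComponent (ClassGroup (𝓞 K)) 2) * 2 ^ (Units.rank K + 1) =
      Nat.card (CommGroup.primaryComponent (ClassGroup (𝓞 F)) 2) * 2 ^ (3 + Units.rank F) := by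
  let pr := toPrincipalIdeal (𝓞 K) K
  let tX : Kˣ →* Kˣ := Units.map (τ : K →* K)
  have htX : ∀ x : Kˣ, ((tX x : Kˣ) : K) = τ x := fun _ => rfl
  have hpr : ∀ x, tU τ (pr x) = pr (tX x) := by
    intro x
    ext1
    rw [tU_coe, coe_toPrincipalIdeal, coe_toPrincipalIdeal, tF_spanSingleton]
    rfl
  let U : Subgroup (FractionalIdeal (𝓞 K)⁰ K)ˣ := (tU τ).eqLocus (MonoidHom.id _)
  have hU : ∀ I, I ∈ U ↔ tU τ I = I := fun I => Iff.rfl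
  let C : Subgroup (FractionalIdeal (𝓞 K)⁰ K)ˣ := pr.range.comap (tU τ / MonoidHom.id _)
  have hC : ∀ I, I ∈ C ↔ ∃ x, tU τ I = I * pr x := by
    intro I
    change (∃ x, pr x = tU τ I / I) ↔ _
    simp only [eq_div_iff_mul_eq', eq_comm, mul_comm]
  have hi : ∀ x : Kˣ, tX x = x ↔ ∃ y, (Units.map (algebraMap F K : F →* K)) y = x := by
    intro x
    constructor
    · intro hx
      have := congrArg Units.val hx
      rw [htX] at this
      obtain ⟨y, hy⟩ := h.exists_of_fixed this
      have hy0 : y ≠ 0 := by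
        rintro rfl
        rw [map_zero] at hy
        exact x.ne_zero hy.symm
      exact ⟨Units.mk0 y hy0, by ext1; exact hy⟩
    · rintro ⟨y, rfl⟩
      ext1
      exact h.fix _
  have hEN : ∀ u : (𝓞 K)ˣ, uK K u * tX (uK K u) = uK K (iU F K (nU F K u)) := by
    intro u
    ext1
    rw [Units.val_mul, htX, uK_coe, uK_coe]
    have := congrArg (algebraMap (𝓞 K) K) (nU_spec h u)
    rw [map_mul] at this
    exact this.symm
  have amb := aux_ambiguous (jF F K) (tU τ) pr (toPrincipalIdeal (𝓞 F) F)
    (Units.map (algebraMap F K : F →* K)) tX jF_injective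
    (fun x => by ext1; exact h.invol _) (tU_tU h) hpr
    (fun x => by
      ext1
      rw [jF_coe, coe_toPrincipalIdeal, coe_toPrincipalIdeal,
        FractionalIdeal.extendedHom_spanSingleton]
      congr 1
      exact frac_map_eq _)
    hi (tU_jF h)
    (by
      intro x hx
      have hx' : (x : K) * τ x = 1 := congrArg Units.val hx
      obtain ⟨y, hy0, hy⟩ := h.hilbert90 hx'
      exact ⟨Units.mk0 y hy0, by ext1; exact hy⟩)
    (by
      intro x hx
      rw [ker_toPrincipal] at hx ⊢
      obtain ⟨v, hv⟩ := hx
      have hv1 : ((v : 𝓞 K) : K) = x * τ x := congrArg Units.val hv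
      obtain ⟨w, hw⟩ := fixed_unit h v (by rw [hv1, map_mul, h.invol, mul_comm])
      obtain ⟨u, hu⟩ := H2 w ⟨x, by rw [← uK_iU, hw]; exact hv1.symm⟩
      refine ⟨uK K u, ⟨u, rfl⟩, ?_⟩
      rw [hEN, hu, hw, hv])
    U C hU hC (uK K).range ((nU F K).ker.map (uK K)) ker_toPrincipal.symm
    (by
      intro u
      constructor
      · rintro ⟨v, hv, rfl⟩
        refine ⟨⟨v, rfl⟩, ?_⟩
        rw [hEN, MonoidHom.mem_ker.1 hv, map_one, map_one]
      · rintro ⟨⟨v, rfl⟩, hv⟩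
        rw [hEN] at hv
        refine ⟨v, ?_, rfl⟩
        apply MonoidHom.mem_ker.2
        apply iU_injective (K := K)
        apply uK_injective
        rw [hv, map_one, map_one])
    ((nU F K).range.map ((uK K).comp (iU F K)))
    ((powMonoidHom 2 : (𝓞 F)ˣ →* (𝓞 F)ˣ).range.map ((uK K).comp (iU F K)))
    (by
      intro x
      constructor
      · rintro ⟨_, ⟨u, rfl⟩, rfl⟩
        exact ⟨uK K u, ⟨u, rfl⟩, hEN u⟩
      · rintro ⟨_, ⟨u, rfl⟩, rfl⟩
        exact ⟨_, ⟨u, rfl⟩, (hEN u).symm⟩)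
    (by
      intro x
      constructor
      · rintro ⟨_, ⟨u, rfl⟩, rfl⟩
        refine ⟨uK K (iU F K u), ⟨_, rfl⟩, ?_, ?_⟩
        · ext1
          rw [htX, uK_iU, h.fix]
        · simp [pow_two]
      · rintro ⟨_, ⟨u, rfl⟩, hfix, rfl⟩
        obtain ⟨w, hw⟩ := fixed_unit h u (congrArg Units.val hfix)
        refine ⟨_, ⟨w, rfl⟩, ?_⟩
        change uK K (iU F K (w ^ 2)) = _
        rw [map_pow, map_pow, hw, pow_two])
  rw [Subgroup.relIndex_map_map_of_injective _ _ (f := (uK K).comp (iU F K))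
      (by exact uK_injective.comp iU_injective), H4,
    relIndex_inv h hp1 hp2 h10 h20 hp12 e1 e2 hram U hU, range_toPrincipal, range_toPrincipal,
    Subgroup.relIndex_ker, Subgroup.index_ker, MonoidHom.range_eq_top.2 mk_surj,
    Subgroup.card_top, ← sqIndex_transfer ((nU F K).ker.equivMapOfInjective _ uK_injective)] at amb
  obtain ⟨m1, hm1, hm1'⟩ := aux_primary_le (ClassGroup (𝓞 K)) (C.map (ClassGroup.mk K)) (by
    intro c hc
    obtain ⟨I, hI, rfl⟩ := cls_surj c
    refine ⟨uI I hI, ?_, mk_uI hI⟩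
    have := H1 I hI hc
    rw [← mk_uI hI, ← mk_uI (TI_map_ne_bot τ hI), ← tU_uI hI] at this
    change _ ∈ pr.range
    change _ ∈ (toPrincipalIdeal (𝓞 K) K).range
    rw [range_toPrincipal, MonoidHom.mem_ker, MonoidHom.div_apply, map_div, this]
    simp)
  obtain ⟨m2, hm2, hm2'⟩ := aux_primary_card (ClassGroup (𝓞 F))
  refine aux_two_part m1 m2 hm1' hm2' (aux_primary_isPow _) (aux_primary_isPow _) hm1 hm2 ?_
  rw [← index_sq_ker h, ← mul_assoc, amb]
  ring

end T2

section gen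
variable {F K : Type*} [Field F] [Field K] [CharZero F] [Algebra F K] {τ : K ≃+* K}

lemma exists_isQ (hfin : Module.finrank F K = 2) (θ : K) (h1 : ∀ x : F, algebraMap F K x ≠ θ)
    (d : F) (h2 : θ ^ 2 = algebraMap F K d) : ∃ τ : K ≃+* K, IsQ F K τ ∧ τ θ = -θ := by
  have : Algebra.IsQuadraticExtension F K := ⟨hfin⟩
  have : FiniteDimensional F K := FiniteDimensional.of_finrank_pos (by omega)
  have : IsGalois F K := ⟨⟩
  have h3 : θ ∉ Set.range (algebraMap F K) := by rintro ⟨x, hx⟩; exact h1 x hx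
  rw [IsGalois.mem_range_algebraMap_iff_fixed] at h3
  push Not at h3
  obtain ⟨f, hf⟩ := h3
  refine ⟨f.toRingEquiv, ⟨hfin, fun x => f.commutes x, θ, hf⟩, ?_⟩
  have h4 : (f θ) ^ 2 = θ ^ 2 := by rw [← map_pow, h2, f.commutes]
  rcases sq_eq_sq_iff_eq_or_eq_neg.1 h4 with h | h
  · exact absurd h hf
  · exact h

lemma IsQ.decomp (h : IsQ F K τ) {θ : K} (h0 : θ ≠ 0) (hθ : τ θ = -θ) (x : K) :
    ∃ a b : F, x = algebraMap F K a + algebraMap F K b * θ := by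
  obtain ⟨a, ha⟩ := h.exists_of_fixed (x := x + τ x) (by rw [map_add, h.invol, add_comm])
  obtain ⟨b, hb⟩ := h.exists_of_fixed (x := (x - τ x) / θ) (by
    rw [map_div₀, map_sub, h.invol, hθ, div_neg, ← neg_div, neg_sub])
  have : CharZero K := charZero_of_injective_algebraMap (algebraMap F K).injective
  refine ⟨a / 2, b / 2, ?_⟩
  rw [map_div₀, map_div₀, ha, hb, map_ofNat]
  field_simp
  ring

/-- uniqueness of the decomposition -/
lemma IsQ.decomp_unique (h : IsQ F K τ) {θ : K} (h0 : θ ≠ 0) (hθ : τ θ = -θ) {a b a' b' : F}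
    (e : algebraMap F K a + algebraMap F K b * θ = algebraMap F K a' + algebraMap F K b' * θ) :
    a = a' ∧ b = b' := by
  have : CharZero K := charZero_of_injective_algebraMap (algebraMap F K).injective
  have e2 := congrArg τ e
  rw [map_add, map_add, map_mul, map_mul, hθ, h.fix, h.fix, h.fix, h.fix] at e2
  have e3 : algebraMap F K a = algebraMap F K a' := by linear_combination (e + e2) / 2
  have e4 : algebraMap F K b = algebraMap F K b' := by
    apply mul_right_cancel₀ h0
    linear_combination (e - e2) / 2
  exact ⟨(algebraMap F K).injective e3, (algebraMap F K).injective e4⟩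

end gen

section gen2
variable {F K : Type*} [Field F] [Field K] [NumberField F] [NumberField K] [Algebra F K]
  {τ : K ≃+* K}

lemma pid_of_euclid (K : Type*) [Field K] [NumberField K]
    (H : ∀ x : K, ∃ y : 𝓞 K, |Algebra.norm ℚ (x - (y : K))| < 1) :
    IsPrincipalIdealRing (𝓞 K) := by
  constructor
  intro I
  by_cases hI : I = ⊥
  · exact ⟨0, by simp [hI]⟩
  obtain ⟨x0, hx0, hx00⟩ := Submodule.exists_mem_ne_zero_of_ne_bot hI
  have hex : ∃ n : ℕ, ∃ x ∈ I, x ≠ 0 ∧ (Algebra.norm ℤ x).natAbs = n := ⟨_, x0, hx0, hx00, rfl⟩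
  classical
  obtain ⟨x, hx, hx1, hx2⟩ := Nat.find_spec hex
  refine ⟨x, ?_⟩
  apply le_antisymm
  · intro z hz
    have hxK : (x : K) ≠ 0 := by simpa using hx1
    obtain ⟨y, hy⟩ := H ((z : K) / x)
    rw [Ideal.submodule_span_eq, Ideal.mem_span_singleton']
    refine ⟨y, ?_⟩
    by_contra hne
    have hw : z - y * x ∈ I := I.sub_mem hz (I.mul_mem_left _ hx)
    have hw0 : z - y * x ≠ 0 := fun h => hne (sub_eq_zero.1 h).symm
    have hlt : (Algebra.norm ℤ (z - y * x)).natAbs < Nat.find hex := by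
      rw [← hx2]
      have e : (((z - y * x : 𝓞 K)) : K) = ((z : K) / x - y) * x := by
        push_cast
        field_simp
      have e2 : |((Algebra.norm ℤ (z - y * x) : ℤ) : ℚ)| < |((Algebra.norm ℤ x : ℤ) : ℚ)| := by
        rw [Algebra.coe_norm_int, Algebra.coe_norm_int, e, map_mul, abs_mul]
        have : 0 < |Algebra.norm ℚ (x : K)| := by
          rw [abs_pos, Ne, Algebra.norm_eq_zero_iff]
          exact hxK
        nlinarith
      zify
      exact_mod_cast e2
    exact Nat.find_min hex hlt ⟨_, hw, hw0, rfl⟩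
  · rw [Ideal.submodule_span_eq, Ideal.span_singleton_le_iff_mem]
    exact hx

/-- clear denominators by an integer -/
lemma exists_int_mul (x : K) : ∃ n : ℤ, n ≠ 0 ∧ ∃ a : 𝓞 K, (a : K) = n * x := by
  obtain ⟨n, hn, h⟩ := ((IsFractionRing.isAlgebraic_iff ℤ ℚ K).2
    (Algebra.IsAlgebraic.isAlgebraic (R := ℚ) x)).exists_integral_multiple
  exact ⟨n, hn, ⟨n • x, h⟩, by simp [zsmul_eq_mul]⟩

theorem two_torsion_mem (h : IsQ F K τ) [IsPrincipalIdealRing (𝓞 F)]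
    (H2 : ∀ v : (𝓞 F)ˣ, (∃ x : K, x * τ x = algebraMap F K ((v : 𝓞 F) : F)) → v ∈ (nU F K).range)
    (H : Subgroup (ClassGroup (𝓞 K)))
    (hram : ∀ P : Ideal (𝓞 K), P.IsPrime → P ≠ ⊥ → (∀ x, x - TI τ x ∈ P) → cls P ∈ H)
    (c : ClassGroup (𝓞 K)) (hc : c ^ 2 = 1) : c ∈ H := by
  have hpid : ∀ b : Ideal (𝓞 F), b ≠ ⊥ → cls (b.map (algebraMap (𝓞 F) (𝓞 K))) = 1 := by
    intro b hb
    obtain ⟨x, hx0, rfl⟩ := cls_eq_one hb (cls_of_pid _)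
    rw [Ideal.map_span, Set.image_singleton, cls_span]
  obtain ⟨I, hI, rfl⟩ := cls_surj c
  have hτI := TI_map_ne_bot τ hI
  have h1 : cls (I.map (TI τ)) = cls I := by
    rw [h.cls_inv hI (hpid _ (relNorm_ne_bot hI)), inv_eq_iff_mul_eq_one, ← pow_two, hc]
  obtain ⟨a, b, ha, hb, e⟩ := (cls_eq_iff hτI hI).1 h1
  -- relation between the norms of a and b
  have e' := congrArg (Ideal.map (TI τ)) e
  rw [Ideal.map_mul, Ideal.map_mul, Ideal.map_span, Ideal.map_span, Set.image_singleton,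
      Set.image_singleton, h.map_map_TI] at e'
  have e3 : Ideal.span {a * TI τ a} = Ideal.span {b * TI τ b} := by
    apply mul_right_cancel₀ hI
    rw [← Ideal.span_singleton_mul_span_singleton, ← Ideal.span_singleton_mul_span_singleton,
      mul_assoc, e', mul_left_comm, e]
    ring
  obtain ⟨v, hv⟩ := Ideal.span_singleton_eq_span_singleton.1 e3
  have hvK : (a : K) * τ a * ((v : 𝓞 K) : K) = b * τ b := congrArg (algebraMap (𝓞 K) K) hv
  have haK : (a : K) ≠ 0 := by simpa using ha
  have hbK : (b : K) ≠ 0 := by simpa using hb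
  have hτaK : τ (a : K) ≠ 0 := by simpa using ha
  have hτbK : τ (b : K) ≠ 0 := by simpa using hb
  have hvf : ((v : 𝓞 K) : K) = (b : K) / a * τ ((b : K) / a) := by
    rw [map_div₀]; field_simp; linear_combination hvK
  obtain ⟨w, hw⟩ := fixed_unit h v (by rw [hvf, map_mul, h.invol, mul_comm])
  obtain ⟨u, hu⟩ := H2 w ⟨(b : K) / a, by rw [← hvf, ← hw]; rfl⟩
  have huv : (v : 𝓞 K) = u * TI τ u := by rw [← nU_spec h, hu, ← hw]; rfl
  have huv' : ((v : 𝓞 K) : K) = ((u : 𝓞 K) : K) * τ ((u : 𝓞 K) : K) :=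
    congrArg (algebraMap (𝓞 K) K) huv
  have huK : ((u : 𝓞 K) : K) ≠ 0 := by simp
  have hτuK : τ ((u : 𝓞 K) : K) ≠ 0 := by simp
  obtain ⟨y0, hy00, hy0⟩ := h.hilbert90 (x := (b : K) / a / ((u : 𝓞 K) : K)) (by
    rw [map_div₀, map_div₀]
    field_simp
    rw [hvf, map_div₀] at huv'
    field_simp at huv'
    linear_combination huv')
  obtain ⟨n, hn, y, hy⟩ := exists_int_mul y0
  have hy1 : y ≠ 0 := by
    rintro rfl
    have : (n : K) * y0 = 0 := by rw [← hy]; simp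
    have hn' : (n : K) ≠ 0 := by exact_mod_cast hn
    exact mul_ne_zero hn' hy00 this
  have e4 : b * TI τ y = a * u * y := by
    apply RingOfIntegers.ext
    change (b : K) * τ (y : K) = a * ((u : 𝓞 K) : K) * y
    rw [hy, map_mul, map_intCast]
    field_simp at hy0
    linear_combination (n : K) * hy0
  have hJ : (Ideal.span {y} * I).map (TI τ) = Ideal.span {y} * I := by
    have ha' : Ideal.span {a} ≠ ⊥ := by simpa using ha
    apply mul_left_cancel₀ ha'
    rw [Ideal.map_mul, Ideal.map_span, Set.image_singleton, mul_left_comm, e, ← mul_assoc,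
      ← mul_assoc, Ideal.span_singleton_mul_span_singleton, mul_comm (TI τ y), e4,
      Ideal.span_singleton_mul_span_singleton]
    congr 1
    rw [mul_right_comm]
    exact Ideal.span_singleton_mul_right_unit u.isUnit _
  have hy' : Ideal.span {y} ≠ ⊥ := by simpa using hy1
  have key := h.inv_induction (fun J => cls J ∈ H)
    (fun I J hI hJ h1 h2 => by rw [cls_mul hI hJ]; exact H.mul_mem h1 h2)
    (fun b hb => by rw [hpid b hb]; exact H.one_mem)
    (fun P hP hP0 _ _ hx => hram P hP hP0 hx) _ (mul_ne_zero hy' hI) hJ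
  rwa [cls_mul hy' hI, cls_span, one_mul] at key

end gen2

section ranks

lemma rank_complex (K : Type*) [Field K] [NumberField K] (z : K) (n : ℕ) (hn : 0 < n)
    (hz : z ^ 2 = -(n : K)) (m : ℕ) (hm : Module.finrank ℚ K = 2 * m) :
    Units.rank K = m - 1 := by
  have : IsTotallyComplex K := by
    constructor
    intro v
    rw [← InfinitePlace.not_isReal_iff_isComplex]
    intro hv
    have h1 := congrArg (InfinitePlace.embedding_of_isReal hv) hz
    rw [map_pow, map_neg, map_natCast] at h1
    have h2 : (0 : ℝ) < n := by exact_mod_cast hn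
    nlinarith [sq_nonneg (InfinitePlace.embedding_of_isReal hv z)]
  have h1 := IsTotallyComplex.finrank K
  have h2 := InfinitePlace.card_eq_nrRealPlaces_add_nrComplexPlaces K
  rw [IsTotallyComplex.nrRealPlaces_eq_zero] at h2
  rw [Units.rank, h2]
  omega

lemma rank_sqrt2 {F : Type*} [Field F] [NumberField F] {τ : F ≃+* F} (h : IsQ ℚ F τ) (r : F)
    (hr : r ^ 2 = 2) (hτ : τ r = -r) : Units.rank F = 1 := by
  have h0 : r ≠ 0 := by rintro rfl; norm_num at hr
  have : IsTotallyReal F := by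
    constructor
    intro v
    rw [InfinitePlace.isReal_iff]
    rw [ComplexEmbedding.isReal_iff]
    ext x
    obtain ⟨a, b, rfl⟩ := h.decomp h0 hτ x
    have h1 := congrArg v.embedding hr
    rw [map_pow, map_ofNat] at h1
    have h2 : starRingEnd ℂ (v.embedding r) = v.embedding r := by
      rw [Complex.conj_eq_iff_im]
      have h3 := congrArg Complex.re h1
      have h4 := congrArg Complex.im h1
      simp [pow_two] at h3 h4
      by_contra hne
      have h5 : (v.embedding r).re = 0 := by
        have : (v.embedding r).re * (v.embedding r).im = 0 := by linarith
        exact (mul_eq_zero.1 this).resolve_right hne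
      rw [h5] at h3
      nlinarith [sq_nonneg (v.embedding r).im]
    simp [ComplexEmbedding.conjugate, h2]
  have h1 := IsTotallyReal.finrank F
  have h2 := InfinitePlace.card_eq_nrRealPlaces_add_nrComplexPlaces F
  have h3 := InfinitePlace.card_add_two_mul_card_eq_rank F
  rw [h.fin] at *
  rw [Units.rank, h2]
  omega

lemma norm_sqrt2 {F : Type*} [Field F] [NumberField F] {τ : F ≃+* F} (h : IsQ ℚ F τ) (r : F)
    (hr : r ^ 2 = 2) (hτ : τ r = -r) (a b : ℚ) :
    Algebra.norm ℚ (algebraMap ℚ F a + algebraMap ℚ F b * r) = a ^ 2 - 2 * b ^ 2 := by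
  apply (algebraMap ℚ F).injective
  rw [h.norm_eq, map_add, map_mul, h.fix, h.fix, hτ]
  simp only [map_sub, map_mul, map_pow, map_ofNat]
  linear_combination -(algebraMap ℚ F b) ^ 2 * hr

lemma int_of_sq {K : Type*} [Field K] [NumberField K] (x : K) (n : ℤ) (h : x ^ 2 = n) :
    ∃ a : 𝓞 K, (a : K) = x := by
  refine ⟨⟨x, IsIntegral.of_pow (n := 2) (by norm_num) ?_⟩, rfl⟩
  rw [h]
  exact (isIntegral_algebraMap (R := ℤ) (A := K) (x := n))

lemma pid_sqrt2 {F : Type*} [Field F] [NumberField F] {τ : F ≃+* F} (h : IsQ ℚ F τ) (r : F)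
    (hr : r ^ 2 = 2) (hτ : τ r = -r) : IsPrincipalIdealRing (𝓞 F) := by
  have h0 : r ≠ 0 := by rintro rfl; norm_num at hr
  obtain ⟨R, hR⟩ := int_of_sq r 2 (by exact_mod_cast hr)
  apply pid_of_euclid
  intro x
  obtain ⟨a, b, rfl⟩ := h.decomp h0 hτ x
  refine ⟨(round a : ℤ) + (round b : ℤ) * R, ?_⟩
  have e : algebraMap ℚ F a + algebraMap ℚ F b * r -
      (((round a : ℤ) + (round b : ℤ) * R : 𝓞 F) : F) =
      algebraMap ℚ F (a - round a) + algebraMap ℚ F (b - round b) * r := by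
    have hR' : algebraMap (𝓞 F) F R = r := hR
    simp only [map_add (algebraMap (𝓞 F) F), map_mul (algebraMap (𝓞 F) F), map_intCast]
    rw [hR']
    simp only [map_sub, map_intCast]
    ring
  rw [e, norm_sqrt2 h r hr hτ]
  have h1 := abs_sub_round a
  have h2 := abs_sub_round b
  rw [abs_le] at h1 h2
  rw [abs_lt]
  constructor <;> nlinarith

lemma aux_zeta_ineq (A B C D : ℚ) (hA : |A| ≤ 1 / 2) (hB : |B| ≤ 1 / 2) (hC : |C| ≤ 1 / 2)
    (hD : |D| ≤ 1 / 2) : |(A ^ 2 + B ^ 2 + C ^ 2 + D ^ 2) ^ 2 -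
      2 * (A * B + B * C + C * D - A * D) ^ 2| < 1 := by
  have hsq : ∀ X : ℚ, |X| ≤ 1 / 2 → X ^ 2 ≤ 1 / 4 := by
    intro X hX
    rw [abs_le] at hX
    nlinarith
  have h1 := hsq A hA
  have h2 := hsq B hB
  have h3 := hsq C hC
  have h4 := hsq D hD
  set S := A ^ 2 + B ^ 2 + C ^ 2 + D ^ 2 with hS
  set T := A * B + B * C + C * D - A * D with hT
  have hS0 : 0 ≤ S := by positivity
  have hS1 : S ≤ 1 := by linarith
  have hpos : 0 ≤ S ^ 2 - 2 * T ^ 2 := by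
    have : S ^ 2 - 2 * T ^ 2 = (A ^ 2 + C ^ 2 - B ^ 2 - D ^ 2) ^ 2 +
        2 * (A * (B + D) - C * (B - D)) ^ 2 := by rw [hS, hT]; ring
    rw [this]; positivity
  rw [abs_of_nonneg hpos]
  by_contra hcon
  push Not at hcon
  have hT0 : T ^ 2 = 0 := by nlinarith [sq_nonneg T]
  have hSe : S = 1 := by nlinarith [sq_nonneg T]
  have hcase : ∀ X : ℚ, X ^ 2 = 1 / 4 → X = 1 / 2 ∨ X = -(1 / 2) := by
    intro X hX
    apply sq_eq_sq_iff_eq_or_eq_neg.1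
    rw [hX]; norm_num
  have hT0' : T = 0 := by simpa using hT0
  rw [hT] at hT0'
  rcases hcase A (by linarith) with rfl | rfl <;> rcases hcase B (by linarith) with rfl | rfl <;>
    rcases hcase C (by linarith) with rfl | rfl <;> rcases hcase D (by linarith) with rfl | rfl <;>
    norm_num at hT0'

lemma pid_zeta8 {F K : Type*} [Field F] [Field K] [NumberField F] [NumberField K] [Algebra F K]
    {τ : F ≃+* F} {c : K ≃+* K} (h : IsQ ℚ F τ) (r : F)
    (hr : r ^ 2 = 2) (hτ : τ r = -r) (h' : IsQ F K c) (i : K) (hi : i ^ 2 = -1) (hc : c i = -i)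
    (Z : 𝓞 K) (hZ : (Z : K) = algebraMap F K r * (1 + i) / 2) : IsPrincipalIdealRing (𝓞 K) := by
  have h0 : r ≠ 0 := by rintro rfl; norm_num at hr
  have i0 : i ≠ 0 := by rintro rfl; norm_num at hi
  obtain ⟨I, hI⟩ := int_of_sq i (-1) (by exact_mod_cast hi)
  apply pid_of_euclid
  intro x
  obtain ⟨α, β, rfl⟩ := h'.decomp i0 hc x
  obtain ⟨a0, a1, rfl⟩ := h.decomp h0 hτ α
  obtain ⟨b0, b1, rfl⟩ := h.decomp h0 hτ β
  have hr' : (algebraMap F K r) ^ 2 = 2 := by rw [← map_pow, hr, map_ofNat]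
  refine ⟨(round a0 : ℤ) + (round (a1 + b1) : ℤ) * Z + (round b0 : ℤ) * I +
    (round (b1 - a1) : ℤ) * Z * I, ?_⟩
  set A := a0 - round a0 with hA
  set B := a1 + b1 - round (a1 + b1) with hB
  set C := b0 - round b0 with hC
  set D := b1 - a1 - round (b1 - a1) with hD
  have hcast : ∀ y : ℚ, algebraMap F K (algebraMap ℚ F y) = (y : K) := by
    intro y; rw [← IsScalarTower.algebraMap_apply]; simp
  have e : algebraMap F K (algebraMap ℚ F a0 + algebraMap ℚ F a1 * r) +
        algebraMap F K (algebraMap ℚ F b0 + algebraMap ℚ F b1 * r) * i -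
      (((round a0 : ℤ) + (round (a1 + b1) : ℤ) * Z + (round b0 : ℤ) * I +
    (round (b1 - a1) : ℤ) * Z * I : 𝓞 K) : K) =
      algebraMap F K (algebraMap ℚ F A + algebraMap ℚ F ((B - D) / 2) * r) +
        algebraMap F K (algebraMap ℚ F C + algebraMap ℚ F ((B + D) / 2) * r) * i := by
    simp only [map_add (algebraMap (𝓞 K) K), map_mul (algebraMap (𝓞 K) K), map_intCast]
    have hI' : algebraMap (𝓞 K) K I = i := hI
    have hZ' : algebraMap (𝓞 K) K Z = algebraMap F K r * (1 + i) / 2 := hZ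
    rw [hI', hZ']
    simp only [map_add, map_mul, hcast, hA, hB, hC, hD]
    push_cast
    linear_combination (-(round (b1 - a1) : K) * algebraMap F K r / 2) * hi
  have e2 : Algebra.norm F (algebraMap F K (algebraMap ℚ F A + algebraMap ℚ F ((B - D) / 2) * r) +
        algebraMap F K (algebraMap ℚ F C + algebraMap ℚ F ((B + D) / 2) * r) * i) =
      algebraMap ℚ F (A ^ 2 + B ^ 2 + C ^ 2 + D ^ 2) +
        algebraMap ℚ F (A * B + B * C + C * D - A * D) * r := by
    apply (algebraMap F K).injective
    rw [h'.norm_eq, map_add c, map_mul c, h'.fix, h'.fix, hc]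
    simp only [map_add, map_mul, hcast]
    push_cast
    linear_combination (-((C : K) + (B + D) / 2 * algebraMap F K r) ^ 2) * hi +
      (((B : K) - D) ^ 2 / 4 + ((B : K) + D) ^ 2 / 4) * hr'
  rw [e, ← Algebra.norm_norm (R := ℚ) (S := F), e2, norm_sqrt2 h r hr hτ]
  exact aux_zeta_ineq A B C D (abs_sub_round _) (abs_sub_round _) (abs_sub_round _)
    (abs_sub_round _)

end ranks

section nt

lemma descent_int (ℓ : ℕ) [Fact ℓ.Prime] (a b c : ℤ) (ha : ¬ (ℓ : ℤ) ∣ a) (hb : ¬ (ℓ : ℤ) ∣ b)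
    (hc1 : (ℓ : ℤ) ∣ c) (hc : ¬ (ℓ : ℤ) ^ 2 ∣ c) (n : ℕ) : ∀ X Y Z : ℤ, Z ≠ 0 → Z.natAbs = n →
    a * Z ^ 2 = b * X ^ 2 + c * Y ^ 2 → legendreSym ℓ (a * b) = 1 := by
  have hℓ : Prime (ℓ : ℤ) := Nat.prime_iff_prime_int.1 Fact.out
  induction n using Nat.strong_induction_on with
  | _ n ih =>
  intro X Y Z hZ hn e
  by_cases hZℓ : (ℓ : ℤ) ∣ Z
  · have h1 : (ℓ : ℤ) ∣ b * X ^ 2 := by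
      have h2 : b * X ^ 2 = a * Z ^ 2 - c * Y ^ 2 := by linarith
      rw [h2]
      exact dvd_sub (Dvd.dvd.mul_left (dvd_pow hZℓ two_ne_zero) _) (Dvd.dvd.mul_right hc1 _)
    have h2 : (ℓ : ℤ) ∣ X := hℓ.dvd_of_dvd_pow ((hℓ.dvd_or_dvd h1).resolve_left hb)
    obtain ⟨Z', rfl⟩ := hZℓ
    obtain ⟨X', rfl⟩ := h2
    obtain ⟨c', rfl⟩ := hc1
    have h0 : (ℓ : ℤ) ≠ 0 := hℓ.ne_zero
    have h3 : c' * Y ^ 2 = ℓ * (a * Z' ^ 2 - b * X' ^ 2) := by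
      apply mul_left_cancel₀ h0; linear_combination -e
    have h4 : (ℓ : ℤ) ∣ Y := by
      rcases hℓ.dvd_or_dvd (Dvd.intro _ h3.symm) with h | h
      · exact absurd (by rw [pow_two]; exact mul_dvd_mul_left _ h) hc
      · exact hℓ.dvd_of_dvd_pow h
    obtain ⟨Y', rfl⟩ := h4
    have hZ' : Z' ≠ 0 := by rintro rfl; simp at hZ
    refine ih Z'.natAbs ?_ X' Y' Z' hZ' rfl ?_
    · rw [← hn, Int.natAbs_mul, Int.natAbs_natCast]
      have := (Fact.out : ℓ.Prime).two_le
      have := Int.natAbs_pos.2 hZ'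
      nlinarith
    · apply mul_left_cancel₀ (pow_ne_zero 2 h0); linear_combination e
  · have hab : ((a * b : ℤ) : ZMod ℓ) ≠ 0 := by
      rw [Ne, ZMod.intCast_zmod_eq_zero_iff_dvd]
      intro h
      exact (hℓ.dvd_or_dvd h).elim ha hb
    rw [legendreSym.eq_one_iff _ hab]
    have hz : (Z : ZMod ℓ) ≠ 0 := by rwa [Ne, ZMod.intCast_zmod_eq_zero_iff_dvd]
    have hcc : (c : ZMod ℓ) = 0 := by rwa [ZMod.intCast_zmod_eq_zero_iff_dvd]
    have e2 := congrArg (Int.cast : ℤ → ZMod ℓ) e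
    push_cast at e2 ⊢
    rw [hcc] at e2
    refine ⟨b * X / Z, ?_⟩
    field_simp
    linear_combination b * e2

lemma clear3 (x y z : ℚ) : ∃ (n X Y Z : ℤ), n ≠ 0 ∧ (X : ℚ) = n * x ∧ (Y : ℚ) = n * y ∧
    (Z : ℚ) = n * z := by
  refine ⟨x.den * y.den * z.den, x.num * y.den * z.den, y.num * x.den * z.den,
    z.num * x.den * y.den, by simp, ?_, ?_, ?_⟩
  · push_cast; linear_combination (-(y.den * z.den : ℚ)) * Rat.mul_den_eq_num x
  · push_cast; linear_combination (-(x.den * z.den : ℚ)) * Rat.mul_den_eq_num y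
  · push_cast; linear_combination (-(x.den * y.den : ℚ)) * Rat.mul_den_eq_num z

lemma descent_rat (ℓ : ℕ) [Fact ℓ.Prime] (a b c : ℤ) (ha : ¬ (ℓ : ℤ) ∣ a) (hb : ¬ (ℓ : ℤ) ∣ b)
    (hc1 : (ℓ : ℤ) ∣ c) (hc : ¬ (ℓ : ℤ) ^ 2 ∣ c) (x y z : ℚ) (hz : z ≠ 0)
    (e : a * z ^ 2 = b * x ^ 2 + c * y ^ 2) : legendreSym ℓ (a * b) = 1 := by
  obtain ⟨n, X, Y, Z, hn, hX, hY, hZ⟩ := clear3 x y z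
  have hn' : (n : ℚ) ≠ 0 := by exact_mod_cast hn
  refine descent_int ℓ a b c ha hb hc1 hc _ X Y Z ?_ rfl ?_
  · rintro rfl
    simp [hn, hz] at hZ
  · have : (a : ℚ) * Z ^ 2 = b * X ^ 2 + c * Y ^ 2 := by
      rw [hX, hY, hZ]; linear_combination (n : ℚ) ^ 2 * e
    exact_mod_cast this

/-- odd part is `±1 mod 8` -/
def oddPM (n : ℤ) : Prop := ∃ (j : ℕ) (m : ℤ), n = 2 ^ j * m ∧ (m % 8 = 1 ∨ m % 8 = 7)

lemma oddPM_form (k : ℤ) (hk : k % 8 = 1) (N : ℕ) : ∀ x y : ℤ, (x ^ 2 - 2 * k * y ^ 2).natAbs = N →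
    x ^ 2 - 2 * k * y ^ 2 ≠ 0 → oddPM (x ^ 2 - 2 * k * y ^ 2) := by
  obtain ⟨k', rfl⟩ : ∃ k', k = 8 * k' + 1 := ⟨k / 8, by omega⟩
  induction N using Nat.strong_induction_on with
  | _ N ih =>
  intro x y hN h0
  rcases Int.even_or_odd' x with ⟨u, rfl | rfl⟩ <;> rcases Int.even_or_odd' y with ⟨v, rfl | rfl⟩
  · have e : (2 * u) ^ 2 - 2 * (8 * k' + 1) * (2 * v) ^ 2 =
      2 ^ 2 * (u ^ 2 - 2 * (8 * k' + 1) * v ^ 2) := by ring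
    rw [e] at hN h0 ⊢
    have h1 : u ^ 2 - 2 * (8 * k' + 1) * v ^ 2 ≠ 0 := by
      intro h; rw [h] at h0; simp at h0
    obtain ⟨j, m, h2, h3⟩ := ih _ (by rw [← hN, Int.natAbs_mul, Int.natAbs_pow]; have := Int.natAbs_pos.2 h1; norm_num; omega)
      u v rfl h1
    exact ⟨j + 2, m, by rw [h2]; ring, h3⟩
  · refine ⟨1, 2 * u ^ 2 - (8 * k' + 1) * (2 * v + 1) ^ 2, by ring, ?_⟩
    rcases Int.even_or_odd' u with ⟨u', rfl | rfl⟩ <;> obtain ⟨w, hw⟩ := Int.even_mul_succ_self v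
    · right
      have : 2 * (2 * u') ^ 2 - (8 * k' + 1) * (2 * v + 1) ^ 2 =
        8 * (u' ^ 2 - k' * (2 * v + 1) ^ 2 - w - 1) + 7 := by linear_combination (-4) * hw
      omega
    · left
      have : 2 * (2 * u' + 1) ^ 2 - (8 * k' + 1) * (2 * v + 1) ^ 2 =
        8 * (u' ^ 2 + u' - k' * (2 * v + 1) ^ 2 - w) + 1 := by linear_combination (-4) * hw
      omega
  · refine ⟨0, _, (by rw [pow_zero, one_mul]), ?_⟩
    left
    obtain ⟨w, hw⟩ := Int.even_mul_succ_self u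
    have : (2 * u + 1) ^ 2 - 2 * (8 * k' + 1) * (2 * v) ^ 2 =
      8 * (w - (8 * k' + 1) * v ^ 2) + 1 := by linear_combination 4 * hw
    omega
  · refine ⟨0, _, (by rw [pow_zero, one_mul]), ?_⟩
    right
    obtain ⟨w, hw⟩ := Int.even_mul_succ_self u
    have : (2 * u + 1) ^ 2 - 2 * (8 * k' + 1) * (2 * v + 1) ^ 2 =
      8 * (w - 2 * k' * (2 * v + 1) ^ 2 - v ^ 2 - v - 1) + 7 := by linear_combination 4 * hw
    omega

lemma oddPM_neg {n : ℤ} (h : oddPM n) : oddPM (-n) := by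
  obtain ⟨j, m, rfl, h⟩ := h
  exact ⟨j, -m, by ring, by omega⟩

lemma oddPM_unique (j j' : ℕ) (m m' : ℤ) (hm : m % 2 = 1) (hm' : m' % 2 = 1)
    (h : 2 ^ j * m = 2 ^ j' * m') : m = m' := by
  wlog hj : j ≤ j' generalizing j j' m m'
  · exact (this j' j m' m hm' hm h.symm (by omega)).symm
  obtain ⟨k, rfl⟩ := Nat.exists_eq_add_of_le hj
  rw [pow_add, mul_assoc] at h
  have h1 := mul_left_cancel₀ (pow_ne_zero j two_ne_zero) h
  rcases k with _ | k
  · simpa using h1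
  · rw [pow_succ] at h1
    have : m = 2 * (2 ^ k * m') := by rw [h1]; ring
    omega

lemma oddPM_not (t n : ℤ) (ht : t % 8 = 3 ∨ t % 8 = 5) (h : oddPM n) (h' : oddPM (t * n)) :
    False := by
  obtain ⟨j, m, rfl, h⟩ := h
  obtain ⟨j', m', e, h'⟩ := h'
  have ho : (t * m) % 2 = 1 := by
    rw [Int.mul_emod]
    have h1 : t % 2 = 1 := by omega
    have h2 : m % 2 = 1 := by omega
    rw [h1, h2]; rfl
  have := oddPM_unique j j' (t * m) m' ho (by omega) (by rw [← e]; ring)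
  have h3 := Int.mul_emod t m 8
  rw [this] at h3
  rcases ht with ht | ht <;> rcases h with h | h <;> rw [ht, h] at h3 <;> omega

/-- rational version of the 2-adic obstruction -/
lemma two_adic_rat (t k : ℤ) (ht : t % 8 = 3 ∨ t % 8 = 5) (hk : k % 8 = 1) (x y e f : ℚ)
    (h0 : x ^ 2 - 2 * k * y ^ 2 ≠ 0)
    (h : t * (x ^ 2 - 2 * k * y ^ 2) = (e ^ 2 - 2 * f ^ 2) ∨
      t * (x ^ 2 - 2 * k * y ^ 2) = -(e ^ 2 - 2 * f ^ 2)) : False := by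
  obtain ⟨n, X, Y, -, hn, hX, hY, -⟩ := clear3 x y 0
  obtain ⟨n', E, F, -, hn', hE, hF, -⟩ := clear3 e f 0
  have hnq : (n : ℚ) ≠ 0 := by exact_mod_cast hn
  have hnq' : (n' : ℚ) ≠ 0 := by exact_mod_cast hn'
  have ht0 : t ≠ 0 := by rintro rfl; omega
  have h1 : ((X * n') ^ 2 - 2 * k * (Y * n') ^ 2 : ℤ) ≠ 0 := by
    have : ((((X * n') ^ 2 - 2 * k * (Y * n') ^ 2 : ℤ)) : ℚ) ≠ 0 := by
      push_cast
      rw [hX, hY]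
      have : (n * x * n') ^ 2 - 2 * k * (n * y * n') ^ 2 =
        (n : ℚ) ^ 2 * n' ^ 2 * (x ^ 2 - 2 * k * y ^ 2) := by ring
      rw [this]
      positivity
    exact_mod_cast this
  have h2 := oddPM_form k hk _ _ _ rfl h1
  have h3 : t * ((X * n') ^ 2 - 2 * k * (Y * n') ^ 2) = (E * n) ^ 2 - 2 * 1 * (F * n) ^ 2 ∨
    t * ((X * n') ^ 2 - 2 * k * (Y * n') ^ 2) = -((E * n) ^ 2 - 2 * 1 * (F * n) ^ 2) := by
    rcases h with h | h
    · left
      have : (t : ℚ) * ((X * n') ^ 2 - 2 * k * (Y * n') ^ 2) = (E * n) ^ 2 - 2 * 1 * (F * n) ^ 2 := by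
        rw [hX, hY, hE, hF]
        linear_combination (n : ℚ) ^ 2 * n' ^ 2 * h
      exact_mod_cast this
    · right
      have : (t : ℚ) * ((X * n') ^ 2 - 2 * k * (Y * n') ^ 2) =
          -((E * n) ^ 2 - 2 * 1 * (F * n) ^ 2) := by
        rw [hX, hY, hE, hF]
        linear_combination (n : ℚ) ^ 2 * n' ^ 2 * h
      exact_mod_cast this
  have h4 := mul_ne_zero ht0 h1
  apply oddPM_not t _ ht h2
  rcases h3 with h3 | h3
  · rw [h3] at h4 ⊢
    exact oddPM_form 1 (by norm_num) _ _ _ rfl h4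
  · rw [h3] at h4 ⊢
    exact oddPM_neg (oddPM_form 1 (by norm_num) _ _ _ rfl (neg_ne_zero.1 h4))

/-- three squares -/
lemma three_squares_int (m : ℤ) (hm : m % 8 = 7) (N : ℕ) : ∀ n x y z : ℤ, n.natAbs = N → n ≠ 0 →
    m * n ^ 2 = x ^ 2 + y ^ 2 + z ^ 2 → False := by
  have sq8 : ∀ x : ℤ, (x % 2 = 0 ∧ (x ^ 2 % 8 = 0 ∨ x ^ 2 % 8 = 4)) ∨ (x % 2 = 1 ∧ x ^ 2 % 8 = 1) := by
    intro x
    have h1 : x % 8 = 0 ∨ x % 8 = 1 ∨ x % 8 = 2 ∨ x % 8 = 3 ∨ x % 8 = 4 ∨ x % 8 = 5 ∨ x % 8 = 6 ∨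
      x % 8 = 7 := by omega
    rcases h1 with h | h | h | h | h | h | h | h <;> simp [pow_two, Int.mul_emod, h] <;> omega
  induction N using Nat.strong_induction_on with
  | _ N ih =>
  intro n x y z hN hn e
  have hmn := Int.mul_emod m (n ^ 2) 8
  rw [hm] at hmn
  rcases sq8 n with ⟨h1, h2⟩ | ⟨h1, h2⟩
  · have h3 : (m * n ^ 2) % 4 = 0 := by rcases h2 with h2 | h2 <;> rw [h2] at hmn <;> omega
    have hx : x % 2 = 0 ∧ y % 2 = 0 ∧ z % 2 = 0 := by
      rcases sq8 x with ⟨a, b⟩ | ⟨a, b⟩ <;> rcases sq8 y with ⟨c, d⟩ | ⟨c, d⟩ <;>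
        rcases sq8 z with ⟨f, g⟩ | ⟨f, g⟩ <;> omega
    obtain ⟨hx, hy, hz⟩ := hx
    obtain ⟨n', rfl⟩ := Int.dvd_of_emod_eq_zero h1
    obtain ⟨x', rfl⟩ := Int.dvd_of_emod_eq_zero hx
    obtain ⟨y', rfl⟩ := Int.dvd_of_emod_eq_zero hy
    obtain ⟨z', rfl⟩ := Int.dvd_of_emod_eq_zero hz
    exact ih n'.natAbs (by omega) n' x' y' z' rfl (by omega) (by linarith)
  · rw [h2] at hmn
    rcases sq8 x with ⟨a, b⟩ | ⟨a, b⟩ <;> rcases sq8 y with ⟨c, d⟩ | ⟨c, d⟩ <;>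
        rcases sq8 z with ⟨f, g⟩ | ⟨f, g⟩ <;> omega

lemma three_squares_rat (m : ℤ) (hm : m % 8 = 7) (x y z : ℚ) (e : (m : ℚ) = x ^ 2 + y ^ 2 + z ^ 2) :
    False := by
  obtain ⟨n, X, Y, Z, hn, hX, hY, hZ⟩ := clear3 x y z
  refine three_squares_int m hm _ n X Y Z rfl hn ?_
  have : (m : ℚ) * n ^ 2 = X ^ 2 + Y ^ 2 + Z ^ 2 := by
    rw [hX, hY, hZ]; linear_combination (n : ℚ) ^ 2 * e
  exact_mod_cast this

/-- `-1` is not a sum of two squares in `ℚ(√-m)`. -/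
lemma two_squares_quad (m : ℤ) (hm : m % 8 = 7) (a b c d : ℚ)
    (e1 : a ^ 2 + c ^ 2 - m * (b ^ 2 + d ^ 2) = -1) (e2 : a * b + c * d = 0) : False := by
  by_cases h : b ^ 2 + d ^ 2 = 0
  · rw [h] at e1
    nlinarith [sq_nonneg a, sq_nonneg c]
  apply three_squares_rat m hm ((a * d - c * b) / (b ^ 2 + d ^ 2)) (b / (b ^ 2 + d ^ 2))
    (d / (b ^ 2 + d ^ 2))
  field_simp
  linear_combination (-(b ^ 2 + d ^ 2)) * e1 + (a * b + c * d) * e2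

end nt

set_option linter.unusedSimpArgs false

section pell

lemma factor_sq (m n N y : ℕ) (hmn : m.Coprime n) (e : m * n = N * y ^ 2) (hN : 0 < N) :
    ∃ d1 d2 a b : ℕ, d1 * d2 = N ∧ m = d1 * a ^ 2 ∧ n = d2 * b ^ 2 := by
  have h1 : N.gcd m * N.gcd n = N := by
    rw [← Nat.Coprime.gcd_mul N hmn, e, Nat.gcd_eq_left (Dvd.intro _ rfl)]
  obtain ⟨m', hm'⟩ := Nat.gcd_dvd_right N m
  obtain ⟨n', hn'⟩ := Nat.gcd_dvd_right N n
  have hc : m'.Coprime n' :=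
    Nat.Coprime.coprime_dvd_left (Dvd.intro_left _ hm'.symm)
      (Nat.Coprime.coprime_dvd_right (Dvd.intro_left _ hn'.symm) hmn)
  have h2 : m' * n' = y ^ 2 := by
    apply Nat.eq_of_mul_eq_mul_left hN
    rw [← e]
    conv_lhs => rw [← h1]
    conv_rhs => rw [hm', hn']
    ring
  obtain ⟨a, ha⟩ := exists_eq_pow_of_mul_eq_pow (Nat.isUnit_iff.2 hc) h2
  obtain ⟨b, hb⟩ := exists_eq_pow_of_mul_eq_pow (Nat.isUnit_iff.2 hc.symm) ((mul_comm _ _).trans h2)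
  exact ⟨_, _, a, b, h1, by rw [← ha]; exact hm', by rw [← hb]; exact hn'⟩

lemma pell_factor (N : ℕ) (hN : ¬ IsSquare N) (h4 : N % 4 ≠ 0) :
    ∃ d1 d2 a b : ℕ, d1 * d2 = N ∧ ((d1 * a ^ 2 = d2 * b ^ 2 + 1 ∧ d1 ≠ 1) ∨
      (d1 * a ^ 2 = d2 * b ^ 2 + 2 ∧ d1 * a ^ 2 % 2 = 1)) := by
  have hN0 : 0 < N := by
    rcases Nat.eq_zero_or_pos N with h | h
    · subst h; simp at h4
    · exact h
  have hex : ∃ x : ℕ, ∃ y : ℕ, 0 < y ∧ x ^ 2 = N * y ^ 2 + 1 := by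
    obtain ⟨x, y, h, hy⟩ := Pell.exists_of_not_isSquare (d := (N : ℤ)) (by exact_mod_cast hN0) (by
      rwa [Int.isSquare_natCast_iff])
    refine ⟨x.natAbs, y.natAbs, Int.natAbs_pos.2 hy, ?_⟩
    zify
    rw [sq_abs, sq_abs]
    linarith
  classical
  obtain ⟨y, hy, e⟩ := Nat.find_spec hex
  have hmin := fun m => @Nat.find_min _ _ hex m
  set x := Nat.find hex with hx
  clear_value x
  rcases Nat.even_or_odd' x with ⟨t, ht | ht⟩
  · have ht0 : 0 < t := by
      rcases Nat.eq_zero_or_pos t with h | h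
      · subst h; subst ht; simp at e
      · exact h
    obtain ⟨s, hs⟩ : ∃ s, t = s + 1 := ⟨t - 1, by omega⟩
    subst hs
    obtain ⟨d1, d2, a, b, h1, h2, h3⟩ := factor_sq (2 * s + 3) (2 * s + 1) N y (by
      have : 2 * s + 3 = (2 * s + 1) + 2 := by ring
      rw [this, Nat.coprime_self_add_left]
      rw [Nat.coprime_two_left, Nat.odd_iff]; omega) (by subst ht; nlinarith) hN0
    exact ⟨d1, d2, a, b, h1, Or.inr ⟨by rw [← h2, ← h3], by rw [← h2]; omega⟩⟩
  · have hev : y % 2 = 0 := by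
      rcases Nat.even_or_odd' y with ⟨v, hv | hv⟩
      · omega
      · exfalso
        have : N = 4 * (t ^ 2 + t) - 4 * (N * (v ^ 2 + v)) := by
          rw [ht, hv] at e
          have : 4 * (t ^ 2 + t) = N + 4 * (N * (v ^ 2 + v)) := by nlinarith
          omega
        omega
    obtain ⟨v, rfl⟩ := Nat.dvd_of_mod_eq_zero hev
    have e2 : (t + 1) * t = N * v ^ 2 := by subst ht; nlinarith
    obtain ⟨d1, d2, a, b, h1, h2, h3⟩ := factor_sq (t + 1) t N v (by simp) e2 hN0
    refine ⟨d1, d2, a, b, h1, Or.inl ⟨by rw [← h2, ← h3], ?_⟩⟩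
    rintro rfl
    rw [one_mul] at h1 h2
    subst h1
    have hb : 0 < b := by
      rcases Nat.eq_zero_or_pos b with h | h
      · subst h
        rw [h3] at e2
        have : d2 * v ^ 2 = 0 := by rw [← e2]; ring
        have h5 : 0 < d2 * v ^ 2 := by
          have : 0 < v := by omega
          positivity
        omega
      · exact h
    have hbb : 0 < d2 * b ^ 2 := by positivity
    apply hmin a _ ⟨b, hb, by rw [← h2, h3]⟩
    rw [ht]
    nlinarith

variable {p q : ℕ} [Fact p.Prime] [Fact q.Prime]

lemma leg_desc (ℓ : ℕ) [Fact ℓ.Prime] (a b c : ℤ) (x y z : ℚ) (hz : z ≠ 0)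
    (e : a * z ^ 2 = b * x ^ 2 + (ℓ * c : ℤ) * y ^ 2) (ha : legendreSym ℓ a ≠ 0)
    (hb : legendreSym ℓ b ≠ 0) (hc : legendreSym ℓ c ≠ 0) :
    legendreSym ℓ a * legendreSym ℓ b = 1 := by
  have key : ∀ u : ℤ, legendreSym ℓ u ≠ 0 → ¬ (ℓ : ℤ) ∣ u := by
    intro u hu h
    apply hu
    rwa [legendreSym.eq_zero_iff, ZMod.intCast_zmod_eq_zero_iff_dvd]
  rw [← legendreSym.mul]
  refine descent_rat ℓ a b (ℓ * c) (key a ha) (key b hb) (Dvd.intro _ rfl) ?_ x y z hz e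
  intro h
  rw [pow_two] at h
  exact key c hc ((mul_dvd_mul_iff_left (by exact_mod_cast (Fact.out : ℓ.Prime).ne_zero)).1 h)

/-- all Legendre symbol data -/
structure LegData (p q : ℕ) [Fact p.Prime] [Fact q.Prime] : Prop where
  p2 : legendreSym p 2 = -1
  pm : legendreSym p (-1) = 1
  q2 : legendreSym q 2 = -1
  qm : legendreSym q (-1) = -1
  qr : legendreSym p q = legendreSym q p
  pq : legendreSym q p = 1 ∨ legendreSym q p = -1
  hp8 : p % 8 = 5
  hq8 : q % 8 = 3

lemma legData (hp8 : p % 8 = 5) (hq8 : q % 8 = 3) : LegData p q := by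
  have hp2 : p ≠ 2 := by rintro rfl; omega
  have hq2 : q ≠ 2 := by rintro rfl; omega
  refine ⟨?_, ?_, ?_, ?_, ?_, ?_, hp8, hq8⟩
  · rw [legendreSym.at_two hp2, ZMod.χ₈_nat_eq_if_mod_eight]; simp [hp8]; omega
  · rw [legendreSym.at_neg_one hp2, ZMod.χ₄_nat_one_mod_four (by omega)]
  · rw [legendreSym.at_two hq2, ZMod.χ₈_nat_eq_if_mod_eight]; simp [hq8]; omega
  · rw [legendreSym.at_neg_one hq2, ZMod.χ₄_nat_three_mod_four (by omega)]
  · exact (legendreSym.quadratic_reciprocity_one_mod_four (by omega) hq2).symm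
  · apply legendreSym.eq_one_or_neg_one
    rw [Int.cast_natCast, Ne, ZMod.natCast_eq_zero_iff]
    intro h
    rw [Nat.prime_dvd_prime_iff_eq Fact.out Fact.out] at h
    subst h; omega

lemma one_leg (ℓ : ℕ) [Fact ℓ.Prime] : legendreSym ℓ 1 = 1 := legendreSym.at_one ℓ

lemma LegData.rw2 (D : LegData p q) {P : Prop} (h : ∀ e : ℤ, (e = 1 ∨ e = -1) →
    legendreSym p q = e → legendreSym q p = e → P) : P :=
  h _ D.pq D.qr rfl

lemma LegData.m2 (D : LegData p q) (x y w : ℚ) (hw : w ≠ 0)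
    (e : 2 * w ^ 2 = x ^ 2 + 2 * (p * q) * y ^ 2) : False := by
  refine D.rw2 fun ee hee h1 h2 => ?_
  have h3 := leg_desc p 2 1 (2 * q) x y w hw (by push_cast; linear_combination e)
    (by simp [D.p2]) (by simp [one_leg]) (by rcases hee with rfl | rfl <;> simp [legendreSym.mul, D.p2, h1])
  simp [D.p2, one_leg] at h3

lemma LegData.mp (D : LegData p q) (x y w : ℚ) (hw : w ≠ 0)
    (e : p * w ^ 2 = x ^ 2 + 2 * (p * q) * y ^ 2) : False := by
  refine D.rw2 fun ee hee h1 h2 => ?_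
  have hp0 : (p : ℚ) ≠ 0 := by exact_mod_cast (Fact.out : p.Prime).ne_zero
  have e' : w ^ 2 = p * (x / p) ^ 2 + 2 * q * y ^ 2 := by field_simp; linear_combination e
  have h3 := leg_desc q 1 p 2 (x / p) y w hw (by push_cast; linear_combination e')
    (by simp [one_leg]) (by rcases hee with rfl | rfl <;> simp [h2]) (by simp [D.q2])
  have h4 := leg_desc p 1 (2 * q) 1 y (x / p) w hw (by push_cast; linear_combination e')
    (by simp [one_leg]) (by rcases hee with rfl | rfl <;> simp [legendreSym.mul, D.p2, h1])
    (by simp [one_leg])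
  rcases hee with rfl | rfl <;> simp [legendreSym.mul, D.p2, h1, h2, one_leg] at h3 h4

lemma LegData.mq (D : LegData p q) (x y w : ℚ) (hw : w ≠ 0)
    (e : q * w ^ 2 = x ^ 2 + 2 * (p * q) * y ^ 2) : False := by
  refine D.rw2 fun ee hee h1 h2 => ?_
  have hq0 : (q : ℚ) ≠ 0 := by exact_mod_cast (Fact.out : q.Prime).ne_zero
  have e' : w ^ 2 = q * (x / q) ^ 2 + 2 * p * y ^ 2 := by field_simp; linear_combination e
  have h3 := leg_desc p 1 q 2 (x / q) y w hw (by push_cast; linear_combination e')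
    (by simp [one_leg]) (by rcases hee with rfl | rfl <;> simp [h1]) (by simp [D.p2])
  have h4 := leg_desc q 1 (2 * p) 1 y (x / q) w hw (by push_cast; linear_combination e')
    (by simp [one_leg]) (by rcases hee with rfl | rfl <;> simp [legendreSym.mul, D.q2, h2])
    (by simp [one_leg])
  rcases hee with rfl | rfl <;> simp [legendreSym.mul, D.q2, h1, h2, one_leg] at h3 h4

lemma LegData.lneg (D : LegData p q) (x y w : ℚ) (hw : w ≠ 0)
    (e : -1 * w ^ 2 = x ^ 2 - (p * q) * y ^ 2) : False := by
  refine D.rw2 fun ee hee h1 h2 => ?_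
  have h3 := leg_desc q (-1) 1 (-1 * p) x y w hw (by push_cast; linear_combination e)
    (by simp [D.qm]) (by simp [one_leg])
    (by rw [legendreSym.mul]; rcases hee with rfl | rfl <;> simp [D.qm, h2])
  simp [D.qm, one_leg] at h3

lemma LegData.l2 (D : LegData p q) (t : ℤ) (ht : t = 2 ∨ t = -2) (x y w : ℚ) (hw : w ≠ 0)
    (e : t * w ^ 2 = x ^ 2 - (p * q) * y ^ 2) : False := by
  refine D.rw2 fun ee hee h1 h2 => ?_
  have ht' : legendreSym p t = -1 := by
    rcases ht with rfl | rfl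
    · exact D.p2
    · rw [show (-2 : ℤ) = -1 * 2 by norm_num, legendreSym.mul, D.pm, D.p2]; norm_num
  have h3 := leg_desc p t 1 (-1 * q) x y w hw (by push_cast; linear_combination e)
    (by simp [ht']) (by simp [one_leg])
    (by rw [legendreSym.mul]; rcases hee with rfl | rfl <;> simp [D.pm, h1])
  simp [ht', one_leg] at h3

lemma LegData.pq8 (D : LegData p q) : ((p : ℤ) * q) % 8 = 7 := by
  have h1 := D.hp8
  have h2 := D.hq8
  rw [Int.mul_emod]
  have h3 : (p : ℤ) % 8 = 5 := by omega
  have h4 : (q : ℤ) % 8 = 3 := by omega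
  rw [h3, h4]; rfl

lemma LegData.twoadic (D : LegData p q) (t : ℕ) (ht : t = p ∨ t = q) (x y e f : ℚ)
    (h0 : x ^ 2 + 2 * (p * q) * y ^ 2 ≠ 0)
    (h : t * (x ^ 2 + 2 * (p * q) * y ^ 2) = (e ^ 2 - 2 * f ^ 2) ∨
      t * (x ^ 2 + 2 * (p * q) * y ^ 2) = -(e ^ 2 - 2 * f ^ 2)) : False := by
  have h1 := D.hp8
  have h2 := D.hq8
  have h3 := D.pq8
  have e1 : x ^ 2 - 2 * ((-((p : ℤ) * q) : ℤ) : ℚ) * y ^ 2 = x ^ 2 + 2 * (p * q) * y ^ 2 := by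
    push_cast; ring
  apply two_adic_rat t (-((p : ℤ) * q)) (by rcases ht with rfl | rfl <;> omega) (by omega) x y e f
  · rw [e1]; exact h0
  · rw [e1]; exact_mod_cast h

lemma div_pq (d : ℕ) (h : d ∣ p * q) : d = 1 ∨ d = p ∨ d = q ∨ d = p * q := by
  obtain ⟨a, b, ha, hb, rfl⟩ := (Nat.dvd_mul).1 h
  rcases (Nat.dvd_prime Fact.out).1 ha with rfl | rfl <;>
    rcases (Nat.dvd_prime Fact.out).1 hb with rfl | rfl <;> simp

lemma LegData.ne (D : LegData p q) : p ≠ q := by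
  have h1 := D.hp8
  have h2 := D.hq8
  omega

lemma not_sq_of (n ℓ : ℕ) (hℓ : ℓ.Prime) (h1 : ℓ ∣ n) (h2 : ¬ ℓ ^ 2 ∣ n) : ¬ IsSquare n := by
  rintro ⟨m, rfl⟩
  rw [← pow_two] at *
  exact h2 (pow_dvd_pow_of_dvd (hℓ.dvd_of_dvd_pow h1) 2)

lemma LegData.pell1 (D : LegData p q) :
    (legendreSym q p = 1 ∧ ∃ a b : ℤ, p * a ^ 2 - q * b ^ 2 = 1) ∨
    (legendreSym q p = -1 ∧ ∃ a b : ℤ, p * a ^ 2 - q * b ^ 2 = 2) := by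
  have hp : p.Prime := Fact.out
  have hq : q.Prime := Fact.out
  have h8 := D.pq8
  refine D.rw2 fun ee hee h1 h2 => ?_
  have hn0 : legendreSym p q ≠ 0 := by rw [h1]; rcases hee with rfl | rfl <;> simp
  have hn1 : legendreSym q p ≠ 0 := by rw [h2]; rcases hee with rfl | rfl <;> simp
  have hns : ¬ IsSquare (p * q) := by
    apply not_sq_of _ p hp (Dvd.intro _ rfl)
    intro h
    rw [pow_two] at h
    have := Nat.dvd_of_mul_dvd_mul_left hp.pos h
    rw [Nat.prime_dvd_prime_iff_eq hp hq] at this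
    exact D.ne this
  obtain ⟨d1, d2, a, b, hd, h⟩ := pell_factor (p * q) hns (by zify; omega)
  rcases h with ⟨h, hd1⟩ | ⟨h, -⟩
  · have hz : (d1 : ℚ) * a ^ 2 = d2 * b ^ 2 + 1 := by exact_mod_cast h
    rcases div_pq d1 (Dvd.intro _ hd) with rfl | rfl | rfl | rfl
    · exact absurd rfl hd1
    · have : d2 = q := Nat.eq_of_mul_eq_mul_left hp.pos hd
      subst this
      left
      have h3 := leg_desc d2 1 d1 (-1) a b 1 one_ne_zero (by push_cast; linear_combination -hz)
        (by simp [one_leg]) hn1 (by simp [D.qm])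
      rw [one_leg, one_mul] at h3
      refine ⟨h3, a, b, ?_⟩
      zify at h; linarith
    · have : d2 = p := Nat.eq_of_mul_eq_mul_left hq.pos (by rw [hd, mul_comm])
      subst this
      exfalso
      have h3 := leg_desc d1 1 (-1 * d2) 1 b a 1 one_ne_zero (by push_cast; linear_combination -hz)
        (by simp [one_leg]) (by rw [legendreSym.mul]; simp [D.qm, hn1]) (by simp [one_leg])
      have h4 := leg_desc d2 1 d1 (-1) a b 1 one_ne_zero (by push_cast; linear_combination -hz)
        (by simp [one_leg]) hn0 (by simp [D.pm])
      rw [legendreSym.mul] at h3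
      rcases hee with rfl | rfl <;> simp [D.qm, D.pm, h1, h2, one_leg] at h3 h4
    · have : d2 = 1 := Nat.eq_of_mul_eq_mul_left (Nat.mul_pos hp.pos hq.pos) (by rw [hd, mul_one])
      subst this
      exfalso
      exact D.lneg b a 1 one_ne_zero (by push_cast at hz ⊢; linear_combination hz)
  · have hz : (d1 : ℚ) * a ^ 2 = d2 * b ^ 2 + 2 := by exact_mod_cast h
    rcases div_pq d1 (Dvd.intro _ hd) with rfl | rfl | rfl | rfl
    · rw [one_mul] at hd
      subst hd
      exact (D.l2 2 (Or.inl rfl) a b 1 one_ne_zero (by push_cast at hz ⊢; linear_combination -hz)).elim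
    · have : d2 = q := Nat.eq_of_mul_eq_mul_left hp.pos hd
      subst this
      right
      have h3 := leg_desc d2 2 d1 (-1) a b 1 one_ne_zero (by push_cast; linear_combination -hz)
        (by simp [D.q2]) hn1 (by simp [D.qm])
      rw [D.q2] at h3
      refine ⟨by linarith, a, b, ?_⟩
      zify at h; linarith
    · have : d2 = p := Nat.eq_of_mul_eq_mul_left hq.pos (by rw [hd, mul_comm])
      subst this
      exfalso
      have h3 := leg_desc d1 2 (-1 * d2) 1 b a 1 one_ne_zero (by push_cast; linear_combination -hz)
        (by simp [D.q2]) (by rw [legendreSym.mul]; simp [D.qm, hn1]) (by simp [one_leg])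
      have h4 := leg_desc d2 2 d1 (-1) a b 1 one_ne_zero (by push_cast; linear_combination -hz)
        (by simp [D.p2]) hn0 (by simp [D.pm])
      rw [legendreSym.mul] at h3
      rcases hee with rfl | rfl <;>
        simp [D.q2, D.p2, D.qm, D.pm, h1, h2, one_leg] at h3 h4
    · have : d2 = 1 := Nat.eq_of_mul_eq_mul_left (Nat.mul_pos hp.pos hq.pos) (by rw [hd, mul_one])
      subst this
      exact (D.l2 (-2) (Or.inr rfl) b a 1 one_ne_zero
        (by push_cast at hz ⊢; linear_combination hz)).elim

lemma LegData.pell2 (D : LegData p q) :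
    (legendreSym q p = 1 ∧ ∃ c d : ℤ, q * c ^ 2 - 2 * p * d ^ 2 = 1) ∨
    (legendreSym q p = -1 ∧ ∃ c d : ℤ, p * c ^ 2 - 2 * q * d ^ 2 = -1) := by
  have hp : p.Prime := Fact.out
  have hq : q.Prime := Fact.out
  have h8 := D.pq8
  refine D.rw2 fun ee hee h1 h2 => ?_
  have hn0 : legendreSym p q ≠ 0 := by rw [h1]; rcases hee with rfl | rfl <;> simp
  have hn1 : legendreSym q p ≠ 0 := by rw [h2]; rcases hee with rfl | rfl <;> simp
  have hn2 : legendreSym p 2 ≠ 0 := by rw [D.p2]; simp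
  have hn3 : legendreSym q 2 ≠ 0 := by rw [D.q2]; simp
  have hn4 : legendreSym q (-1) ≠ 0 := by rw [D.qm]; simp
  have hn5 : legendreSym p (-1) ≠ 0 := by rw [D.pm]; simp
  have hmul : ∀ (ℓ : ℕ) [Fact ℓ.Prime] (a b : ℤ), legendreSym ℓ a ≠ 0 → legendreSym ℓ b ≠ 0 →
      legendreSym ℓ (a * b) ≠ 0 := by
    intro ℓ _ a b ha hb
    rw [legendreSym.mul]; exact mul_ne_zero ha hb
  have hone : ∀ (ℓ : ℕ) [Fact ℓ.Prime], legendreSym ℓ 1 ≠ 0 := by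
    intro ℓ _; rw [one_leg]; simp
  have hns : ¬ IsSquare (2 * (p * q)) := by
    apply not_sq_of _ 2 Nat.prime_two (Dvd.intro _ rfl)
    zify
    omega
  obtain ⟨d1, d2, a, b, hd, h⟩ := pell_factor (2 * (p * q)) hns (by zify; omega)
  rcases h with ⟨h, hd1⟩ | ⟨h, ho⟩
  · have hz : (d1 : ℚ) * a ^ 2 = d2 * b ^ 2 + 1 := by exact_mod_cast h
    obtain ⟨e, f, he, hf, rfl⟩ := (Nat.dvd_mul).1 (Dvd.intro _ hd)
    have e0 : (2 * (p * q) : ℚ) = e * f * d2 := by exact_mod_cast hd.symm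
    rcases (Nat.dvd_prime Nat.prime_two).1 he with rfl | rfl <;>
      rcases div_pq f hf with rfl | rfl | rfl | rfl
    · exact absurd rfl hd1
    · -- p a² = 2 q b² + 1
      exfalso
      have : d2 = 2 * q := Nat.eq_of_mul_eq_mul_left hp.pos (by linarith)
      subst this
      push_cast at hz
      have h3 := leg_desc q 1 f (-1 * 2) a b 1 one_ne_zero (by push_cast; linear_combination -hz)
        (hone q) hn1 (hmul q _ _ hn4 hn3)
      have h4 := leg_desc f 1 (-1 * 2 * q) 1 b a 1 one_ne_zero (by push_cast; linear_combination -hz)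
        (hone f) (hmul _ _ _ (hmul _ _ _ hn5 hn2) hn0) (hone f)
      rw [legendreSym.mul, legendreSym.mul, D.p2, D.pm, one_leg, h1] at h4
      rw [h2, one_leg] at h3
      linarith
    · -- q a² = 2 p b² + 1
      left
      have : d2 = 2 * p := Nat.eq_of_mul_eq_mul_left hq.pos (by linarith)
      subst this
      push_cast at hz
      have h3 := leg_desc p 1 f (-1 * 2) a b 1 one_ne_zero (by push_cast; linear_combination -hz)
        (hone p) hn0 (hmul p _ _ hn5 hn2)
      rw [h1, one_leg, one_mul] at h3
      refine ⟨by rw [h2, h3], a, b, ?_⟩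
      rw [one_mul] at hz
      have : (f : ℤ) * a ^ 2 = 2 * p * b ^ 2 + 1 := by exact_mod_cast hz
      linarith
    · exfalso
      have : d2 = 2 := Nat.eq_of_mul_eq_mul_left (Nat.mul_pos hp.pos hq.pos) (by linarith)
      subst this
      push_cast at hz
      have h4 := leg_desc p 1 (-1 * 2) q b a 1 one_ne_zero (by push_cast; linear_combination -hz)
        (hone p) (hmul _ _ _ hn5 hn2) hn0
      rw [legendreSym.mul, D.p2, D.pm, one_leg] at h4
      norm_num at h4
    · exfalso
      have : d2 = p * q := by linarith
      subst this
      push_cast at hz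
      have h4 := leg_desc p 1 2 (-1 * q) a b 1 one_ne_zero (by push_cast; linear_combination -hz)
        (hone p) hn2 (hmul _ _ _ hn5 hn0)
      rw [D.p2, one_leg] at h4
      norm_num at h4
    · exfalso
      have : d2 = q := Nat.eq_of_mul_eq_mul_left (show 0 < 2 * f by have := hp.pos; omega) (by linarith)
      subst this
      push_cast at hz
      have h3 := leg_desc d2 1 (2 * f) (-1) a b 1 one_ne_zero (by push_cast; linear_combination -hz)
        (hone _) (hmul _ _ _ hn3 hn1) hn4
      have h4 := leg_desc f 1 (-1 * d2) 2 b a 1 one_ne_zero (by push_cast; linear_combination -hz)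
        (hone f) (hmul _ _ _ hn5 hn0) hn2
      rw [legendreSym.mul, D.pm, one_leg, h1] at h4
      rw [legendreSym.mul, D.q2, h2, one_leg] at h3
      linarith
    · right
      have : d2 = p := Nat.eq_of_mul_eq_mul_left (show 0 < 2 * f by have := hq.pos; omega) (by linarith)
      subst this
      push_cast at hz
      have h3 := leg_desc d2 1 (2 * f) (-1) a b 1 one_ne_zero (by push_cast; linear_combination -hz)
        (hone _) (hmul _ _ _ hn2 hn0) hn5
      rw [legendreSym.mul, D.p2, h1, one_leg] at h3
      refine ⟨by rw [h2]; linarith, b, a, ?_⟩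
      have : 2 * (f : ℤ) * a ^ 2 = d2 * b ^ 2 + 1 := by exact_mod_cast hz
      linarith
    · exfalso
      have : d2 = 1 := Nat.eq_of_mul_eq_mul_left (show 0 < 2 * (p * q) by
        have := Nat.mul_pos hp.pos hq.pos
        omega) (by linarith)
      subst this
      push_cast at hz
      have h4 := leg_desc q 1 (-1) (2 * p) b a 1 one_ne_zero (by push_cast; linear_combination -hz)
        (hone q) hn4 (hmul _ _ _ hn3 hn1)
      rw [D.qm, one_leg] at h4
      norm_num at h4
  · exfalso
    have h5 : (d1 * d2) % 2 = 0 := by rw [hd]; omega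
    have h6 : d2 * b ^ 2 % 2 = 1 := by omega
    have h7 : (d1 * a ^ 2) * (d2 * b ^ 2) % 2 = 1 := by rw [Nat.mul_mod, ho, h6]
    rw [show (d1 * a ^ 2) * (d2 * b ^ 2) = (d1 * d2) * (a ^ 2 * b ^ 2) by ring, Nat.mul_mod, h5] at h7
    simp at h7

end pell

section ideals
variable {F K : Type*} [Field F] [Field K] [NumberField F] [NumberField K] [Algebra F K]
  {τ : K ≃+* K}

lemma ideal_sq_inj {I J : Ideal (𝓞 K)} (h : I ^ 2 = J ^ 2) : I = J := by
  have key : ∀ I J : Ideal (𝓞 K), I ^ 2 = J ^ 2 → I ≤ J := by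
    intro I J h
    rw [← Ideal.dvd_iff_le]
    rw [← UniqueFactorizationMonoid.pow_dvd_pow_iff_dvd (n := 2) two_ne_zero, h]
  exact le_antisymm (key I J h) (key J I h.symm)

lemma split_sq {R : Type*} [CommRing R] {I J T : Ideal R} (h : I * J = T ^ 2) (h1 : I ⊔ J = ⊤) :
    (I ⊔ T) ^ 2 = I ∧ (J ⊔ T) ^ 2 = J ∧ (I ⊔ T) * (J ⊔ T) = T := by
  have key : ∀ I J : Ideal R, I * J = T ^ 2 → I ⊔ J = ⊤ → (I ⊔ T) ^ 2 = I := by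
    intro I J h h1
    have : (I ⊔ T) ^ 2 = I * (I ⊔ J ⊔ T) := by
      rw [pow_two, Ideal.sup_mul, Ideal.mul_sup, Ideal.mul_sup, Ideal.mul_sup, Ideal.mul_sup, h,
        ← pow_two T, mul_comm T I]
      apply le_antisymm
      · refine sup_le (sup_le ?_ ?_) (sup_le ?_ ?_)
        · exact le_sup_of_le_left le_sup_left
        · exact le_sup_right
        · exact le_sup_right
        · exact le_sup_of_le_left le_sup_right
      · refine sup_le (sup_le ?_ ?_) ?_
        · exact le_sup_of_le_left le_sup_left
        · exact le_sup_of_le_right le_sup_right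
        · exact le_sup_of_le_left le_sup_right
    rw [this, h1, top_sup_eq, Ideal.mul_top]
  refine ⟨key I J h h1, key J I (by rw [mul_comm, h]) (by rw [sup_comm, h1]), ?_⟩
  rw [Ideal.sup_mul, Ideal.mul_sup, Ideal.mul_sup, h]
  apply le_antisymm
  · refine sup_le (sup_le ?_ ?_) (sup_le ?_ ?_)
    · exact Ideal.pow_le_self two_ne_zero
    · exact Ideal.mul_le_right
    · exact Ideal.mul_le_left
    · exact Ideal.mul_le_right
  · calc T = T * (I ⊔ J) := by rw [h1, Ideal.mul_top]
      _ = I * T ⊔ T * J := by rw [Ideal.mul_sup, mul_comm T I]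
      _ ≤ _ := sup_le (le_sup_of_le_left le_sup_right) (le_sup_of_le_right le_sup_left)

lemma prime_of_absNorm {I : Ideal (𝓞 K)} {n : ℕ} (hn : n.Prime) (h : Ideal.absNorm I = n) :
    I.IsPrime ∧ I ≠ ⊥ ∧ I.IsMaximal := by
  have h1 : I.IsPrime := by
    apply Ideal.isPrime_of_irreducible_absNorm
    rw [h]; exact hn
  have h2 : I ≠ ⊥ := by
    rintro rfl
    rw [Ideal.absNorm_bot] at h
    exact hn.ne_zero h.symm
  exact ⟨h1, h2, h1.isMaximal h2⟩

lemma prime_eq_of_mem {I P : Ideal (𝓞 K)} {n : ℕ} (hn : n.Prime) (h : Ideal.absNorm I = n)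
    (hP : P.IsPrime) (h1 : I ≤ P) : P = I :=
  ((prime_of_absNorm hn h).2.2.eq_of_le hP.ne_top h1).symm

lemma absNorm_intCast_span (n : ℤ) : Ideal.absNorm (Ideal.span {(n : 𝓞 K)}) =
    n.natAbs ^ Module.finrank ℚ K := by
  have := Algebra.norm_algebraMap_of_basis (RingOfIntegers.basis K) n
  rw [Ideal.absNorm_span_singleton]
  rw [show ((n : ℤ) : 𝓞 K) = algebraMap ℤ (𝓞 K) n from rfl, this, Int.natAbs_pow,
    ← Module.finrank_eq_card_basis (RingOfIntegers.basis K), RingOfIntegers.rank]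

lemma span_sq_eq (t : 𝓞 K) (l m u v : ℤ) (ht : t ^ 2 = -((l : 𝓞 K) * m)) (huv : u * l + v * m = 1) :
    (Ideal.span {(l : 𝓞 K), t}) ^ 2 = Ideal.span {(l : 𝓞 K)} := by
  have huv' : (u : 𝓞 K) * l + v * m = 1 := by exact_mod_cast congrArg (Int.cast : ℤ → 𝓞 K) huv
  rw [pow_two, Ideal.span_pair_mul_span_pair]
  apply le_antisymm
  · rw [Ideal.span_le]
    rintro x (rfl | rfl | rfl | rfl) <;> rw [SetLike.mem_coe, Ideal.mem_span_singleton]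
    · exact Dvd.intro _ rfl
    · exact Dvd.intro _ rfl
    · exact Dvd.intro_left _ rfl
    · exact ⟨-m, by linear_combination ht⟩
  · rw [Ideal.span_singleton_le_iff_mem]
    have h1 : (l : 𝓞 K) = u * (l * l) - v * (t * t) := by
      linear_combination (-(l : 𝓞 K)) * huv' + v * ht
    have h2 : ∀ J : Ideal (𝓞 K), (u * (l * l) - v * (t * t) : 𝓞 K) ∈ J → (l : 𝓞 K) ∈ J := by
      intro J hJ; rwa [← h1] at hJ
    apply h2
    refine Ideal.sub_mem _ (Ideal.mul_mem_left _ _ (Ideal.subset_span ?_))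
      (Ideal.mul_mem_left _ _ (Ideal.subset_span ?_))
    · simp
    · simp

lemma absNorm_span_sq (hK : Module.finrank ℚ K = 2) (l : ℤ) (I : Ideal (𝓞 K))
    (h : I ^ 2 = Ideal.span {(l : 𝓞 K)}) : Ideal.absNorm I = l.natAbs := by
  have h1 := congrArg Ideal.absNorm h
  rw [map_pow, absNorm_intCast_span, hK] at h1
  exact Nat.pow_left_injective two_ne_zero h1

lemma IsQ.absNorm_of_sq (h : IsQ F K τ) {P : Ideal (𝓞 K)} {p : Ideal (𝓞 F)}
    (e : p.map (algebraMap (𝓞 F) (𝓞 K)) = P ^ 2) : Ideal.absNorm P = Ideal.absNorm p := by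
  have h1 := congrArg Ideal.absNorm e
  rw [Ideal.absNorm_algebraMap, map_pow, h.finrankInt] at h1
  exact (Nat.pow_left_injective two_ne_zero h1).symm

lemma klein_mem {G : Type*} [CommGroup G] {a b : G} (ha : a ^ 2 = 1) (hb : b ^ 2 = 1) {c : G}
    (hc : c ∈ Subgroup.closure ({a, b} : Set G)) : c = 1 ∨ c = a ∨ c = b ∨ c = a * b := by
  have ha' : a * a = 1 := by rw [← pow_two, ha]
  have hb' : b * b = 1 := by rw [← pow_two, hb]
  rw [Subgroup.mem_closure_pair] at hc
  obtain ⟨m, n, rfl⟩ := hc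
  have key : ∀ x : G, x * x = 1 → ∀ m : ℤ, x ^ m = 1 ∨ x ^ m = x := by
    intro x hx m
    have hx2 : x ^ (2 : ℤ) = 1 := by rw [zpow_ofNat, pow_two, hx]
    rcases Int.even_or_odd' m with ⟨j, rfl | rfl⟩
    · left; rw [zpow_mul, hx2, one_zpow]
    · right; rw [zpow_add, zpow_mul, hx2, one_zpow, one_mul, zpow_one]
  rcases key a ha' m with h1 | h1 <;> rcases key b hb' n with h2 | h2 <;> rw [h1, h2] <;> simp

lemma top_of_index_two {G : Type*} [Group G] {S T : Subgroup G} (hS : S.index = 2) (h : S ≤ T)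
    {g : G} (hg : g ∈ T) (hg' : g ∉ S) : T = ⊤ := by
  have h1 := Subgroup.relIndex_mul_index h
  rw [hS] at h1
  have h2 : S.relIndex T ≠ 1 := by
    rw [Ne, Subgroup.relIndex_eq_one]
    intro h3; exact hg' (h3 hg)
  have h3 : T.index ∣ 2 := Dvd.intro_left _ h1
  rcases (Nat.dvd_prime Nat.prime_two).1 h3 with h4 | h4
  · exact Subgroup.index_eq_one.1 h4
  · rw [h4] at h1; omega

lemma relIndex_two_of_index_four {G : Type*} [Group G] {S T : Subgroup G} (hS : S.index = 4)
    (h : S ≤ T) {g : G} (hg : g ∈ T) (hg' : g ∉ S) {g' : G} (hT : g' ∉ T) : S.relIndex T = 2 := by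
  have h1 := Subgroup.relIndex_mul_index h
  rw [hS] at h1
  have h2 : S.relIndex T ≠ 1 := by
    rw [Ne, Subgroup.relIndex_eq_one]
    intro h3; exact hg' (h3 hg)
  have h3 : T.index ≠ 1 := by
    rw [Ne, Subgroup.index_eq_one]
    rintro rfl; exact hT (Subgroup.mem_top _)
  have h4 : S.relIndex T ∣ 4 := Dvd.intro _ h1
  have h5 : S.relIndex T ≤ 4 := Nat.le_of_dvd (by norm_num) h4
  have h6 : S.relIndex T ≠ 0 := by intro h; rw [h] at h1; omega
  have h7 : S.relIndex T ≠ 3 := by intro h; rw [h] at h1; omega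
  have h8 : S.relIndex T ≠ 4 := by intro h; rw [h] at h1; omega
  omega

/-- units of the integers of `ℚ`. -/
lemma rat_units (v : (𝓞 ℚ)ˣ) : v = 1 ∨ v = -1 := by
  have e := Int.units_eq_one_or (Units.map (Rat.ringOfIntegersEquiv : 𝓞 ℚ →* ℤ) v)
  have hinj : Function.Injective (Units.map (Rat.ringOfIntegersEquiv : 𝓞 ℚ →* ℤ)) :=
    Units.map_injective Rat.ringOfIntegersEquiv.injective
  rcases e with e | e
  · left; apply hinj; rw [e, map_one]
  · right; apply hinj; rw [e]
    ext1
    simp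

instance pid_rat : IsPrincipalIdealRing (𝓞 ℚ) :=
  IsPrincipalIdealRing.of_surjective (Rat.ringOfIntegersEquiv.symm : ℤ →+* 𝓞 ℚ)
    Rat.ringOfIntegersEquiv.symm.surjective

end ideals

section biquad
variable {F K : Type*} [Field F] [Field K] [CharZero F] [Algebra F K]

lemma adjoin_sqrt (r : K) (a : F) (hr : r ^ 2 = algebraMap F K a)
    (nr : ∀ x : F, algebraMap F K x ≠ r) :
    ∃ τ0 : F⟮r⟯ ≃+* F⟮r⟯, IsQ F F⟮r⟯ τ0 ∧ τ0 (AdjoinSimple.gen F r) = -AdjoinSimple.gen F r := by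
  have hinteg : IsIntegral F r := by
    refine ⟨Polynomial.X ^ 2 - Polynomial.C a, Polynomial.monic_X_pow_sub_C _ two_ne_zero, ?_⟩
    simp [hr]
  have hfin : Module.finrank F F⟮r⟯ = 2 := by
    rw [adjoin.finrank hinteg]
    have h1 : (minpoly F r).natDegree ≤ 2 := by
      have hd : minpoly F r ∣ Polynomial.X ^ 2 - Polynomial.C a := by
        apply minpoly.dvd
        simp [hr]
      have := Polynomial.natDegree_le_of_dvd hd (Polynomial.X_pow_sub_C_ne_zero (by norm_num) _)
      rwa [Polynomial.natDegree_X_pow_sub_C] at this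
    have h2 := minpoly.natDegree_pos hinteg
    have h3 : (minpoly F r).natDegree ≠ 1 := by
      intro h
      rw [minpoly.natDegree_eq_one_iff] at h
      obtain ⟨x, hx⟩ := h
      exact nr x hx
    omega
  refine exists_isQ hfin _ ?_ a ?_
  · intro x hx
    exact nr x (congrArg (fun z : F⟮r⟯ => (z : K)) hx)
  · apply Subtype.ext
    exact hr

lemma biquad (h4 : Module.finrank F K = 4) (r s : K) (a b : F)
    (hr : r ^ 2 = algebraMap F K a) (hs : s ^ 2 = algebraMap F K b)
    (nr : ∀ x : F, algebraMap F K x ≠ r) (ns : ∀ x : F, algebraMap F K x ≠ s)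
    (nrs : ∀ x : F, algebraMap F K x ≠ r * s) :
    ∃ τ : K ≃+* K, IsQ F⟮r⟯ K τ ∧ τ r = r ∧ τ s = -s := by
  obtain ⟨τ0, h0, hτ0⟩ := adjoin_sqrt r a hr nr
  have hr0 : r ≠ 0 := by
    rintro rfl
    exact nr 0 (map_zero _)
  have hg0 : AdjoinSimple.gen F r ≠ 0 := by
    intro h
    exact hr0 (congrArg (fun z : F⟮r⟯ => (z : K)) h)
  have : FiniteDimensional F K := FiniteDimensional.of_finrank_pos (by omega)
  have hfin : Module.finrank F⟮r⟯ K = 2 := by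
    have := Module.finrank_mul_finrank F F⟮r⟯ K
    rw [h0.fin, h4] at this
    omega
  obtain ⟨τ, hτ, hs'⟩ := exists_isQ (F := F⟮r⟯) (K := K) hfin s (by
    intro z hz
    obtain ⟨x, y, e⟩ := h0.decomp hg0 hτ0 z
    have e1 : s = algebraMap F K x + algebraMap F K y * r := by
      rw [← hz, e]; rfl
    have e2 : algebraMap F F⟮r⟯ (x ^ 2 + a * y ^ 2) + algebraMap F F⟮r⟯ (2 * x * y) *
        AdjoinSimple.gen F r
        = algebraMap F F⟮r⟯ b + algebraMap F F⟮r⟯ 0 * AdjoinSimple.gen F r := by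
      apply Subtype.ext
      change algebraMap F K (x ^ 2 + a * y ^ 2) + algebraMap F K (2 * x * y) * r
        = algebraMap F K b + algebraMap F K 0 * r
      rw [← hs, e1]
      simp only [map_add, map_mul, map_pow, map_ofNat, map_zero, ← hr]
      ring
    have e3 := (h0.decomp_unique hg0 hτ0 e2).2
    rcases mul_eq_zero.1 e3 with h | h
    · have hx : x = 0 := by simpa using h
      apply nrs (a * y)
      rw [e1, hx, map_mul, ← hr, map_zero]
      ring
    · apply ns x
      rw [e1, h, map_zero]; ring) (algebraMap F F⟮r⟯ b) (by rw [hs]; rfl)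
  exact ⟨τ, hτ, hτ.fix (AdjoinSimple.gen F r), hs'⟩

end biquad

section normeq
variable {K : Type*} [Field K] [NumberField K] {τ : K ≃+* K}

lemma norm_quad (h : IsQ ℚ K τ) (θ : K) (d : ℚ) (hθ : θ ^ 2 = algebraMap ℚ K d) (hτ : τ θ = -θ)
    (a b : ℚ) : Algebra.norm ℚ (algebraMap ℚ K a + algebraMap ℚ K b * θ) = a ^ 2 - d * b ^ 2 := by
  apply (algebraMap ℚ K).injective
  rw [h.norm_eq, map_add, map_mul, h.fix, h.fix, hτ]
  simp only [map_sub, map_mul, map_pow]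
  linear_combination -(algebraMap ℚ K b) ^ 2 * hθ

lemma absNorm_span_rat (x : 𝓞 K) :
    (Ideal.absNorm (Ideal.span {x}) : ℚ) = |Algebra.norm ℚ (x : K)| := by
  rw [Ideal.absNorm_span_singleton, ← Algebra.coe_norm_int, Nat.cast_natAbs, Int.cast_abs]

lemma norm_of_cls {I J : Ideal (𝓞 K)} (hI : I ≠ ⊥) (hJ : J ≠ ⊥) (h : cls I = cls J) :
    ∃ (z : K) (W : ℚ), z ≠ 0 ∧ W ≠ 0 ∧
      |Algebra.norm ℚ z| * (Ideal.absNorm I : ℚ) = (Ideal.absNorm J : ℚ) * W ^ 2 := by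
  obtain ⟨x, y, hx, hy, e⟩ := (cls_eq_iff hI hJ).1 h
  have hx' : (x : K) ≠ 0 := by simpa using hx
  have hy' : (y : K) ≠ 0 := by simpa using hy
  refine ⟨x * y, Algebra.norm ℚ (y : K), mul_ne_zero hx' hy', ?_, ?_⟩
  · rwa [Ne, Algebra.norm_eq_zero_iff]
  · have e1 := congrArg (fun I => (Ideal.absNorm I : ℚ)) e
    simp only [map_mul, Nat.cast_mul, absNorm_span_rat] at e1
    rw [map_mul, abs_mul, mul_right_comm, e1, ← sq_abs (Algebra.norm ℚ (y : K))]
    ring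

end normeq

section fieldM
variable {p q : ℕ} [Fact p.Prime] [Fact q.Prime]
variable {M : Type*} [Field M] [NumberField M] {μ : M ≃+* M}

lemma M_norm (h : IsQ ℚ M μ) (t : M) (ht : t ^ 2 = -(2 * (p * q))) (hμ : μ t = -t) (z : M) :
    ∃ a b : ℚ, Algebra.norm ℚ z = a ^ 2 + 2 * (p * q) * b ^ 2 := by
  have h0 : t ≠ 0 := by
    rintro rfl
    have hp : (p : M) ≠ 0 := Nat.cast_ne_zero.2 (Fact.out : p.Prime).ne_zero
    have hq : (q : M) ≠ 0 := Nat.cast_ne_zero.2 (Fact.out : q.Prime).ne_zero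
    have : (2 : M) * (p * q) ≠ 0 := by simp [hp, hq]
    apply this
    linear_combination ht
  obtain ⟨a, b, rfl⟩ := h.decomp h0 hμ z
  refine ⟨a, b, ?_⟩
  rw [norm_quad h t (-(2 * (p * q))) (by rw [ht]; simp) hμ]
  ring

/-- the classes of `2`-power order in `ℚ(√(-2pq))` -/
theorem M_primary (D : LegData p q) (h : IsQ ℚ M μ) (t : M) (ht : t ^ 2 = -(2 * (p * q)))
    (hμ : μ t = -t) (T : 𝓞 M) (hT : (T : M) = t) :
    ∃ P2 Pp Pq : Ideal (𝓞 M), P2 ^ 2 = Ideal.span {(2 : 𝓞 M)} ∧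
      Ideal.absNorm Pp = p ∧ Ideal.absNorm Pq = q ∧
      ∀ I : Ideal (𝓞 M), I ≠ ⊥ → cls I ∈ CommGroup.primaryComponent (ClassGroup (𝓞 M)) 2 →
        cls I = 1 ∨ cls I = cls P2 ∨ cls I = cls Pp ∨ cls I = cls Pq := by
  have hp : p.Prime := Fact.out
  have hq : q.Prime := Fact.out
  have hp8 := D.hp8
  have hq8 := D.hq8
  have hTT : T ^ 2 = -(2 * (p * q)) := by
    apply RingOfIntegers.ext
    change (T : M) ^ 2 = _
    rw [hT, ht]; simp [map_neg (algebraMap (𝓞 M) M), map_mul (algebraMap (𝓞 M) M), map_ofNat (algebraMap (𝓞 M) M)]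
  have cop : ∀ l m : ℕ, Nat.Coprime l m → T ^ 2 = -((l : 𝓞 M) * m) →
      (Ideal.span {(l : 𝓞 M), T}) ^ 2 = Ideal.span {(l : 𝓞 M)} := by
    intro l m hlm e
    have := span_sq_eq T l m (Nat.gcdA l m) (Nat.gcdB l m) (by rw [e]; push_cast; ring) (by
      have := Nat.gcd_eq_gcd_ab l m
      rw [hlm] at this
      push_cast at this
      linarith)
    simpa using this
  have c2p : Nat.Coprime 2 p := (Nat.coprime_primes Nat.prime_two hp).2 (by omega)
  have c2q : Nat.Coprime 2 q := (Nat.coprime_primes Nat.prime_two hq).2 (by omega)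
  have cpq : Nat.Coprime p q := (Nat.coprime_primes hp hq).2 D.ne
  have s2 := cop 2 (p * q) (Nat.Coprime.mul_right c2p c2q) (by rw [hTT]; push_cast; ring)
  have sp := cop p (2 * q) (Nat.Coprime.mul_right c2p.symm cpq) (by rw [hTT]; push_cast; ring)
  have sq' := cop q (2 * p) (Nat.Coprime.mul_right c2q.symm cpq.symm) (by rw [hTT]; push_cast; ring)
  set P2 := Ideal.span {((2 : ℕ) : 𝓞 M), T} with hP2
  set Pp := Ideal.span {(p : 𝓞 M), T} with hPp
  set Pq := Ideal.span {(q : 𝓞 M), T} with hPq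
  have n2 : Ideal.absNorm P2 = 2 := by
    have := absNorm_span_sq h.fin (2 : ℤ) P2 (by simpa using s2)
    simpa using this
  have np : Ideal.absNorm Pp = p := by
    have := absNorm_span_sq h.fin (p : ℤ) Pp (by simpa using sp)
    simpa using this
  have nq : Ideal.absNorm Pq = q := by
    have := absNorm_span_sq h.fin (q : ℤ) Pq (by simpa using sq')
    simpa using this
  have b2 := (prime_of_absNorm Nat.prime_two n2).2.1
  have bp := (prime_of_absNorm hp np).2.1
  have bq := (prime_of_absNorm hq nq).2.1
  have k2 : cls P2 ^ 2 = 1 := by rw [← cls_pow b2, s2, cls_span]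
  have kp : cls Pp ^ 2 = 1 := by rw [← cls_pow bp, sp, cls_span]
  have kq : cls Pq ^ 2 = 1 := by rw [← cls_pow bq, sq', cls_span]
  have hprod : P2 * Pp * Pq = Ideal.span {T} := by
    apply ideal_sq_inj
    rw [mul_pow, mul_pow, s2, sp, sq', Ideal.span_singleton_mul_span_singleton,
      Ideal.span_singleton_mul_span_singleton, Ideal.span_singleton_pow, hTT, Ideal.span_singleton_neg]
    congr 2
    push_cast; ring
  have kk : cls P2 * cls Pp = cls Pq := by
    have := congrArg cls hprod
    rw [cls_span, cls_mul (mul_ne_zero b2 bp) bq, cls_mul b2 bp] at this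
    rw [mul_eq_one_iff_eq_inv.1 this, inv_eq_iff_mul_eq_one, ← pow_two, kq]
  -- 2-torsion
  have hH2 : ∀ v : (𝓞 ℚ)ˣ, (∃ x : M, x * μ x = algebraMap ℚ M ((v : 𝓞 ℚ) : ℚ)) →
      v ∈ (nU ℚ M).range := by
    rintro v ⟨x, hx⟩
    rcases rat_units v with rfl | rfl
    · exact one_mem _
    · exfalso
      obtain ⟨a, b, hab⟩ := M_norm h t ht hμ x
      have e := h.norm_eq x
      rw [hx] at e
      have e2 := (algebraMap ℚ M).injective e
      rw [hab] at e2
      have e3 : (((-1 : (𝓞 ℚ)ˣ) : 𝓞 ℚ) : ℚ) = -1 := by simp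
      rw [e3] at e2
      have : (0 : ℚ) ≤ a ^ 2 + 2 * (p * q) * b ^ 2 := by positivity
      linarith
  have htor : ∀ c : ClassGroup (𝓞 M), c ^ 2 = 1 →
      c = 1 ∨ c = cls P2 ∨ c = cls Pp ∨ c = cls Pq := by
    intro c hc
    rw [← kk]
    apply klein_mem k2 kp
    refine two_torsion_mem h hH2 _ ?_ c hc
    intro P hP hP0 hx
    have t1 : 2 * T ∈ P := by
      have := hx T
      have e : TI μ T = -T := by
        apply RingOfIntegers.ext
        rw [TI_coe, hT, hμ]
        change -t = -(T : M)
        rw [hT]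
      rw [e] at this
      convert this using 1; ring
    have t2 : T ∈ P := by
      rcases hP.mem_or_mem t1 with h | h
      · apply hP.mem_of_pow_mem 2
        rw [hTT]
        exact P.neg_mem (P.mul_mem_right _ h)
      · exact h
    have t3 : (2 : 𝓞 M) * (p * q) ∈ P := by
      rw [← neg_mem_iff, ← hTT, pow_two]
      exact P.mul_mem_left _ t2
    have le : ∀ l : 𝓞 M, l ∈ P → Ideal.span {l, T} ≤ P := by
      intro l hl
      rw [Ideal.span_le]
      rintro x (rfl | rfl)
      · exact hl
      · exact t2
    have in2 : cls P2 ∈ Subgroup.closure ({cls P2, cls Pp} : Set (ClassGroup (𝓞 M))) :=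
      Subgroup.subset_closure (by simp)
    have inp : cls Pp ∈ Subgroup.closure ({cls P2, cls Pp} : Set (ClassGroup (𝓞 M))) :=
      Subgroup.subset_closure (by simp)
    rcases hP.mem_or_mem t3 with h | h
    · rw [prime_eq_of_mem Nat.prime_two n2 hP (le _ (by simpa using h))]
      exact in2
    · rcases hP.mem_or_mem h with h | h
      · rw [prime_eq_of_mem hp np hP (le _ h)]
        exact inp
      · rw [prime_eq_of_mem hq nq hP (le _ h), ← kk]
        exact mul_mem in2 inp
  have hno4 : ∀ c : ClassGroup (𝓞 M), c ^ 4 = 1 → c ^ 2 = 1 := by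
    intro c hc
    obtain ⟨I, hI, rfl⟩ := cls_surj c
    have hI0 : (Ideal.absNorm I : ℚ) ≠ 0 := by
      simpa [Ideal.absNorm_eq_zero_iff] using hI
    have key : ∀ (J : Ideal (𝓞 M)) , J ≠ ⊥ → cls I ^ 2 = cls J → ∃ x y w : ℚ, w ≠ 0 ∧
        (Ideal.absNorm J : ℚ) * w ^ 2 = x ^ 2 + 2 * (p * q) * y ^ 2 := by
      intro J hJ e
      rw [← cls_pow hI] at e
      obtain ⟨z, W, hz, hW, e2⟩ := norm_of_cls (pow_ne_zero 2 hI) hJ e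
      obtain ⟨a, b, hab⟩ := M_norm h t ht hμ z
      rw [hab, abs_of_nonneg (by positivity), map_pow] at e2
      refine ⟨a * Ideal.absNorm I, b * Ideal.absNorm I, W, hW, ?_⟩
      rw [← e2]; push_cast; ring
    rcases htor (cls I ^ 2) (by rw [← pow_mul]; exact hc) with h1 | h1 | h1 | h1
    · exact h1
    · obtain ⟨x, y, w, hw, e⟩ := key _ b2 h1
      rw [n2] at e
      exact (D.m2 x y w hw (by exact_mod_cast e)).elim
    · obtain ⟨x, y, w, hw, e⟩ := key _ bp h1
      rw [np] at e
      exact (D.mp x y w hw (by exact_mod_cast e)).elim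
    · obtain ⟨x, y, w, hw, e⟩ := key _ bq h1
      rw [nq] at e
      exact (D.mq x y w hw (by exact_mod_cast e)).elim
  refine ⟨P2, Pp, Pq, by simpa using s2, np, nq, fun I hI hc => ?_⟩
  exact htor _ (aux_no_order_four hno4 _ hc)

end fieldM

section stepk
variable {p q : ℕ} [Fact p.Prime] [Fact q.Prime]
variable {k : Type*} [Field k] [NumberField k] {κ : k ≃+* k}

lemma pq_ne_zero (K : Type*) [Field K] [CharZero K] : (p : K) * q ≠ 0 :=
  mul_ne_zero (Nat.cast_ne_zero.2 (Fact.out : p.Prime).ne_zero)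
    (Nat.cast_ne_zero.2 (Fact.out : q.Prime).ne_zero)

lemma absNorm_two_of_split {K : Type*} [Field K] [NumberField K] (h2 : Module.finrank ℚ K = 2)
    {p1 p2 : Ideal (𝓞 K)} (e : p1 * p2 = Ideal.span {(2 : 𝓞 K)})
    (e2 : Ideal.absNorm p1 = Ideal.absNorm p2) : Ideal.absNorm p1 = 2 := by
  have h1 := congrArg Ideal.absNorm e
  have h3 := absNorm_intCast_span (K := K) 2
  rw [h2] at h3
  push_cast at h3
  rw [h3, map_mul, ← e2, ← pow_two] at h1
  exact Nat.pow_left_injective two_ne_zero h1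

lemma k_split (D : LegData p q) (h : IsQ ℚ k κ) (s : k) (hs : s ^ 2 = -(p * q)) (hκ : κ s = -s) :
    ∃ p1 p2 : Ideal (𝓞 k), p1 * p2 = Ideal.span {(2 : 𝓞 k)} ∧ p1 ⊔ p2 = ⊤ ∧
      Ideal.absNorm p1 = 2 ∧ Ideal.absNorm p2 = 2 := by
  have h8 := D.pq8
  obtain ⟨m, hm⟩ : ∃ m : ℤ, (p : ℤ) * q + 1 = 8 * m := ⟨((p : ℤ) * q + 1) / 8, by omega⟩
  have hm' : (p : k) * q + 1 = 8 * m := by exact_mod_cast congrArg (Int.cast : ℤ → k) hm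
  have hinteg : IsIntegral ℤ ((1 + s) / 2) := by
    refine ⟨Polynomial.X ^ 2 - Polynomial.X + Polynomial.C (2 * m), ?_, ?_⟩
    · monicity!
    · rw [Polynomial.eval₂_add, Polynomial.eval₂_sub, Polynomial.eval₂_pow,
        Polynomial.eval₂_X, Polynomial.eval₂_C, eq_intCast]
      push_cast
      linear_combination hs / 4 - hm' / 4
  set ω : 𝓞 k := ⟨(1 + s) / 2, hinteg⟩ with hω
  have hωk : algebraMap (𝓞 k) k ω = (1 + s) / 2 := rfl
  have e1 : ω * (1 - ω) = 2 * m := by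
    apply RingOfIntegers.ext
    change algebraMap (𝓞 k) k _ = algebraMap (𝓞 k) k _
    simp only [map_mul, map_sub, map_one, map_ofNat, map_intCast, hωk]
    linear_combination -hs / 4 + hm' / 4
  have e2 : TI κ ω = 1 - ω := by
    apply RingOfIntegers.ext
    rw [TI_coe]
    change κ ((1 + s) / 2) = algebraMap (𝓞 k) k _
    simp only [map_mul, map_sub, map_one, map_ofNat, map_intCast, hωk, map_div₀, map_add, hκ]
    ring
  have hprod : Ideal.span {(2 : 𝓞 k), ω} * Ideal.span {(2 : 𝓞 k), 1 - ω} = Ideal.span {(2 : 𝓞 k)} := by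
    rw [Ideal.span_pair_mul_span_pair]
    apply le_antisymm
    · rw [Ideal.span_le]
      rintro x (rfl | rfl | rfl | rfl) <;> rw [SetLike.mem_coe, Ideal.mem_span_singleton]
      · exact dvd_mul_right _ _
      · exact dvd_mul_right _ _
      · exact dvd_mul_left _ _
      · rw [e1]; exact dvd_mul_right _ _
    · rw [Ideal.span_singleton_le_iff_mem]
      have := Ideal.add_mem
        (Ideal.span {(2 : 𝓞 k) * 2, 2 * (1 - ω), ω * 2, ω * (1 - ω)})
        (Ideal.subset_span (Or.inr (Or.inl rfl)))
        (Ideal.subset_span (Or.inr (Or.inr (Or.inl rfl))))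
      rwa [show (2 : 𝓞 k) * (1 - ω) + ω * 2 = 2 by ring] at this
  have hmap : (Ideal.span {(2 : 𝓞 k), ω}).map (TI κ) = Ideal.span {(2 : 𝓞 k), 1 - ω} := by
    rw [Ideal.map_span, Set.image_pair, e2, map_ofNat]
  have hn : Ideal.absNorm (Ideal.span {(2 : 𝓞 k), ω}) =
      Ideal.absNorm (Ideal.span {(2 : 𝓞 k), 1 - ω}) := by
    rw [← hmap, IsQ.absNorm_map_TI]
  have hn2 := absNorm_two_of_split h.fin hprod hn
  refine ⟨_, _, hprod, ?_, hn2, hn ▸ hn2⟩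
  rw [Ideal.eq_top_iff_one]
  have : (1 : 𝓞 k) = ω + (1 - ω) := by ring
  rw [this]
  exact Ideal.add_mem _ (Ideal.mem_sup_left (Ideal.subset_span (by simp)))
    (Ideal.mem_sup_right (Ideal.subset_span (by simp)))

lemma k_neg_one (D : LegData p q) (h : IsQ ℚ k κ) (s : k) (hs : s ^ 2 = -(p * q)) (hκ : κ s = -s)
    (x : k) : x ^ 2 ≠ -1 := by
  intro hx
  have s0 : s ≠ 0 := by
    rintro rfl
    exact pq_ne_zero (p := p) (q := q) k (by linear_combination hs)
  obtain ⟨a, b, rfl⟩ := h.decomp s0 hκ x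
  have e : algebraMap ℚ k (a ^ 2 - p * q * b ^ 2) + algebraMap ℚ k (2 * a * b) * s
      = algebraMap ℚ k (-1) + algebraMap ℚ k 0 * s := by
    simp only [map_sub, map_mul, map_pow, map_natCast, map_ofNat, map_neg, map_one, map_zero]
    linear_combination hx - (algebraMap ℚ k b) ^ 2 * hs
  have e1 := (h.decomp_unique s0 hκ e).1
  exact D.lneg a b 1 one_ne_zero (by linear_combination -e1)

end stepk

section stepF2
variable {p q : ℕ} [Fact p.Prime] [Fact q.Prime]
variable {k Q M F : Type*} [Field k] [NumberField k] [Field Q] [NumberField Q] [Field M]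
  [NumberField M] [Field F] [NumberField F] [Algebra k F] [Algebra Q F] [Algebra M F]
  {κ : k ≃+* k} {κ' : Q ≃+* Q} {μ : M ≃+* M} {σ τ ρ : F ≃+* F}

lemma finrank_rat_two {E L : Type*} [Field E] [NumberField E] [Field L] [NumberField L]
    [Algebra E L] {τ : L ≃+* L} (h : IsQ E L τ) :
    Module.finrank ℚ L = 2 * Module.finrank ℚ E := by
  have : IsScalarTower ℚ E L := IsScalarTower.of_algebraMap_eq (fun x => by simp)
  rw [← Module.finrank_mul_finrank ℚ E L, h.fin, mul_comm]

lemma map_span_one {E L : Type*} [Field E] [NumberField E] [Field L] [NumberField L]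
    [Algebra E L] {b : Ideal (𝓞 E)} (hb : b ≠ ⊥) (h : cls b = 1) :
    cls (b.map (algebraMap (𝓞 E) (𝓞 L))) = 1 := by
  obtain ⟨x, hx0, rfl⟩ := cls_eq_one hb h
  rw [Ideal.map_span, Set.image_singleton, cls_span]

lemma primary_inv {E L : Type*} [Field E] [NumberField E] [Field L] [NumberField L]
    [Algebra E L] {τ : L ≃+* L} (h : IsQ E L τ) [IsPrincipalIdealRing (𝓞 E)] {I : Ideal (𝓞 L)}
    (hI : I ≠ ⊥) : cls (I.map (TI τ)) = (cls I)⁻¹ :=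
  h.cls_inv hI (map_span_one (relNorm_ne_bot hI) (cls_of_pid _))

/-- `ρ` acts as inversion on 2-primary classes -/
lemma F2_rho (D : LegData p q) (hρ : IsQ M F ρ) (hτ : IsQ Q F τ) (hM : IsQ ℚ M μ) (hQ : IsQ ℚ Q κ')
    (t : M) (ht : t ^ 2 = -(2 * (p * q))) (hμ : μ t = -t)
    (rQ : Q) (hrQ : rQ ^ 2 = 2) (hκ' : κ' rQ = -rQ)
    (R : 𝓞 F) (hR : R ^ 2 = 2) {I : Ideal (𝓞 F)} (hI : I ≠ ⊥)
    (hc : cls I ∈ CommGroup.primaryComponent (ClassGroup (𝓞 F)) 2) :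
    cls (I.map (TI ρ)) = (cls I)⁻¹ := by
  have := pid_sqrt2 hQ rQ hrQ hκ'
  have r0 : rQ ≠ 0 := by rintro rfl; norm_num at hrQ
  apply hρ.cls_inv hI
  obtain ⟨T, hT⟩ := int_of_sq t (-(2 * (p * q))) (by rw [ht]; push_cast; ring)
  obtain ⟨P2, Pp, Pq, s2, np, nq, hall⟩ := M_primary D hM t ht hμ T hT
  have hb := relNorm_ne_bot (F := M) hI
  have hcb := relNorm_primary (F := M) hI hc
  have key : ∀ (ℓ : ℕ) (P : Ideal (𝓞 M)), (ℓ = p ∨ ℓ = q) → Ideal.absNorm P = ℓ →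
      cls (Ideal.relNorm (𝓞 M) I) ≠ cls P := by
    intro ℓ P hℓ hn e
    have hℓp : ℓ.Prime := by rcases hℓ with rfl | rfl <;> exact Fact.out
    obtain ⟨z, W, hz, hW, e1⟩ := norm_of_cls hb (prime_of_absNorm hℓp hn).2.1 e
    obtain ⟨g, hg0, hg⟩ := cls_eq_one (relNorm_ne_bot (F := Q) hI) (cls_of_pid _)
    have e2 : (Ideal.absNorm (Ideal.relNorm (𝓞 M) I) : ℚ) = |Algebra.norm ℚ (g : Q)| := by
      rw [← absNorm_span_rat, ← hg, Ideal.absNorm_relNorm, Ideal.absNorm_relNorm]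
    obtain ⟨a, b, hab⟩ := M_norm hM t ht hμ z
    obtain ⟨e', f', hef⟩ := hQ.decomp r0 hκ' (g : Q)
    have hg' : Algebra.norm ℚ (g : Q) = e' ^ 2 - 2 * f' ^ 2 := by
      rw [hef, norm_sqrt2 hQ rQ hrQ hκ']
    have hn0 : (Ideal.absNorm (Ideal.relNorm (𝓞 M) I) : ℚ) ≠ 0 := by
      simpa [Ideal.absNorm_eq_zero_iff] using hI
    have hz0 : a ^ 2 + 2 * (p * q) * b ^ 2 ≠ 0 := by
      rw [← hab, Ne, Algebra.norm_eq_zero_iff]; exact hz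
    rw [hab, abs_of_nonneg (by positivity), hn] at e1
    rw [hg'] at e2
    set n : ℚ := (Ideal.absNorm (Ideal.relNorm (𝓞 M) I) : ℚ)
    have e3 : (ℓ : ℚ) * (a ^ 2 + 2 * (p * q) * b ^ 2) = (ℓ * W / n) ^ 2 * n := by
      have e4 : ((ℓ : ℚ) * W / n) ^ 2 * n = ℓ * (ℓ * W ^ 2) / n := by field_simp
      rw [e4, ← e1]
      field_simp
    apply D.twoadic ℓ hℓ a b (ℓ * W / n * e') (ℓ * W / n * f') hz0
    rw [e3, e2]
    rcases abs_choice (e' ^ 2 - 2 * f' ^ 2) with h | h <;> rw [h]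
    · left; ring
    · right; ring
  rcases hall _ hb hcb with h | h | h | h
  · exact map_span_one hb h
  · have h20 : P2 ≠ ⊥ := by
      rintro rfl
      have : (2 : 𝓞 M) = 0 := by
        rw [← Ideal.span_singleton_eq_bot, ← s2]; simp [pow_two]
      exact two_ne_zero this
    rw [cls_jmap_congr hb h20 h]
    have : P2.map (algebraMap (𝓞 M) (𝓞 F)) = Ideal.span {R} := by
      apply ideal_sq_inj
      rw [← Ideal.map_pow, s2, Ideal.map_span, Set.image_singleton, Ideal.span_singleton_pow, hR,
        map_ofNat]
    rw [this, cls_span]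
  · exact (key p Pp (Or.inl rfl) np h).elim
  · exact (key q Pq (Or.inr rfl) nq h).elim

theorem stepF2 (D : LegData p q) (hσ : IsQ k F σ) (hτ : IsQ Q F τ) (hρ : IsQ M F ρ)
    (hk : IsQ ℚ k κ) (hQ : IsQ ℚ Q κ') (hM : IsQ ℚ M μ)
    (s : k) (hs : s ^ 2 = -(p * q)) (hκ : κ s = -s)
    (rQ : Q) (hrQ : rQ ^ 2 = 2) (hκ' : κ' rQ = -rQ)
    (t : M) (ht : t ^ 2 = -(2 * (p * q))) (hμ : μ t = -t)
    (r : F) (hr : algebraMap Q F rQ = r) (htr : algebraMap M F t = r * algebraMap k F s)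
    (hσr : σ r = -r) (hτs : τ (algebraMap k F s) = -algebraMap k F s) (hρr : ρ r = -r)
    (R : 𝓞 F) (hR : (R : F) = r) :
    Nat.card (CommGroup.primaryComponent (ClassGroup (𝓞 F)) 2) =
      2 * Nat.card (CommGroup.primaryComponent (ClassGroup (𝓞 k)) 2) ∧
    ∃ P1 P2 : Ideal (𝓞 F), P1 * P2 = Ideal.span {R} ∧ P1 ⊔ P2 = ⊤ ∧ Ideal.absNorm P1 = 2 ∧
      Ideal.absNorm P2 = 2 := by
  have := pid_sqrt2 hQ rQ hrQ hκ'
  have r2 : r ^ 2 = 2 := by rw [← hr, ← map_pow, hrQ, map_ofNat]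
  have r0 : r ≠ 0 := by rintro rfl; norm_num at r2
  have s0 : s ≠ 0 := by
    rintro rfl
    exact pq_ne_zero (p := p) (q := q) k (by linear_combination hs)
  have hRF : algebraMap (𝓞 F) F R = r := hR
  have R2 : R ^ 2 = 2 := by
    apply RingOfIntegers.ext
    change algebraMap (𝓞 F) F _ = algebraMap (𝓞 F) F _
    rw [map_pow, hRF, r2, map_ofNat]
  have hρs : ρ (algebraMap k F s) = -algebraMap k F s := by
    have := hρ.fix t
    rw [htr, map_mul, hρr] at this
    apply mul_left_cancel₀ r0
    linear_combination -this
  have hcomp : τ.trans ρ = σ := by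
    ext x
    obtain ⟨a, b, rfl⟩ := hσ.decomp r0 hσr x
    have ha : ∀ a : k, ρ (τ (algebraMap k F a)) = algebraMap k F a := by
      intro a
      obtain ⟨a0, a1, rfl⟩ := hk.decomp s0 hκ a
      have hq1 : ∀ c : ℚ, algebraMap k F (algebraMap ℚ k c) = (c : F) := by intro c; simp
      simp only [map_add, map_mul, hq1, map_ratCast, hτs, map_neg, hρs, neg_neg]
    have hτr : τ r = r := by rw [← hr, hτ.fix]
    rw [RingEquiv.trans_apply]
    simp only [map_add, map_mul, ha, hτr, hρr, hσ.fix, hσr]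
  -- H1
  have H1 : ∀ I : Ideal (𝓞 F), I ≠ ⊥ → cls I ∈ CommGroup.primaryComponent (ClassGroup (𝓞 F)) 2 →
      cls (I.map (TI σ)) = cls I := by
    intro I hI hc
    have e1 : cls (I.map (TI τ)) = (cls I)⁻¹ := primary_inv hτ hI
    have e2 := F2_rho D hρ hτ hM hQ t ht hμ rQ hrQ hκ' R R2 (TI_map_ne_bot τ hI)
      (by rw [e1]; exact inv_mem hc)
    rw [TI_mul_map, hcomp, e1, inv_inv] at e2
    exact e2
  -- units
  have hfk := hk.fin
  have hfF : Module.finrank ℚ F = 2 * 2 := by rw [finrank_rat_two hσ, hfk]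
  have rk : Units.rank k = 0 := by
    have := rank_complex k s (p * q) (Nat.mul_pos (Fact.out : p.Prime).pos (Fact.out : q.Prime).pos)
      (by rw [hs]; push_cast; ring) 1 hfk
    simpa using this
  have rF : Units.rank F = 1 := by
    have := rank_complex F (algebraMap k F s) (p * q)
      (Nat.mul_pos (Fact.out : p.Prime).pos (Fact.out : q.Prime).pos)
      (by rw [← map_pow, hs]; push_cast; simp) 2 hfF
    simpa using this
  have hidx : (powMonoidHom 2 : (𝓞 k)ˣ →* (𝓞 k)ˣ).range.index = 2 := by
    rw [index_sq_units, rk]; rfl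
  have hle : (powMonoidHom 2 : (𝓞 k)ˣ →* (𝓞 k)ˣ).range ≤ (nU k F).range := by
    rintro _ ⟨v, rfl⟩
    exact ⟨iU k F v, nU_iU hσ v⟩
  have hneg : (-1 : (𝓞 k)ˣ) ∈ (nU k F).range := by
    have hu : (1 + R) * (R - 1) = 1 := by linear_combination R2
    refine ⟨⟨1 + R, R - 1, hu, by rw [mul_comm]; exact hu⟩, ?_⟩
    apply Units.ext
    apply FaithfulSMul.algebraMap_injective (𝓞 k) (𝓞 F)
    rw [nU_spec hσ]
    change (1 + R) * TI σ (1 + R) = _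
    have : TI σ R = -R := by
      apply RingOfIntegers.ext
      rw [TI_coe, hR, hσr]
      change _ = algebraMap (𝓞 F) F _
      rw [map_neg, hRF]
    rw [map_add, map_one, this]
    simp
    linear_combination -R2
  have hnot : (-1 : (𝓞 k)ˣ) ∉ (powMonoidHom 2 : (𝓞 k)ˣ →* (𝓞 k)ˣ).range := by
    rintro ⟨v, hv⟩
    apply k_neg_one D hk s hs hκ ((v : 𝓞 k) : k)
    have := congrArg (fun u : (𝓞 k)ˣ => algebraMap (𝓞 k) k (u : 𝓞 k)) hv
    simpa using this
  have htop := top_of_index_two hidx hle hneg hnot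
  have H4 : (powMonoidHom 2 : (𝓞 k)ˣ →* (𝓞 k)ˣ).range.relIndex (nU k F).range = 2 := by
    rw [htop, Subgroup.relIndex_top_right, hidx]
  -- ramification
  obtain ⟨p1, p2, hprod, hsup, n1, n2⟩ := k_split D hk s hs hκ
  have hj : p1.map (algebraMap (𝓞 k) (𝓞 F)) * p2.map (algebraMap (𝓞 k) (𝓞 F)) =
      Ideal.span {R} ^ 2 := by
    rw [← Ideal.map_mul, hprod, Ideal.map_span, Set.image_singleton, Ideal.span_singleton_pow, R2,
      map_ofNat]
  have hj1 : p1.map (algebraMap (𝓞 k) (𝓞 F)) ⊔ p2.map (algebraMap (𝓞 k) (𝓞 F)) = ⊤ := by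
    rw [← Ideal.map_sup, hsup, Ideal.map_top]
  obtain ⟨q1, q2, q3⟩ := split_sq hj hj1
  have N1 : Ideal.absNorm (p1.map (algebraMap (𝓞 k) (𝓞 F)) ⊔ Ideal.span {R}) = 2 := by
    rw [hσ.absNorm_of_sq q1.symm, n1]
  have N2 : Ideal.absNorm (p2.map (algebraMap (𝓞 k) (𝓞 F)) ⊔ Ideal.span {R}) = 2 := by
    rw [hσ.absNorm_of_sq q2.symm, n2]
  have pr1 := prime_of_absNorm Nat.prime_two n1
  have pr2 := prime_of_absNorm Nat.prime_two n2
  have hp12 : p1 ≠ p2 := by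
    rintro rfl
    rw [sup_idem] at hsup
    exact pr1.1.ne_top hsup
  have hram : ∀ P : Ideal (𝓞 F), P.IsPrime → P ≠ ⊥ → (∀ x, x - TI σ x ∈ P) →
      P = (p1.map (algebraMap (𝓞 k) (𝓞 F)) ⊔ Ideal.span {R}) ∨
      P = (p2.map (algebraMap (𝓞 k) (𝓞 F)) ⊔ Ideal.span {R}) := by
    intro P hP hP0 hx
    have hTR : TI σ R = -R := by
      apply RingOfIntegers.ext
      rw [TI_coe, hR, hσr]
      change _ = algebraMap (𝓞 F) F _
      rw [map_neg, hRF]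
    have h1 := hx R
    rw [hTR, show R - -R = R ^ 3 by linear_combination -R * R2] at h1
    have h2 : Ideal.span {R} ≤ P := by
      rw [Ideal.span_singleton_le_iff_mem]
      exact hP.mem_of_pow_mem 3 h1
    rw [← q3] at h2
    rcases hP.mul_le.1 h2 with h | h
    · left; exact prime_eq_of_mem Nat.prime_two N1 hP h
    · right; exact prime_eq_of_mem Nat.prime_two N2 hP h
  have hT := theoremT hσ H1 (fun v _ => by rw [htop]; trivial) pr1.1 pr2.1 pr1.2.1 pr2.2.1 hp12
    q1.symm q2.symm hram H4
  rw [rF, rk] at hT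
  refine ⟨by omega, _, _, q3, ?_, N1, N2⟩
  rw [eq_top_iff, ← hj1]
  exact sup_le_sup le_sup_left le_sup_left

end stepF2

set_option linter.unusedVariables false

section Lp
variable {p q : ℕ} [Fact p.Prime] [Fact q.Prime]
variable {Q L : Type*} [Field Q] [NumberField Q] [Field L] [NumberField L] [Algebra Q L]
  {κ : Q ≃+* Q} {ν : L ≃+* L}

lemma inert_aux (D : LegData p q) (ℓ : ℕ) (hℓ : ℓ = p ∨ ℓ = q) (e f : ℚ)
    (h : |e ^ 2 - 2 * f ^ 2| = (ℓ : ℚ)) : False := by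
  have : Fact ℓ.Prime := by rcases hℓ with rfl | rfl <;> infer_instance
  have h2 : legendreSym ℓ 2 = -1 := by
    rcases hℓ with rfl | rfl
    · exact D.p2
    · exact D.q2
  have hm : legendreSym ℓ (-1) ≠ 0 := by
    rcases hℓ with rfl | rfl
    · rw [D.pm]; norm_num
    · rw [D.qm]; norm_num
  have h1 : legendreSym ℓ 1 = 1 := legendreSym.at_one ℓ
  by_cases hf : f = 0
  · subst hf
    have h3 : e ^ 2 = ℓ := by
      rw [← h]; simp
    have h4 : IsSquare (ℓ : ℚ) := ⟨e, by rw [← h3]; ring⟩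
    rw [Rat.isSquare_natCast_iff] at h4
    exact (Fact.out : ℓ.Prime).prime.not_isSquare h4
  · have key : ∀ c : ℤ, legendreSym ℓ c ≠ 0 → 2 * f ^ 2 = e ^ 2 + ℓ * c → False := by
      intro c hc e1
      have := leg_desc ℓ 2 1 c e 1 f hf (by push_cast; linear_combination e1) (by rw [h2]; norm_num)
        (by rw [h1]; norm_num) hc
      rw [h2, h1] at this
      norm_num at this
    rcases abs_choice (e ^ 2 - 2 * f ^ 2) with h' | h' <;> rw [h'] at h
    · exact key (-1) hm (by push_cast; linear_combination -h)
    · exact key 1 (by rw [h1]; norm_num) (by push_cast; linear_combination h)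

/-- norm from `ℚ(√2,√(pq))` to `ℚ` -/
lemma Lp_norm (hQ : IsQ ℚ Q κ) (hν : IsQ Q L ν) (w : L) (hw : w ^ 2 = p * q) (hνw : ν w = -w)
    (z : L) : ∃ A B : ℚ, Algebra.norm ℚ (Algebra.norm Q z) = A ^ 2 - p * q * B ^ 2 := by
  have w0 : w ≠ 0 := by
    rintro rfl
    exact pq_ne_zero (p := p) (q := q) L (by linear_combination -hw)
  obtain ⟨x, y, rfl⟩ := hν.decomp w0 hνw z
  have e1 : Algebra.norm Q (algebraMap Q L x + algebraMap Q L y * w) = x ^ 2 - p * q * y ^ 2 := by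
    apply (algebraMap Q L).injective
    rw [hν.norm_eq, map_add, map_mul, hν.fix, hν.fix, hνw]
    simp only [map_sub, map_mul, map_pow, map_natCast]
    linear_combination -(algebraMap Q L y) ^ 2 * hw
  obtain ⟨A, hA⟩ := hQ.exists_of_fixed (x := x * κ x + p * q * (y * κ y)) (by
    simp only [map_add, map_mul, map_natCast, hQ.invol]; ring)
  obtain ⟨B, hB⟩ := hQ.exists_of_fixed (x := x * κ y + y * κ x) (by
    simp only [map_add, map_mul, map_natCast, hQ.invol]; ring)
  refine ⟨A, B, ?_⟩
  apply (algebraMap ℚ Q).injective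
  rw [e1, hQ.norm_eq]
  simp only [map_sub, map_mul, map_pow, map_natCast, hA, hB]
  ring

lemma Lp_norm' (hQ : IsQ ℚ Q κ) (hν : IsQ Q L ν) (w : L) (hw : w ^ 2 = p * q) (hνw : ν w = -w)
    (z : L) : ∃ A B : ℚ, Algebra.norm ℚ z = A ^ 2 - p * q * B ^ 2 := by
  have : IsScalarTower ℚ Q L := IsScalarTower.of_algebraMap_eq (fun x => by simp)
  rw [← Algebra.norm_norm (R := ℚ) (S := Q)]
  exact Lp_norm hQ hν w hw hνw z

lemma TI_eq_neg {K : Type*} [Field K] {τ : K ≃+* K} {x : 𝓞 K} {y : K} (h : (x : K) = y)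
    (hy : τ y = -y) : TI τ x = -x := by
  apply RingOfIntegers.ext
  rw [TI_coe, h, hy]
  have : algebraMap (𝓞 K) K x = y := h
  change _ = algebraMap (𝓞 K) K _
  rw [map_neg, this]

lemma exists_int_of_quad {K : Type*} [Field K] [NumberField K] (x : K) (A B : 𝓞 K)
    (h : x ^ 2 = algebraMap (𝓞 K) K A * x + algebraMap (𝓞 K) K B) :
    ∃ y : 𝓞 K, algebraMap (𝓞 K) K y = x := by
  rw [← IsIntegrallyClosed.isIntegral_iff]
  refine ⟨Polynomial.X ^ 2 - Polynomial.C A * Polynomial.X - Polynomial.C B, ?_, ?_⟩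
  · monicity!
  · rw [Polynomial.eval₂_sub, Polynomial.eval₂_sub, Polynomial.eval₂_pow, Polynomial.eval₂_mul,
      Polynomial.eval₂_X, Polynomial.eval₂_C, Polynomial.eval₂_C, h]
    ring

/-- explicit elements of `ℚ(√2,√(pq))` -/
lemma Lp_elements (D : LegData p q) (R W : 𝓞 L) (hR : R ^ 2 = 2) (hW : W ^ 2 = p * q)
    (hνR : TI ν R = R) (hνW : TI ν W = -W) :
    (∃ u : (𝓞 L)ˣ, (u : 𝓞 L) * TI ν u = -1) ∧
    (∃ π : 𝓞 L, π * TI ν π = p ∨ π * TI ν π = -p) ∧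
    (∃ π : 𝓞 L, π * TI ν π = q ∨ π * TI ν π = -q) := by
  have key : ∀ u : 𝓞 L, u * TI ν u = -1 → ∃ u : (𝓞 L)ˣ, (u : 𝓞 L) * TI ν u = -1 := by
    intro u hu
    refine ⟨⟨u, -TI ν u, by rw [mul_neg, hu, neg_neg], by rw [neg_mul, mul_comm, hu, neg_neg]⟩, hu⟩
  rcases D.pell1 with ⟨hl, a, b, h1⟩ | ⟨hl, a, b, h1⟩ <;>
    rcases D.pell2 with ⟨hl', c, d, h2⟩ | ⟨hl', c, d, h2⟩
  · have h1' : (p : 𝓞 L) * a ^ 2 - q * b ^ 2 = 1 := by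
      exact_mod_cast congrArg (Int.cast : ℤ → 𝓞 L) h1
    have h2' : (q : 𝓞 L) * c ^ 2 - 2 * p * d ^ 2 = 1 := by
      exact_mod_cast congrArg (Int.cast : ℤ → 𝓞 L) h2
    refine ⟨key ((b * c * q + a * d * p * R) + (a * c + b * d * R) * W) ?_,
      ⟨p * a + b * W, Or.inl ?_⟩, ⟨q * b + a * W, Or.inr ?_⟩⟩
    · simp only [map_add, map_mul, map_intCast, map_natCast, hνR, hνW]
      linear_combination (-(a * c + b * d * R) ^ 2 : 𝓞 L) * hW +
        (a ^ 2 * d ^ 2 * p ^ 2 - p * q * b ^ 2 * d ^ 2 : 𝓞 L) * hR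
        - (q * c ^ 2 - 2 * p * d ^ 2 : 𝓞 L) * h1' - h2'
    · simp only [map_add, map_mul, map_intCast, map_natCast, hνR, hνW]
      linear_combination (-b ^ 2 : 𝓞 L) * hW + (p : 𝓞 L) * h1'
    · simp only [map_add, map_mul, map_intCast, map_natCast, hνR, hνW]
      linear_combination (-a ^ 2 : 𝓞 L) * hW - (q : 𝓞 L) * h1'
  · rw [hl] at hl'; norm_num at hl'
  · rw [hl] at hl'; norm_num at hl'
  · have h1' : (p : 𝓞 L) * a ^ 2 - q * b ^ 2 = 2 := by
      exact_mod_cast congrArg (Int.cast : ℤ → 𝓞 L) h1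
    have h2' : (p : 𝓞 L) * c ^ 2 - 2 * q * d ^ 2 = -1 := by
      exact_mod_cast congrArg (Int.cast : ℤ → 𝓞 L) h2
    have R0 : R ≠ 0 := by rintro rfl; norm_num at hR
    refine ⟨?_, ⟨p * c + d * R * W, Or.inr ?_⟩, ⟨R * q * d + c * W, Or.inl ?_⟩⟩
    · set U : 𝓞 L := (a * c * p + b * d * q * R) + (b * c + a * d * R) * W with hU
      have hUU : U * TI ν U = -2 := by
        rw [hU]
        simp only [map_add, map_mul, map_intCast, map_natCast, hνR, hνW]
        linear_combination (-(b * c + a * d * R) ^ 2 : 𝓞 L) * hW +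
          (b ^ 2 * d ^ 2 * q ^ 2 - p * q * a ^ 2 * d ^ 2 : 𝓞 L) * hR
          + (p * c ^ 2 - 2 * q * d ^ 2 : 𝓞 L) * h1' + 2 * h2'
      have hUt : U + TI ν U = R * (R * (a * c * p) + 2 * (b * d * q)) := by
        rw [hU]
        simp only [map_add, map_mul, map_intCast, map_natCast, hνR, hνW]
        linear_combination (-a * c * p : 𝓞 L) * hR
      set A : 𝓞 L := R * (a * c * p) + 2 * (b * d * q) with hA
      have hU2 : U ^ 2 = R * A * U + 2 := by linear_combination U * hUt - hUU
      have Rk0 : algebraMap (𝓞 L) L R ≠ 0 := by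
        rwa [Ne, map_eq_zero_iff _ (FaithfulSMul.algebraMap_injective (𝓞 L) L)]
      have hRk := congrArg (algebraMap (𝓞 L) L) hR
      have hU2k := congrArg (algebraMap (𝓞 L) L) hU2
      simp only [map_pow, map_add, map_mul, map_ofNat] at hRk hU2k
      obtain ⟨u, hu⟩ := exists_int_of_quad (algebraMap (𝓞 L) L U / algebraMap (𝓞 L) L R) A 1 (by
        rw [map_one]
        field_simp
        linear_combination hU2k - hRk)
      have hRu : R * u = U := by
        apply FaithfulSMul.algebraMap_injective (𝓞 L) L
        rw [map_mul, hu]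
        field_simp
      apply key u
      have e := hUU
      rw [← hRu, map_mul, hνR] at e
      apply mul_left_cancel₀ (two_ne_zero : (2 : 𝓞 L) ≠ 0)
      linear_combination e - (u * TI ν u) * hR
    · simp only [map_add, map_mul, map_intCast, map_natCast, hνR, hνW]
      linear_combination (-d ^ 2 * R ^ 2 : 𝓞 L) * hW - (d ^ 2 * p * q : 𝓞 L) * hR + (p : 𝓞 L) * h2'
    · simp only [map_add, map_mul, map_intCast, map_natCast, hνR, hνW]
      linear_combination (-c ^ 2 : 𝓞 L) * hW + (q ^ 2 * d ^ 2 : 𝓞 L) * hR - (q : 𝓞 L) * h2'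

/-- the ramified prime above `2` -/
lemma Lp_T (D : LegData p q) (R W : 𝓞 L) (hR : R ^ 2 = 2) (hW : W ^ 2 = p * q) :
    ∃ T : Ideal (𝓞 L), T ^ 2 = Ideal.span {R} := by
  have h8 := D.pq8
  obtain ⟨m, hm⟩ : ∃ m : ℤ, (p : ℤ) * q + 1 = 8 * m := ⟨((p : ℤ) * q + 1) / 8, by omega⟩
  have hm' : (p : 𝓞 L) * q + 1 = 8 * m := by exact_mod_cast congrArg (Int.cast : ℤ → 𝓞 L) hm
  have R0 : R ≠ 0 := by rintro rfl; norm_num at hR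
  have Rk0 : algebraMap (𝓞 L) L R ≠ 0 := by
    rwa [Ne, map_eq_zero_iff _ (FaithfulSMul.algebraMap_injective (𝓞 L) L)]
  have e1 : (1 + W) ^ 2 = 2 * (4 * m + W) := by linear_combination hW + hm'
  have e1k := congrArg (algebraMap (𝓞 L) L) e1
  have hRk := congrArg (algebraMap (𝓞 L) L) hR
  simp only [map_pow, map_mul, map_ofNat] at e1k hRk
  obtain ⟨α, hα⟩ := exists_int_of_quad (algebraMap (𝓞 L) L (1 + W) / algebraMap (𝓞 L) L R) 0
    (4 * m + W) (by
      rw [div_pow, e1k, hRk, map_zero]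
      field_simp
      ring)
  have hRα : R * α = 1 + W := by
    apply FaithfulSMul.algebraMap_injective (𝓞 L) L
    rw [map_mul, hα]
    field_simp
  have hα2 : α ^ 2 = 4 * m + W := by
    apply mul_left_cancel₀ (two_ne_zero : (2 : 𝓞 L) ≠ 0)
    rw [← e1, ← hRα]
    linear_combination -α ^ 2 * hR
  have e2 : (1 + α) * (1 + α) = 4 * m + 2 * α + R * α := by linear_combination hα2 - hRα
  refine ⟨Ideal.span {R, 1 + α}, ?_⟩
  rw [pow_two, Ideal.span_pair_mul_span_pair]
  apply le_antisymm
  · rw [Ideal.span_le]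
    rintro x (rfl | rfl | rfl | rfl) <;> rw [SetLike.mem_coe, Ideal.mem_span_singleton]
    · exact dvd_mul_right _ _
    · exact dvd_mul_right _ _
    · exact dvd_mul_left _ _
    · rw [e2]
      exact ⟨2 * R * m + R * α + α, by linear_combination -(2 * m + α) * hR⟩
  · rw [Ideal.span_singleton_le_iff_mem]
    set S := Ideal.span {R * R, R * (1 + α), (1 + α) * R, (1 + α) * (1 + α)}
    have m1 : R * R ∈ S := Ideal.subset_span (Or.inl rfl)
    have m2 : R * (1 + α) ∈ S := Ideal.subset_span (Or.inr (Or.inl rfl))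
    have m3 : (1 + α) * (1 + α) ∈ S := Ideal.subset_span (Or.inr (Or.inr (Or.inr rfl)))
    have : R = R * (1 + α) - (1 + α) * (1 + α) + (2 * m + α) * (R * R) := by
      rw [e2]; linear_combination -(2 * m + α) * hR
    rw [this]
    exact S.add_mem (S.sub_mem m2 m3) (S.mul_mem_left _ m1)

end Lp

section Lp2
variable {p q : ℕ} [Fact p.Prime] [Fact q.Prime]
variable {Q L : Type*} [Field Q] [NumberField Q] [Field L] [NumberField L] [Algebra Q L]
  {κ : Q ≃+* Q} {ν : L ≃+* L}

lemma Lp_units (D : LegData p q) (hQ : IsQ ℚ Q κ) (hν : IsQ Q L ν) (w : L) (hw : w ^ 2 = p * q)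
    (hνw : ν w = -w) (r : Q) (hr : r ^ 2 = 2) (hκ : κ r = -r)
    (hneg : (-1 : (𝓞 Q)ˣ) ∈ (nU Q L).range) (v : (𝓞 Q)ˣ)
    (hv : ∃ x : L, x * ν x = algebraMap Q L ((v : 𝓞 Q) : Q)) : v ∈ (nU Q L).range := by
  have r0 : r ≠ 0 := by rintro rfl; norm_num at hr
  obtain ⟨R, hR⟩ := int_of_sq r 2 (by rw [hr]; norm_num)
  have hRQ : algebraMap (𝓞 Q) Q R = r := hR
  have R2 : R ^ 2 = 2 := by
    apply RingOfIntegers.ext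
    change algebraMap (𝓞 Q) Q _ = algebraMap (𝓞 Q) Q _
    rw [map_pow, hRQ, hr, map_ofNat]
  have hTR := TI_eq_neg hR hκ
  -- norm one
  have hker : ∀ v : (𝓞 Q)ˣ, (∃ x : L, x * ν x = algebraMap Q L ((v : 𝓞 Q) : Q)) →
      v ∈ (nU ℚ Q).ker := by
    rintro v ⟨x, hx⟩
    rw [MonoidHom.mem_ker]
    rcases rat_units (nU ℚ Q v) with h | h
    · exact h
    · exfalso
      obtain ⟨A, B, hAB⟩ := Lp_norm hQ hν w hw hνw x
      have e1 : Algebra.norm Q x = algebraMap (𝓞 Q) Q (v : 𝓞 Q) := by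
        apply (algebraMap Q L).injective
        rw [hν.norm_eq, hx]
      have e2 : Algebra.norm ℚ (algebraMap (𝓞 Q) Q (v : 𝓞 Q)) = -1 := by
        apply (algebraMap ℚ Q).injective
        rw [hQ.norm_eq]
        have e3 := congrArg (algebraMap (𝓞 Q) Q) (nU_spec hQ v)
        rw [h] at e3
        simp only [map_mul, Units.val_neg, Units.val_one, map_neg, map_one] at e3 ⊢
        rw [e3]; rfl
      rw [e1, e2] at hAB
      exact D.lneg A B 1 one_ne_zero (by linear_combination hAB)
  have hle : (powMonoidHom 2 : (𝓞 Q)ˣ →* (𝓞 Q)ˣ).range ≤ (nU Q L).range := by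
    rintro _ ⟨v, rfl⟩
    exact ⟨iU Q L v, nU_iU hν v⟩
  have hidx : (powMonoidHom 2 : (𝓞 Q)ˣ →* (𝓞 Q)ˣ).range.index = 4 := by
    rw [index_sq_units, rank_sqrt2 hQ r hr hκ]; rfl
  have hnot : (-1 : (𝓞 Q)ˣ) ∉ (powMonoidHom 2 : (𝓞 Q)ˣ →* (𝓞 Q)ˣ).range := by
    rintro ⟨v, hv⟩
    have hv2 : (algebraMap (𝓞 Q) Q (v : 𝓞 Q)) ^ 2 = -1 := by
      have := congrArg (fun u : (𝓞 Q)ˣ => algebraMap (𝓞 Q) Q (u : 𝓞 Q)) hv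
      simpa using this
    obtain ⟨a, b, e⟩ := hQ.decomp r0 hκ (algebraMap (𝓞 Q) Q (v : 𝓞 Q))
    rw [e] at hv2
    have e2 : algebraMap ℚ Q (a ^ 2 + 2 * b ^ 2) + algebraMap ℚ Q (2 * a * b) * r
      = algebraMap ℚ Q (-1) + algebraMap ℚ Q 0 * r := by
      simp only [map_add, map_mul, map_pow, map_natCast, map_ofNat, map_neg, map_one, map_zero]
      linear_combination hv2 - (algebraMap ℚ Q b) ^ 2 * hr
    have e3 := (hQ.decomp_unique r0 hκ e2).1
    have : (0 : ℚ) ≤ a ^ 2 + 2 * b ^ 2 := by positivity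
    linarith
  have hTK : (nU Q L).range ≤ (nU ℚ Q).ker := by
    rintro _ ⟨u, rfl⟩
    apply hker
    refine ⟨((u : 𝓞 L) : L), ?_⟩
    have := congrArg (algebraMap (𝓞 L) L) (nU_spec hν u)
    exact this.symm
  -- the fundamental unit
  have hu : (1 + R) * (R - 1) = 1 := by linear_combination R2
  set ε : (𝓞 Q)ˣ := ⟨1 + R, R - 1, hu, by rw [mul_comm]; exact hu⟩ with hε
  have hεK : ε ∉ (nU ℚ Q).ker := by
    rw [MonoidHom.mem_ker]
    intro h
    have e := nU_spec hQ ε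
    rw [h] at e
    change _ = (1 + R) * TI κ (1 + R) at e
    rw [map_add, map_one, hTR] at e
    simp only [Units.val_one, map_one] at e
    have : (2 : 𝓞 Q) = 0 := by linear_combination e - R2
    exact two_ne_zero this
  have hrel := relIndex_two_of_index_four hidx hle hneg hnot (fun h => hεK (hTK h))
  have hT2 : (nU Q L).range.index = 2 := by
    have := Subgroup.relIndex_mul_index hle
    rw [hrel, hidx] at this
    omega
  have h3 := Subgroup.relIndex_mul_index hTK
  rw [hT2] at h3
  have h4 : (nU ℚ Q).ker.index ≠ 1 := by
    rw [Ne, Subgroup.index_eq_one]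
    intro h; rw [h] at hεK; exact hεK trivial
  have h5 : (nU Q L).range.relIndex (nU ℚ Q).ker = 1 := by
    have hd : (nU ℚ Q).ker.index ∣ 2 := ⟨_, by rw [← h3, mul_comm]⟩
    rcases (Nat.dvd_prime Nat.prime_two).1 hd with h | h
    · exact absurd h h4
    · rw [h] at h3; omega
  rw [Subgroup.relIndex_eq_one] at h5
  exact h5 (hker v hv)

theorem Lp_primary (D : LegData p q) (hQ : IsQ ℚ Q κ) (hν : IsQ Q L ν) (w : L) (hw : w ^ 2 = p * q)
    (hνw : ν w = -w) (r : Q) (hr : r ^ 2 = 2) (hκ : κ r = -r) (R : 𝓞 L)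
    (hR : (R : L) = algebraMap Q L r) :
    (∃ u : (𝓞 L)ˣ, (u : 𝓞 L) * TI ν u = -1) ∧ ∃ T : Ideal (𝓞 L), T ^ 2 = Ideal.span {R} ∧
      ∀ I : Ideal (𝓞 L), I ≠ ⊥ → cls I ∈ CommGroup.primaryComponent (ClassGroup (𝓞 L)) 2 →
        cls I = 1 ∨ cls I = cls T := by
  have := pid_sqrt2 hQ r hr hκ
  have r0 : r ≠ 0 := by rintro rfl; norm_num at hr
  have w0 : w ≠ 0 := by
    rintro rfl
    exact pq_ne_zero (p := p) (q := q) L (by linear_combination -hw)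
  obtain ⟨W, hW⟩ := int_of_sq w (p * q) (by rw [hw]; push_cast; ring)
  have hWL : algebraMap (𝓞 L) L W = w := hW
  have hRL : algebraMap (𝓞 L) L R = algebraMap Q L r := hR
  have W2 : W ^ 2 = p * q := by
    apply RingOfIntegers.ext
    change algebraMap (𝓞 L) L _ = algebraMap (𝓞 L) L _
    rw [map_pow, hWL, hw, map_mul, map_natCast, map_natCast]
  have R2 : R ^ 2 = 2 := by
    apply RingOfIntegers.ext
    change algebraMap (𝓞 L) L _ = algebraMap (𝓞 L) L _
    rw [map_pow, hRL, ← map_pow, hr, map_ofNat, map_ofNat]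
  have hTW := TI_eq_neg hW hνw
  have hTR : TI ν R = R := by
    apply RingOfIntegers.ext
    rw [TI_coe, hR, hν.fix]
  obtain ⟨⟨u, hu⟩, ⟨πp, hπp⟩, ⟨πq, hπq⟩⟩ := Lp_elements D R W R2 W2 hTR hTW
  obtain ⟨T, hT⟩ := Lp_T D R W R2 W2
  refine ⟨⟨u, hu⟩, T, hT, ?_⟩
  have hneg : (-1 : (𝓞 Q)ˣ) ∈ (nU Q L).range := by
    refine ⟨u, ?_⟩
    apply Units.ext
    apply FaithfulSMul.algebraMap_injective (𝓞 Q) (𝓞 L)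
    rw [nU_spec hν, hu]
    simp
  have hH2 := Lp_units D hQ hν w hw hνw r hr hκ hneg
  -- norm of T
  obtain ⟨RQ, hRQ⟩ := int_of_sq r 2 (by rw [hr]; norm_num)
  have hRR : algebraMap (𝓞 Q) (𝓞 L) RQ = R := by
    apply RingOfIntegers.ext
    rw [hR, ← hRQ]; rfl
  have nT : Ideal.absNorm T = 2 := by
    have e : (Ideal.span {RQ}).map (algebraMap (𝓞 Q) (𝓞 L)) = T ^ 2 := by
      rw [Ideal.map_span, Set.image_singleton, hRR, hT]
    rw [hν.absNorm_of_sq e]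
    have e3 := norm_sqrt2 hQ r hr hκ 0 1
    rw [map_zero, map_one, zero_add, one_mul] at e3
    have e2 : (Ideal.absNorm (Ideal.span {RQ}) : ℚ) = 2 := by
      rw [absNorm_span_rat, hRQ, e3]; norm_num
    exact_mod_cast e2
  have T0 := (prime_of_absNorm Nat.prime_two nT).2.1
  have kT : cls T ^ 2 = 1 := by rw [← cls_pow T0, hT, cls_span]
  have finL : Module.finrank ℚ L = 4 := by rw [finrank_rat_two hν, hQ.fin]
  -- primes over p and q
  have hpr : ∀ (ℓ : ℕ) (π : 𝓞 L), (ℓ = p ∨ ℓ = q) → (π * TI ν π = ℓ ∨ π * TI ν π = -ℓ) →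
      ∀ P : Ideal (𝓞 L), P.IsPrime → P ≠ ⊥ → (∀ x, x - TI ν x ∈ P) → (ℓ : 𝓞 L) ∈ P →
      cls P = 1 := by
    intro ℓ π hℓ hπ P hP hP0 hx hmem
    have hℓp : ℓ.Prime := by rcases hℓ with rfl | rfl <;> exact Fact.out
    have hπP : π ∈ P := by
      have h1 : π * TI ν π ∈ P := by
        rcases hπ with h | h <;> rw [h]
        · exact hmem
        · exact P.neg_mem hmem
      rcases hP.mem_or_mem h1 with h | h
      · exact h
      · have := P.add_mem (hx π) h
        rwa [sub_add_cancel] at this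
    have hn : Ideal.absNorm (Ideal.span {π}) = ℓ ^ 2 := by
      have h1 : Ideal.span {π} * (Ideal.span {π}).map (TI ν) = Ideal.span {((ℓ : ℤ) : 𝓞 L)} := by
        rw [Ideal.map_span, Set.image_singleton, Ideal.span_singleton_mul_span_singleton]
        rcases hπ with h | h <;> rw [h]
        · simp
        · rw [Ideal.span_singleton_neg]; simp
      have h2 := congrArg Ideal.absNorm h1
      rw [map_mul, IsQ.absNorm_map_TI, absNorm_intCast_span, finL, Int.natAbs_natCast,
        ← pow_two, show ℓ ^ 4 = (ℓ ^ 2) ^ 2 by ring] at h2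
      exact Nat.pow_left_injective two_ne_zero h2
    have hle : Ideal.span {π} ≤ P := (Ideal.span_singleton_le_iff_mem _).2 hπP
    obtain ⟨J, hJ⟩ := Ideal.dvd_iff_le.2 hle
    have hd : Ideal.absNorm P ∣ ℓ ^ 2 := by
      rw [← hn, hJ, map_mul]; exact dvd_mul_right _ _
    obtain ⟨j, hj, hPj⟩ := (Nat.dvd_prime_pow hℓp).1 hd
    interval_cases j
    · rw [pow_zero, Ideal.absNorm_eq_one_iff] at hPj
      exact absurd hPj hP.ne_top
    · exfalso
      obtain ⟨g, hg0, hg⟩ := cls_eq_one (relNorm_ne_bot (F := Q) hP0) (cls_of_pid _)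
      have e2 : (Ideal.absNorm P : ℚ) = |Algebra.norm ℚ (g : Q)| := by
        rw [← absNorm_span_rat, ← hg, Ideal.absNorm_relNorm]
      obtain ⟨e', f', hef⟩ := hQ.decomp r0 hκ (g : Q)
      rw [hef, norm_sqrt2 hQ r hr hκ, hPj, pow_one] at e2
      exact inert_aux D ℓ hℓ e' f' e2.symm
    · have h1 := congrArg Ideal.absNorm hJ
      rw [hn, map_mul, hPj] at h1
      have h2 : Ideal.absNorm J = 1 := by
        have : 0 < ℓ ^ 2 := pow_pos hℓp.pos 2
        exact Nat.eq_of_mul_eq_mul_left this (by rw [← h1, mul_one])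
      rw [Ideal.absNorm_eq_one_iff] at h2
      rw [h2, Ideal.mul_top] at hJ
      rw [← hJ, cls_span]
  -- 2-torsion
  have htor : ∀ c : ClassGroup (𝓞 L), c ^ 2 = 1 → c = 1 ∨ c = cls T := by
    intro c hc
    have hcl : c ∈ Subgroup.closure ({cls T, 1} : Set (ClassGroup (𝓞 L))) := by
      refine two_torsion_mem hν hH2 _ ?_ c hc
      intro P hP hP0 hx
      have t1 : 2 * W ∈ P := by
        have := hx W
        rw [hTW] at this
        convert this using 1; ring
      have t2 : (2 : 𝓞 L) * (p * q) ∈ P := by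
        have := P.mul_mem_right W t1
        rwa [mul_assoc, ← pow_two, W2] at this
      rcases hP.mem_or_mem t2 with h | h
      · have h1 : T ≤ P := by
          apply hP.le_of_pow_le (n := 2)
          rw [hT, Ideal.span_singleton_le_iff_mem]
          apply hP.mem_of_pow_mem 2
          rwa [R2]
        rw [prime_eq_of_mem Nat.prime_two nT hP h1]
        exact Subgroup.subset_closure (by simp)
      · rcases hP.mem_or_mem h with h | h
        · rw [hpr p πp (Or.inl rfl) hπp P hP hP0 hx h]; exact one_mem _
        · rw [hpr q πq (Or.inr rfl) hπq P hP hP0 hx h]; exact one_mem _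
    rcases klein_mem kT (one_pow 2) hcl with h | h | h | h
    · exact Or.inl h
    · exact Or.inr h
    · exact Or.inl h
    · rw [mul_one] at h; exact Or.inr h
  have hno4 : ∀ c : ClassGroup (𝓞 L), c ^ 4 = 1 → c ^ 2 = 1 := by
    intro c hc
    obtain ⟨I, hI, rfl⟩ := cls_surj c
    rcases htor (cls I ^ 2) (by rw [← pow_mul]; exact hc) with h1 | h1
    · exact h1
    · exfalso
      rw [← cls_pow hI] at h1
      obtain ⟨z, V, hz, hV, e2⟩ := norm_of_cls (pow_ne_zero 2 hI) T0 h1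
      obtain ⟨A, B, hAB⟩ := Lp_norm' hQ hν w hw hνw z
      rw [hAB, map_pow, nT] at e2
      push_cast at e2
      rcases abs_choice (A ^ 2 - p * q * B ^ 2) with h | h <;> rw [h] at e2
      · exact D.l2 2 (Or.inl rfl) (A * Ideal.absNorm I) (B * Ideal.absNorm I) V hV
          (by push_cast; linear_combination -e2)
      · exact D.l2 (-2) (Or.inr rfl) (A * Ideal.absNorm I) (B * Ideal.absNorm I) V hV
          (by push_cast; linear_combination e2)
  intro I hI hc
  exact htor _ (aux_no_order_four hno4 _ hc)

end Lp2

section stepL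
variable {p q : ℕ} [Fact p.Prime] [Fact q.Prime]
variable {k Q Q8 Lp F L : Type*} [Field k] [NumberField k] [Field Q] [NumberField Q] [Field Q8]
  [NumberField Q8] [Field Lp] [NumberField Lp] [Field F] [NumberField F] [Field L] [NumberField L]
  [Algebra k F] [Algebra Q Q8] [Algebra Q Lp] [Algebra Q8 L] [Algebra Lp L] [Algebra F L]
  {κk : k ≃+* k} {κ : Q ≃+* Q} {ν : Lp ≃+* Lp} {γ : Q8 ≃+* Q8} {σ : F ≃+* F}
  {c δ τ : L ≃+* L}

/-- `1 + √2` is not a norm from `F(i)` -/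
lemma eps_not_norm (D : LegData p q) (hk : IsQ ℚ k κk) (s : k) (hs : s ^ 2 = -(p * q))
    (hκs : κk s = -s) (hσ : IsQ k F σ) (r : F) (hr : r ^ 2 = 2) (hσr : σ r = -r)
    (hτ : IsQ F L τ) (i : L) (hi : i ^ 2 = -1) (hτi : τ i = -i) (x : L)
    (hx : x * τ x = algebraMap F L (1 + r)) : False := by
  have i0 : i ≠ 0 := by rintro rfl; norm_num at hi
  have s0 : s ≠ 0 := by
    rintro rfl
    exact pq_ne_zero (p := p) (q := q) k (by linear_combination hs)
  obtain ⟨a, b, rfl⟩ := hτ.decomp i0 hτi x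
  have e1 : a ^ 2 + b ^ 2 = 1 + r := by
    apply (algebraMap F L).injective
    rw [← hx]
    simp only [map_add, map_mul, map_pow, hτ.fix, hτi]
    linear_combination (algebraMap F L b) ^ 2 * hi
  have e2 := congrArg σ e1
  simp only [map_add, map_pow, map_one, hσr] at e2
  obtain ⟨A, hA⟩ := hσ.exists_of_fixed (x := a * σ a - b * σ b) (by
    simp only [map_sub, map_mul, hσ.invol]; ring)
  obtain ⟨B, hB⟩ := hσ.exists_of_fixed (x := a * σ b + b * σ a) (by
    simp only [map_add, map_mul, hσ.invol]; ring)
  have e3 : A ^ 2 + B ^ 2 = -1 := by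
    apply (algebraMap k F).injective
    simp only [map_add, map_pow, map_neg, map_one, hA, hB]
    linear_combination (σ a ^ 2 + σ b ^ 2) * e1 + (1 + r) * e2 - hr
  obtain ⟨a0, b0, rfl⟩ := hk.decomp s0 hκs A
  obtain ⟨c0, d0, rfl⟩ := hk.decomp s0 hκs B
  have e4 : algebraMap ℚ k (a0 ^ 2 + c0 ^ 2 - p * q * (b0 ^ 2 + d0 ^ 2)) +
      algebraMap ℚ k (2 * (a0 * b0 + c0 * d0)) * s
      = algebraMap ℚ k (-1) + algebraMap ℚ k 0 * s := by
    simp only [map_add, map_sub, map_mul, map_pow, map_natCast, map_ofNat, map_neg, map_one, map_zero]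
    linear_combination e3 - ((algebraMap ℚ k b0) ^ 2 + (algebraMap ℚ k d0) ^ 2) * hs
  have e5 := hk.decomp_unique s0 hκs e4
  exact two_squares_quad ((p : ℤ) * q) D.pq8 a0 b0 c0 d0 (by push_cast; linear_combination e5.1)
    (by linear_combination e5.2 / 2)

/-- existence of the integer `ζ₈` -/
lemma exists_zeta {K : Type*} [Field K] [NumberField K] (r i : K) (hr : r ^ 2 = 2)
    (hi : i ^ 2 = -1) : ∃ Z : 𝓞 K, algebraMap (𝓞 K) K Z = r * (1 + i) / 2 := by
  obtain ⟨I, hI⟩ := int_of_sq i (-1) (by rw [hi]; norm_num)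
  have hI' : algebraMap (𝓞 K) K I = i := hI
  apply exists_int_of_quad _ 0 I
  rw [map_zero, hI']
  linear_combination (1 + i) ^ 2 / 4 * hr + hi / 2

/-- complex conjugation acts as inversion on 2-primary classes -/
lemma L_conj (D : LegData p q) (hQ : IsQ ℚ Q κ) (rQ : Q) (hrQ : rQ ^ 2 = 2) (hκ : κ rQ = -rQ)
    (hν : IsQ Q Lp ν) (wp : Lp) (hwp : wp ^ 2 = p * q) (hνw : ν wp = -wp)
    (hc : IsQ Lp L c) (R Y : 𝓞 L) (hR : (R : L) = algebraMap Lp L (algebraMap Q Lp rQ))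
    (hY : Ideal.span {Y} ^ 2 = Ideal.span {R})
    {I : Ideal (𝓞 L)} (hI : I ≠ ⊥)
    (hcl : cls I ∈ CommGroup.primaryComponent (ClassGroup (𝓞 L)) 2) :
    cls (I.map (TI c)) = (cls I)⁻¹ := by
  apply hc.cls_inv hI
  have hb := relNorm_ne_bot (F := Lp) hI
  have hcb := relNorm_primary (F := Lp) hI hcl
  obtain ⟨Rp, hRp⟩ := int_of_sq (algebraMap Q Lp rQ) 2 (by rw [← map_pow, hrQ, map_ofNat, Int.cast_ofNat])
  obtain ⟨_, T, hT, hall⟩ := Lp_primary D hQ hν wp hwp hνw rQ hrQ hκ Rp hRp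
  have hRR : algebraMap (𝓞 Lp) (𝓞 L) Rp = R := by
    apply RingOfIntegers.ext
    rw [hR, ← hRp]; rfl
  rcases hall _ hb hcb with h | h
  · exact map_span_one hb h
  · have hT0 : T ≠ ⊥ := by
      rintro rfl
      have : Rp = 0 := by
        rw [← Ideal.span_singleton_eq_bot, ← hT]; simp [pow_two]
      have e : algebraMap Q Lp rQ = 0 := by rw [← hRp, this]; rfl
      have e' : rQ = 0 := by simpa using e
      rw [e'] at hrQ; norm_num at hrQ
    rw [cls_jmap_congr hb hT0 h]
    have : T.map (algebraMap (𝓞 Lp) (𝓞 L)) = Ideal.span {Y} := by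
      apply ideal_sq_inj
      rw [← Ideal.map_pow, hT, Ideal.map_span, Set.image_singleton, hRR, hY]
    rw [this, cls_span]

theorem stepL (D : LegData p q)
    (hQ : IsQ ℚ Q κ) (rQ : Q) (hrQ : rQ ^ 2 = 2) (hκ : κ rQ = -rQ)
    (hν : IsQ Q Lp ν) (wp : Lp) (hwp : wp ^ 2 = p * q) (hνw : ν wp = -wp)
    (hQ8 : IsQ Q Q8 γ) (i8 : Q8) (hi8 : i8 ^ 2 = -1) (hγ : γ i8 = -i8)
    (hk : IsQ ℚ k κk) (s : k) (hs : s ^ 2 = -(p * q)) (hκs : κk s = -s)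
    (hσ : IsQ k F σ) (rF : F) (hσr : σ rF = -rF)
    (hc : IsQ Lp L c) (hδ : IsQ Q8 L δ) (hτ : IsQ F L τ)
    (r i w : L) (h1 : algebraMap Lp L (algebraMap Q Lp rQ) = r) (h2 : algebraMap Lp L wp = w)
    (h3 : algebraMap Q8 L i8 = i) (h4 : algebraMap F L rF = r)
    (h5 : algebraMap F L (algebraMap k F s) = i * w)
    (h6 : algebraMap Q8 L (algebraMap Q Q8 rQ) = r)
    (hτi : τ i = -i) (hci : c i = -i) (hδw : δ w = -w)
    (RF : 𝓞 F) (hRF : (RF : F) = rF) {P1 P2 : Ideal (𝓞 F)} (hP : P1 * P2 = Ideal.span {RF})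
    (hsup : P1 ⊔ P2 = ⊤) (n1 : Ideal.absNorm P1 = 2) (n2 : Ideal.absNorm P2 = 2) :
    Nat.card (CommGroup.primaryComponent (ClassGroup (𝓞 L)) 2) =
      Nat.card (CommGroup.primaryComponent (ClassGroup (𝓞 F)) 2) := by
  have r2 : r ^ 2 = 2 := by rw [← h1, ← map_pow, ← map_pow, hrQ, map_ofNat, map_ofNat]
  have i2 : i ^ 2 = -1 := by rw [← h3, ← map_pow, hi8, map_neg, map_one]
  have w2 : w ^ 2 = p * q := by
    rw [← h2, ← map_pow, hwp, map_mul, map_natCast, map_natCast]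
  have rF2 : rF ^ 2 = 2 := by
    apply (algebraMap F L).injective
    rw [map_pow, h4, r2, map_ofNat]
  have i0 : i ≠ 0 := by rintro rfl; norm_num at i2
  have r0 : r ≠ 0 := by rintro rfl; norm_num at r2
  have w0 : w ≠ 0 := by
    rintro rfl
    exact pq_ne_zero (p := p) (q := q) L (by linear_combination -w2)
  have wp0 : wp ≠ 0 := by rintro rfl; rw [map_zero] at h2; exact w0 h2.symm
  have rQ0 : rQ ≠ 0 := by rintro rfl; norm_num at hrQ
  have hτw : τ w = -w := by
    have := hτ.fix (algebraMap k F s)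
    rw [h5, map_mul, hτi] at this
    apply mul_left_cancel₀ i0
    linear_combination -this
  have hτr : τ r = r := by rw [← h4, hτ.fix]
  have hδr : δ r = r := by rw [← h6, hδ.fix]
  have hδi : δ i = i := by rw [← h3, hδ.fix]
  have hqq : ∀ x : ℚ, algebraMap Lp L (algebraMap Q Lp (algebraMap ℚ Q x)) = (x : L) := by
    intro x; simp
  have hcomp : c.trans δ = τ := by
    ext x
    obtain ⟨a, b, rfl⟩ := hc.decomp i0 hci x
    have hLp : ∀ a : Lp, δ (algebraMap Lp L a) = τ (algebraMap Lp L a) := by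
      intro a
      obtain ⟨x, y, rfl⟩ := hν.decomp wp0 hνw a
      obtain ⟨x0, x1, rfl⟩ := hQ.decomp rQ0 hκ x
      obtain ⟨y0, y1, rfl⟩ := hQ.decomp rQ0 hκ y
      simp only [map_add, map_mul, hqq, map_ratCast, h1, h2, hδr, hτr, hδw, hτw]
    rw [RingEquiv.trans_apply]
    simp only [map_add, map_mul, hLp, hc.fix, hci, map_neg, hδi, hτi]
  -- integers
  obtain ⟨R, hR⟩ := int_of_sq r 2 (by rw [r2]; norm_num)
  obtain ⟨Im, hIm⟩ := int_of_sq i (-1) (by rw [i2]; norm_num)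
  obtain ⟨Z, hZ⟩ := exists_zeta r i r2 i2
  have hRL : algebraMap (𝓞 L) L R = r := hR
  have hIL : algebraMap (𝓞 L) L Im = i := hIm
  have inj := FaithfulSMul.algebraMap_injective (𝓞 L) L
  have R2 : R ^ 2 = 2 := by
    apply inj
    rw [map_pow, hRL, r2, map_ofNat]
  have I2 : Im ^ 2 = -1 := by
    apply inj
    rw [map_pow, hIL, i2, map_neg, map_one]
  have Z2 : Z ^ 2 = Im := by
    apply inj
    rw [map_pow, hZ, hIL]
    linear_combination (1 + i) ^ 2 / 4 * r2 + i2 / 2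
  have RZ : R * Z = 1 + Im := by
    apply inj
    rw [map_mul, map_add, map_one, hZ, hIL, hRL]
    linear_combination (1 + i) / 2 * r2
  have hY2 : (1 - Z) ^ 2 = R * (Z * (1 - R)) := by
    linear_combination Z2 - RZ + Z * R2
  have hunit : IsUnit (Z * (1 - R)) := by
    refine IsUnit.of_mul_eq_one (Z ^ 7 * (-(1 + R))) ?_
    have z8 : Z ^ 8 = 1 := by
      rw [show Z ^ 8 = (Z ^ 2) ^ 4 by ring, Z2, show Im ^ 4 = (Im ^ 2) ^ 2 by ring, I2]; ring
    linear_combination (R ^ 2 - 1) * z8 + R2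
  have hY : Ideal.span {1 - Z} ^ 2 = Ideal.span {R} := by
    rw [Ideal.span_singleton_pow, hY2]
    exact Ideal.span_singleton_mul_right_unit hunit R
  -- H1
  have : IsPrincipalIdealRing (𝓞 Q8) := by
    obtain ⟨Z8, hZ8⟩ := exists_zeta (algebraMap Q Q8 rQ) i8 (by rw [← map_pow, hrQ, map_ofNat]) hi8
    exact pid_zeta8 hQ rQ hrQ hκ hQ8 i8 hi8 hγ Z8 hZ8
  have H1 : ∀ I : Ideal (𝓞 L), I ≠ ⊥ → cls I ∈ CommGroup.primaryComponent (ClassGroup (𝓞 L)) 2 →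
      cls (I.map (TI τ)) = cls I := by
    intro I hI hcl
    have e1 := L_conj D hQ rQ hrQ hκ hν wp hwp hνw hc R (1 - Z) (by rw [hR, h1]) hY hI hcl
    have e2 : cls ((I.map (TI c)).map (TI δ)) = (cls (I.map (TI c)))⁻¹ :=
      primary_inv hδ (TI_map_ne_bot c hI)
    rw [TI_mul_map, hcomp, e1, inv_inv] at e2
    exact e2
  -- units
  have hfF : Module.finrank ℚ F = 2 * 2 := by rw [finrank_rat_two hσ, hk.fin]
  have hfL : Module.finrank ℚ L = 2 * 4 := by rw [finrank_rat_two hτ, hfF]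
  have rkF : Units.rank F = 1 := by
    have := rank_complex F (algebraMap k F s) (p * q)
      (Nat.mul_pos (Fact.out : p.Prime).pos (Fact.out : q.Prime).pos)
      (by rw [← map_pow, hs]; push_cast; simp) 2 hfF
    simpa using this
  have rkL : Units.rank L = 3 := by
    have := rank_complex L i 1 one_pos (by rw [i2]; norm_num) 4 hfL
    simpa using this
  have hidx : (powMonoidHom 2 : (𝓞 F)ˣ →* (𝓞 F)ˣ).range.index = 4 := by
    rw [index_sq_units, rkF]; rfl
  have hle : (powMonoidHom 2 : (𝓞 F)ˣ →* (𝓞 F)ˣ).range ≤ (nU F L).range := by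
    rintro _ ⟨v, rfl⟩
    exact ⟨iU F L v, nU_iU hτ v⟩
  have hnot : (-1 : (𝓞 F)ˣ) ∉ (powMonoidHom 2 : (𝓞 F)ˣ →* (𝓞 F)ˣ).range := by
    rintro ⟨v, hv⟩
    have hv2 : (algebraMap (𝓞 F) F (v : 𝓞 F)) ^ 2 = -1 := by
      have := congrArg (fun u : (𝓞 F)ˣ => algebraMap (𝓞 F) F (u : 𝓞 F)) hv
      simpa using this
    have hv3 : (algebraMap F L (algebraMap (𝓞 F) F (v : 𝓞 F))) ^ 2 = i ^ 2 := by
      rw [← map_pow, hv2, i2, map_neg, map_one]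
    have hfix := hτ.fix (algebraMap (𝓞 F) F (v : 𝓞 F))
    have hii : i = -i := by
      rcases sq_eq_sq_iff_eq_or_eq_neg.1 hv3 with h | h <;> rw [h] at hfix
      · rw [hτi] at hfix; exact hfix.symm
      · rw [map_neg, hτi, neg_neg] at hfix; exact hfix
    exact i0 (self_eq_neg.1 hii)
  have hneg : (-1 : (𝓞 F)ˣ) ∈ (nU F L).range := by
    obtain ⟨Rp, hRp⟩ := int_of_sq (algebraMap Q Lp rQ) 2 (by rw [← map_pow, hrQ, map_ofNat, Int.cast_ofNat])
    obtain ⟨⟨u, hu⟩, _⟩ := Lp_primary D hQ hν wp hwp hνw rQ hrQ hκ Rp hRp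
    have hres : ∀ a : Lp, τ (algebraMap Lp L a) = algebraMap Lp L (ν a) := by
      intro a
      obtain ⟨x, y, rfl⟩ := hν.decomp wp0 hνw a
      obtain ⟨x0, x1, rfl⟩ := hQ.decomp rQ0 hκ x
      obtain ⟨y0, y1, rfl⟩ := hQ.decomp rQ0 hκ y
      have hqn : ∀ x : Q, ν (algebraMap Q Lp x) = algebraMap Q Lp x := hν.fix
      simp only [map_add, map_mul, hqn, hνw, hqq, map_ratCast, h1, h2, hτr, hτw, map_neg]
    refine ⟨iU Lp L u, ?_⟩
    apply Units.ext
    apply FaithfulSMul.algebraMap_injective (𝓞 F) (𝓞 L)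
    rw [nU_spec hτ]
    have e1 : TI τ (algebraMap (𝓞 Lp) (𝓞 L) u) = algebraMap (𝓞 Lp) (𝓞 L) (TI ν u) := by
      apply RingOfIntegers.ext
      exact hres _
    change algebraMap (𝓞 Lp) (𝓞 L) u * TI τ (algebraMap (𝓞 Lp) (𝓞 L) u) = _
    rw [e1, ← map_mul, hu]
    simp
  have RF2 : RF ^ 2 = 2 := by
    apply FaithfulSMul.algebraMap_injective (𝓞 F) F
    have : algebraMap (𝓞 F) F RF = rF := hRF
    rw [map_pow, this, rF2, map_ofNat]
  have hu : (1 + RF) * (RF - 1) = 1 := by linear_combination RF2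
  set ε : (𝓞 F)ˣ := ⟨1 + RF, RF - 1, hu, by rw [mul_comm]; exact hu⟩ with hε
  have hεF : ((ε : 𝓞 F) : F) = 1 + rF := by
    have : algebraMap (𝓞 F) F RF = rF := hRF
    change algebraMap (𝓞 F) F (1 + RF) = _
    rw [map_add, map_one, this]
  have hnu : ∀ u : (𝓞 L)ˣ, ((u : 𝓞 L) : L) * τ ((u : 𝓞 L) : L) =
      algebraMap F L ((nU F L u : 𝓞 F) : F) := by
    intro u
    have := congrArg (algebraMap (𝓞 L) L) (nU_spec hτ u)
    exact this.symm
  have hεN : ∀ x : L, x * τ x = algebraMap F L ((ε : 𝓞 F) : F) → False := by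
    intro x hx
    rw [hεF] at hx
    exact eps_not_norm D hk s hs hκs hσ rF rF2 hσr hτ i i2 hτi x hx
  have hεT : ε ∉ (nU F L).range := by
    rintro ⟨u, hu'⟩
    apply hεN ((u : 𝓞 L) : L)
    rw [hnu, hu']
  have H4 := relIndex_two_of_index_four hidx hle hneg hnot hεT
  have hT2 : (nU F L).range.index = 2 := by
    have := Subgroup.relIndex_mul_index hle
    rw [H4, hidx] at this
    omega
  have H2 : ∀ v : (𝓞 F)ˣ, (∃ x : L, x * τ x = algebraMap F L ((v : 𝓞 F) : F)) →
      v ∈ (nU F L).range := by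
    rintro v ⟨x, hx⟩
    by_contra hv
    have hm : v * ε ∈ (nU F L).range := by
      rw [Subgroup.mul_mem_iff_of_index_two hT2]
      exact ⟨fun h => absurd h hv, fun h => absurd h hεT⟩
    obtain ⟨u, hu'⟩ := hm
    have hvF : ((v : 𝓞 F) : F) ≠ 0 := by
      intro h
      have : (v : 𝓞 F) = 0 := by
        apply RingOfIntegers.ext; exact h
      exact v.ne_zero this
    have hvL : algebraMap F L ((v : 𝓞 F) : F) ≠ 0 := by
      rwa [Ne, map_eq_zero_iff _ (algebraMap F L).injective]
    apply hεN (((u : 𝓞 L) : L) / x)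
    rw [map_div₀, div_mul_div_comm, hx, hnu, hu']
    rw [div_eq_iff hvL, ← map_mul]
    congr 1
    first
      | exact (map_mul (algebraMap (𝓞 F) F) (v : 𝓞 F) (ε : 𝓞 F)).trans (mul_comm _ _)
      | exact map_mul (algebraMap (𝓞 F) F) (v : 𝓞 F) (ε : 𝓞 F)
  -- ramification
  have hRR : algebraMap (𝓞 F) (𝓞 L) RF = R := by
    apply RingOfIntegers.ext
    rw [hR, ← h4, ← hRF]; rfl
  have hj : P1.map (algebraMap (𝓞 F) (𝓞 L)) * P2.map (algebraMap (𝓞 F) (𝓞 L)) =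
      Ideal.span {1 - Z} ^ 2 := by
    rw [← Ideal.map_mul, hP, Ideal.map_span, Set.image_singleton, hRR, hY]
  have hj1 : P1.map (algebraMap (𝓞 F) (𝓞 L)) ⊔ P2.map (algebraMap (𝓞 F) (𝓞 L)) = ⊤ := by
    rw [← Ideal.map_sup, hsup, Ideal.map_top]
  obtain ⟨q1, q2, q3⟩ := split_sq hj hj1
  have N1 := (hτ.absNorm_of_sq q1.symm).trans n1
  have N2 := (hτ.absNorm_of_sq q2.symm).trans n2
  have pr1 := prime_of_absNorm Nat.prime_two n1
  have pr2 := prime_of_absNorm Nat.prime_two n2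
  have hp12 : P1 ≠ P2 := by
    rintro rfl
    rw [sup_idem] at hsup
    exact pr1.1.ne_top hsup
  have hram : ∀ P : Ideal (𝓞 L), P.IsPrime → P ≠ ⊥ → (∀ x, x - TI τ x ∈ P) →
      P = (P1.map (algebraMap (𝓞 F) (𝓞 L)) ⊔ Ideal.span {1 - Z}) ∨
      P = (P2.map (algebraMap (𝓞 F) (𝓞 L)) ⊔ Ideal.span {1 - Z}) := by
    intro P hPp hP0 hx
    have g1 := hx Im
    rw [TI_eq_neg hIm hτi] at g1
    have g2 : R ∈ P := by
      apply hPp.mem_of_pow_mem 2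
      have := P.mul_mem_left (-Im) g1
      rwa [show -Im * (Im - -Im) = R ^ 2 by linear_combination -2 * I2 - R2] at this
    have g3 : Ideal.span {1 - Z} ≤ P := by
      rw [Ideal.span_singleton_le_iff_mem]
      apply hPp.mem_of_pow_mem 2
      rw [hY2]
      exact P.mul_mem_right _ g2
    rw [← q3] at g3
    rcases hPp.mul_le.1 g3 with h | h
    · left; exact prime_eq_of_mem Nat.prime_two N1 hPp h
    · right; exact prime_eq_of_mem Nat.prime_two N2 hPp h
  have hT := theoremT hτ H1 H2 pr1.1 pr2.1 pr1.2.1 pr2.2.1 hp12 q1.symm q2.symm hram H4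
  rw [rkF, rkL] at hT
  omega

end stepL

section transfer

lemma card_primary_congr {k k' : Type*} [Field k] [NumberField k] [Field k'] [NumberField k']
    (e : k ≃+* k') : Nat.card (CommGroup.primaryComponent (ClassGroup (𝓞 k)) 2) =
      Nat.card (CommGroup.primaryComponent (ClassGroup (𝓞 k')) 2) := by
  let f : ClassGroup (𝓞 k) ≃* ClassGroup (𝓞 k') :=
    ClassGroup.mulEquiv (RingOfIntegers.mapRingEquiv e)
  refine Nat.card_congr (Equiv.subtypeEquiv f.toEquiv ?_)
  intro a
  rw [CommGroup.mem_primaryComponent, CommGroup.mem_primaryComponent]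
  refine exists_congr fun n => ?_
  change _ ↔ f a ^ _ = 1
  rw [← map_pow, map_eq_one_iff f f.injective]

lemma quad_iso {k k' : Type*} [Field k] [Field k'] [Algebra ℚ k] [Algebra ℚ k']
    (f1 : Module.finrank ℚ k = 2) (f2 : Module.finrank ℚ k' = 2) (s : k) (s' : k') (a : ℚ)
    (hs : s ^ 2 = algebraMap ℚ k a) (hs' : s' ^ 2 = algebraMap ℚ k' a)
    (ha : ∀ b : ℚ, b ^ 2 ≠ a) : Nonempty (k ≃+* k') := by
  have hirr : Irreducible (Polynomial.X ^ 2 - Polynomial.C a : Polynomial ℚ) :=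
    X_pow_sub_C_irreducible_of_prime Nat.prime_two ha
  have : Fact (Irreducible (Polynomial.X ^ 2 - Polynomial.C a : Polynomial ℚ)) := ⟨hirr⟩
  have hA : Module.finrank ℚ (AdjoinRoot (Polynomial.X ^ 2 - Polynomial.C a : Polynomial ℚ)) = 2 := by
    rw [(AdjoinRoot.powerBasis hirr.ne_zero).finrank, AdjoinRoot.powerBasis_dim,
      Polynomial.natDegree_X_pow_sub_C]
  have key : ∀ {k : Type _} [Field k] [Algebra ℚ k] (f1 : Module.finrank ℚ k = 2) (s : k)
      (hs : s ^ 2 = algebraMap ℚ k a),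
      Nonempty (AdjoinRoot (Polynomial.X ^ 2 - Polynomial.C a : Polynomial ℚ) ≃+* k) := by
    intro k _ _ f1 s hs
    let φ := AdjoinRoot.liftAlgHom (Polynomial.X ^ 2 - Polynomial.C a : Polynomial ℚ)
      (Algebra.ofId ℚ k) s (by
        simp [hs])
    have h1 : Function.Injective φ := φ.toRingHom.injective
    have : FiniteDimensional ℚ k := FiniteDimensional.of_finrank_pos (by omega)
    have : FiniteDimensional ℚ (AdjoinRoot (Polynomial.X ^ 2 - Polynomial.C a : Polynomial ℚ)) :=
      FiniteDimensional.of_finrank_pos (by omega)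
    have h2 : Function.Surjective φ :=
      (LinearMap.injective_iff_surjective_of_finrank_eq_finrank (f := φ.toLinearMap)
        (hA.trans f1.symm)).1 h1
    exact ⟨RingEquiv.ofBijective φ ⟨h1, h2⟩⟩
  have key' : ∀ {k : Type _} [Field k] [Algebra ℚ k] (f1 : Module.finrank ℚ k = 2) (s : k)
      (hs : s ^ 2 = algebraMap ℚ k a),
      Nonempty (AdjoinRoot (Polynomial.X ^ 2 - Polynomial.C a : Polynomial ℚ) ≃+* k) := by
    intro k _ _ f1 s hs
    let φ := AdjoinRoot.liftAlgHom (Polynomial.X ^ 2 - Polynomial.C a : Polynomial ℚ)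
      (Algebra.ofId ℚ k) s (by
        simp [hs])
    have h1 : Function.Injective φ := φ.toRingHom.injective
    have : FiniteDimensional ℚ k := FiniteDimensional.of_finrank_pos (by omega)
    have : FiniteDimensional ℚ (AdjoinRoot (Polynomial.X ^ 2 - Polynomial.C a : Polynomial ℚ)) :=
      FiniteDimensional.of_finrank_pos (by omega)
    have h2 : Function.Surjective φ :=
      (LinearMap.injective_iff_surjective_of_finrank_eq_finrank (f := φ.toLinearMap)
        (hA.trans f1.symm)).1 h1
    exact ⟨RingEquiv.ofBijective φ ⟨h1, h2⟩⟩
  obtain ⟨e1⟩ := key f1 s hs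
  obtain ⟨e2⟩ := key' f2 s' hs'
  exact ⟨e1.symm.trans e2⟩

lemma IsQ.rat {k : Type*} [Field k] [CharZero k] [inst : Algebra ℚ k] {κ : k ≃+* k}
    (h : @IsQ ℚ k _ _ inst κ) : @IsQ ℚ k _ _ DivisionRing.toRatAlgebra κ := by
  have : inst = DivisionRing.toRatAlgebra := Subsingleton.elim _ _
  rw [← this]; exact h

end transfer

section ratfacts
variable {p q : ℕ} [Fact p.Prime] [Fact q.Prime]

lemma rat_two (x : ℚ) : x ^ 2 ≠ 2 := by
  intro h
  have h1 : IsSquare ((2 : ℕ) : ℚ) := ⟨x, by push_cast; rw [← h]; ring⟩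
  rw [Rat.isSquare_natCast_iff] at h1
  exact not_sq_of 2 2 Nat.prime_two dvd_rfl (by norm_num) h1

lemma LegData.rat_pq (D : LegData p q) (x : ℚ) : x ^ 2 ≠ p * q := by
  intro h
  have hp : p.Prime := Fact.out
  have hq : q.Prime := Fact.out
  have h1 : IsSquare ((p * q : ℕ) : ℚ) := ⟨x, by push_cast; rw [← h]; ring⟩
  rw [Rat.isSquare_natCast_iff] at h1
  revert h1
  apply not_sq_of _ p hp (Dvd.intro _ rfl)
  intro h
  rw [pow_two] at h
  have := Nat.dvd_of_mul_dvd_mul_left hp.pos h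
  rw [Nat.prime_dvd_prime_iff_eq hp hq] at this
  exact D.ne this

lemma LegData.rat_2pq (D : LegData p q) (x : ℚ) : x ^ 2 ≠ 2 * (p * q) := by
  intro h
  have h1 : IsSquare ((2 * (p * q) : ℕ) : ℚ) := ⟨x, by push_cast; rw [← h]; ring⟩
  rw [Rat.isSquare_natCast_iff] at h1
  revert h1
  apply not_sq_of _ 2 Nat.prime_two (Dvd.intro _ rfl)
  have := D.pq8
  zify
  omega

lemma pq_pos : (0 : ℚ) < p * q := by
  have hp : p.Prime := Fact.out
  have hq : q.Prime := Fact.out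
  exact mul_pos (by exact_mod_cast hp.pos) (by exact_mod_cast hq.pos)

lemma neg_ne_sq {n : ℚ} (hn : n < 0) (x : ℚ) : x ^ 2 ≠ n := by
  intro h
  nlinarith [sq_nonneg x]

/-- rational squares in `ℚ(√2)` -/
lemma sq_in_E {E : Type*} [Field E] [CharZero E] {κ : E ≃+* E} (h : IsQ ℚ E κ) (r : E)
    (hr : r ^ 2 = 2) (hκ : κ r = -r) (x : E) (n : ℚ) (hx : x ^ 2 = algebraMap ℚ E n) :
    (∃ a : ℚ, a ^ 2 = n) ∨ ∃ b : ℚ, 2 * b ^ 2 = n := by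
  have r0 : r ≠ 0 := by rintro rfl; norm_num at hr
  obtain ⟨a, b, rfl⟩ := h.decomp r0 hκ x
  have e : algebraMap ℚ E (a ^ 2 + 2 * b ^ 2) + algebraMap ℚ E (2 * a * b) * r =
      algebraMap ℚ E n + algebraMap ℚ E 0 * r := by
    rw [← hx]
    simp only [map_add, map_mul, map_pow, map_ofNat, map_zero]
    linear_combination -(algebraMap ℚ E b) ^ 2 * hr
  obtain ⟨e1, e2⟩ := h.decomp_unique r0 hκ e
  rcases mul_eq_zero.1 e2 with h | h
  · right; refine ⟨b, ?_⟩
    have : a = 0 := by simpa using h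
    rw [← e1, this]; ring
  · left; refine ⟨a, ?_⟩
    rw [← e1, h]; ring

end ratfacts

section Fabs
variable {p q : ℕ} [Fact p.Prime] [Fact q.Prime]

/-- the field `F = ℚ(√2, √(-pq))` -/
theorem F_abs {F : Type*} [Field F] [NumberField F] (D : LegData p q)
    (h4 : Module.finrank ℚ F = 4) (r s : F) (hr : r ^ 2 = 2) (hs : s ^ 2 = -(p * q)) :
    ∃ (κ : ℚ⟮s⟯ ≃+* ℚ⟮s⟯) (σ : F ≃+* F) (R : 𝓞 F) (P1 P2 : Ideal (𝓞 F)),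
      IsQ ℚ ℚ⟮s⟯ κ ∧ κ (AdjoinSimple.gen ℚ s) = -AdjoinSimple.gen ℚ s ∧
      IsQ ℚ⟮s⟯ F σ ∧ σ r = -r ∧ (R : F) = r ∧
      P1 * P2 = Ideal.span {R} ∧ P1 ⊔ P2 = ⊤ ∧ Ideal.absNorm P1 = 2 ∧ Ideal.absNorm P2 = 2 ∧
      Nat.card (CommGroup.primaryComponent (ClassGroup (𝓞 F)) 2) =
        2 * Nat.card (CommGroup.primaryComponent (ClassGroup (𝓞 ℚ⟮s⟯)) 2) := by
  have inj : Function.Injective (algebraMap ℚ F) := (algebraMap ℚ F).injective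
  have hpos := pq_pos (p := p) (q := q)
  have hr' : r ^ 2 = algebraMap ℚ F 2 := by rw [hr, map_ofNat]
  have hs' : s ^ 2 = algebraMap ℚ F (-(p * q)) := by
    rw [hs, map_neg, map_mul, map_natCast, map_natCast]
  have ht' : (r * s) ^ 2 = algebraMap ℚ F (-(2 * (p * q))) := by
    rw [mul_pow, hr', hs', ← map_mul]; congr 1; ring
  have gen : ∀ (y : F) (n : ℚ), y ^ 2 = algebraMap ℚ F n → (∀ x : ℚ, x ^ 2 ≠ n) →
      ∀ x : ℚ, algebraMap ℚ F x ≠ y := by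
    rintro y n hy hn x rfl
    rw [← map_pow] at hy
    exact hn x (inj hy)
  have nr := gen r _ hr' rat_two
  have ns := gen s _ hs' (neg_ne_sq (by linarith))
  have nt := gen (r * s) _ ht' (neg_ne_sq (by linarith))
  have r0 : r ≠ 0 := by rintro rfl; norm_num at hr
  have s0 : s ≠ 0 := by rintro rfl; exact ns 0 (map_zero _)
  obtain ⟨κ, hk, hκ⟩ := adjoin_sqrt s _ hs' ns
  obtain ⟨κ', hQ, hκ'⟩ := adjoin_sqrt r _ hr' nr
  obtain ⟨μ, hM, hμ⟩ := adjoin_sqrt (r * s) _ ht' nt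
  obtain ⟨σ, hσ, hσs, hσr⟩ := biquad h4 s r _ _ hs' hr' ns nr (by rwa [mul_comm])
  obtain ⟨τ, hτ, hτr, hτs⟩ := biquad h4 r s _ _ hr' hs' nr ns nt
  obtain ⟨ρ, hρ, hρt, hρr⟩ := biquad h4 (r * s) r _ _ ht' hr' nt nr (by
    intro x hx
    apply ns (x / 2)
    rw [map_div₀, hx, map_ofNat]
    linear_combination s / 2 * hr)
  obtain ⟨R, hR⟩ := int_of_sq r 2 (by rw [hr, Int.cast_ofNat])
  have main := stepF2 D hσ hτ hρ hk.rat hQ.rat hM.rat (AdjoinSimple.gen ℚ s) (by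
      apply Subtype.ext
      change s ^ 2 = -((p : F) * q)
      exact hs) hκ (AdjoinSimple.gen ℚ r) (by
      apply Subtype.ext
      exact hr) hκ' (AdjoinSimple.gen ℚ (r * s)) (by
      apply Subtype.ext
      change (r * s) ^ 2 = -(2 * ((p : F) * q))
      rw [mul_pow, hr, hs]; ring) hμ r rfl rfl hσr hτs hρr R hR
  obtain ⟨hc, P1, P2, a1, a2, a3, a4⟩ := main
  exact ⟨κ, σ, R, P1, P2, hk, hκ, hσ, hσr, hR, a1, a2, a3, a4, hc⟩

end Fabs

section Labs
variable {p q : ℕ} [Fact p.Prime] [Fact q.Prime]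

lemma biquad_finrank {E L : Type*} [Field E] [CharZero E] [Field L] [Algebra E L] (r s : L) (a b : E)
    (hr : r ^ 2 = algebraMap E L a) (hs : s ^ 2 = algebraMap E L b)
    (nr : ∀ x : E, algebraMap E L x ≠ r) (ns : ∀ x : E, algebraMap E L x ≠ s)
    (nrs : ∀ x : E, algebraMap E L x ≠ r * s)
    (hgen : ∀ M : IntermediateField E L, r ∈ M → s ∈ M → M = ⊤) :
    Module.finrank E L = 4 := by
  obtain ⟨τ0, h0, hτ0⟩ := adjoin_sqrt r a hr nr
  have hr0 : r ≠ 0 := by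
    rintro rfl
    exact nr 0 (map_zero _)
  have hg0 : AdjoinSimple.gen E r ≠ 0 := by
    intro h
    exact hr0 (congrArg (fun z : E⟮r⟯ => (z : L)) h)
  have hn : ∀ z : E⟮r⟯, algebraMap E⟮r⟯ L z ≠ s := by
    intro z hz
    obtain ⟨x, y, e⟩ := h0.decomp hg0 hτ0 z
    have e1 : s = algebraMap E L x + algebraMap E L y * r := by
      rw [← hz, e]; rfl
    have e2 : algebraMap E E⟮r⟯ (x ^ 2 + a * y ^ 2) + algebraMap E E⟮r⟯ (2 * x * y) *
        AdjoinSimple.gen E r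
        = algebraMap E E⟮r⟯ b + algebraMap E E⟮r⟯ 0 * AdjoinSimple.gen E r := by
      apply Subtype.ext
      change algebraMap E L (x ^ 2 + a * y ^ 2) + algebraMap E L (2 * x * y) * r
        = algebraMap E L b + algebraMap E L 0 * r
      rw [← hs, e1]
      simp only [map_add, map_mul, map_pow, map_ofNat, map_zero, ← hr]
      ring
    have e3 := (h0.decomp_unique hg0 hτ0 e2).2
    rcases mul_eq_zero.1 e3 with h | h
    · have hx : x = 0 := by simpa using h
      apply nrs (a * y)
      rw [e1, hx, map_mul, ← hr, map_zero]
      ring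
    · apply ns x
      rw [e1, h, map_zero]; ring
  obtain ⟨τ1, h1, -⟩ := adjoin_sqrt (F := E⟮r⟯) s (algebraMap E E⟮r⟯ b) (by rw [hs]; rfl) hn
  have htop : E⟮r⟯⟮s⟯ = (⊤ : IntermediateField E⟮r⟯ L) := by
    have := hgen (E⟮r⟯⟮s⟯.restrictScalars E)
      ((E⟮r⟯⟮s⟯).algebraMap_mem (AdjoinSimple.gen E r)) (mem_adjoin_simple_self E⟮r⟯ s)
    rw [eq_top_iff]
    intro x _
    have hx : x ∈ (⊤ : IntermediateField E L) := mem_top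
    rw [← this] at hx
    exact hx
  have h2 : Module.finrank E⟮r⟯ L = 2 := by
    have := h1.fin
    rw [htop, finrank_top'] at this
    exact this
  rw [← Module.finrank_mul_finrank E E⟮r⟯ L, h0.fin, h2]

theorem L_abs {L : Type*} [Field L] [NumberField L] (D : LegData p q) (r i w : L) (hr : r ^ 2 = 2)
    (hi : i ^ 2 = -1) (hw : w ^ 2 = p * q)
    (hgen : ∀ M : IntermediateField ℚ L, r ∈ M → i ∈ M → w ∈ M → M = ⊤)
    {k' : Type*} [Field k'] [NumberField k'] (s' : k') (hs' : s' ^ 2 = -(p * q))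
    (hk' : Module.finrank ℚ k' = 2) :
    Nat.card (CommGroup.primaryComponent (ClassGroup (𝓞 L)) 2) =
      2 * Nat.card (CommGroup.primaryComponent (ClassGroup (𝓞 k')) 2) := by
  have hpos := pq_pos (p := p) (q := q)
  have hrQ : r ^ 2 = algebraMap ℚ L 2 := by rw [hr, map_ofNat]
  have nrQ : ∀ x : ℚ, algebraMap ℚ L x ≠ r := by
    rintro x rfl
    rw [← map_pow] at hrQ
    exact rat_two x ((algebraMap ℚ L).injective hrQ)
  obtain ⟨κ, hQ, hκ⟩ := adjoin_sqrt r _ hrQ nrQ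
  have hE2 : (AdjoinSimple.gen ℚ r) ^ 2 = 2 := by
    apply Subtype.ext; exact hr
  have i0 : i ≠ 0 := by rintro rfl; norm_num at hi
  have gen : ∀ (y : L) (n : ℚ), y ^ 2 = algebraMap ℚ L n → (∀ x : ℚ, x ^ 2 ≠ n) →
      (∀ x : ℚ, 2 * x ^ 2 ≠ n) → ∀ x : ℚ⟮r⟯, algebraMap ℚ⟮r⟯ L x ≠ y := by
    rintro y n hy hn hn' x rfl
    have hx : x ^ 2 = algebraMap ℚ ℚ⟮r⟯ n := by
      apply Subtype.ext
      refine hy.trans ?_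
      simp
    rcases sq_in_E hQ.rat _ hE2 hκ x n hx with ⟨a, ha⟩ | ⟨b, hb⟩
    · exact hn a ha
    · exact hn' b hb
  have ni := gen i (-1) (by rw [hi]; simp) (neg_ne_sq (by norm_num))
    (fun x h => by nlinarith [sq_nonneg x])
  have nw := gen w (p * q) (by rw [hw]; simp) D.rat_pq (fun x h => D.rat_2pq (2 * x) (by
    linear_combination 2 * h))
  have niw := gen (i * w) (-(p * q)) (by rw [mul_pow, hi, hw]; simp) (neg_ne_sq (by linarith))
    (fun x h => by nlinarith [sq_nonneg x])
  have hiE : i ^ 2 = algebraMap ℚ⟮r⟯ L (-1) := by rw [hi, map_neg, map_one]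
  have hwE : w ^ 2 = algebraMap ℚ⟮r⟯ L (p * q) := by rw [hw, map_mul, map_natCast, map_natCast]
  have hiwE : (i * w) ^ 2 = algebraMap ℚ⟮r⟯ L (-(p * q)) := by
    rw [mul_pow, hi, hw, map_neg, map_mul, map_natCast, map_natCast]; ring
  have h4 : Module.finrank ℚ⟮r⟯ L = 4 := by
    refine biquad_finrank i w _ _ hiE hwE ni nw niw ?_
    intro M hMi hMw
    have := hgen (M.restrictScalars ℚ) (M.algebraMap_mem (AdjoinSimple.gen ℚ r)) hMi hMw
    rw [eq_top_iff]
    intro x _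
    have hx : x ∈ (⊤ : IntermediateField ℚ L) := mem_top
    rw [← this] at hx
    exact hx
  obtain ⟨ν, hν, hνw⟩ := adjoin_sqrt w _ hwE nw
  obtain ⟨γ, hγ, hγi⟩ := adjoin_sqrt i _ hiE ni
  obtain ⟨φ, hφ, hφs⟩ := adjoin_sqrt (i * w) _ hiwE niw
  obtain ⟨c, hc, -, hci⟩ := biquad h4 w i _ _ hwE hiE nw ni (by rwa [mul_comm])
  obtain ⟨δ, hδ, -, hδw⟩ := biquad h4 i w _ _ hiE hwE ni nw niw
  obtain ⟨τ, hτ, -, hτi⟩ := biquad h4 (i * w) i _ _ hiwE hiE niw ni (by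
    intro x hx
    apply nw (-x)
    rw [map_neg, hx]
    linear_combination -w * hi)
  have hF4 : Module.finrank ℚ ℚ⟮r⟯⟮i * w⟯ = 4 := by
    rw [finrank_rat_two hφ, hQ.rat.fin]
  obtain ⟨κk, σ, R, P1, P2, hk, hκk, hσ, hσr, hR, a1, a2, a3, a4, hcard⟩ :=
    F_abs D hF4 (algebraMap ℚ⟮r⟯ ℚ⟮r⟯⟮i * w⟯ (AdjoinSimple.gen ℚ r))
      (AdjoinSimple.gen ℚ⟮r⟯ (i * w)) (by rw [← map_pow, hE2, map_ofNat]) (by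
        apply Subtype.ext
        change (i * w) ^ 2 = -((p : L) * q)
        rw [mul_pow, hi, hw]; ring)
  have hsk : (AdjoinSimple.gen ℚ (AdjoinSimple.gen ℚ⟮r⟯ (i * w))) ^ 2 = -(p * q) := by
    apply Subtype.ext
    apply Subtype.ext
    change (i * w) ^ 2 = -((p : L) * q)
    rw [mul_pow, hi, hw]; ring
  have hL := stepL D hQ.rat (AdjoinSimple.gen ℚ r) hE2 hκ hν (AdjoinSimple.gen _ w) (by
      apply Subtype.ext; exact hw) hνw hγ (AdjoinSimple.gen _ i) (by
      apply Subtype.ext; exact hi) hγi hk.rat _ hsk hκk hσ _ hσr hc hδ hτ r i w rfl rfl rfl rfl rfl rfl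
      hτi hci hδw R hR a1 a2 a3 a4
  obtain ⟨e⟩ := quad_iso (a := (-(p * q) : ℚ)) hk.rat.fin hk' _ s' (by rw [hsk]; simp)
    (by rw [hs']; simp) (neg_ne_sq (by linarith))
  rw [hL, hcard, card_primary_congr e]

end Labs

section final

lemma z8_cases (z r i : ℂ) (hr : r ^ 2 = 2) (hi : i ^ 2 = -1) (hz : z ^ 8 = 1) :
    z = 1 ∨ z = -1 ∨ z = i ∨ z = -i ∨ z = (1 + i) * r / 2 ∨ z = -((1 + i) * r / 2) ∨
      z = (1 - i) * r / 2 ∨ z = -((1 - i) * r / 2) := by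
  have h : (z ^ 2 - 1 ^ 2) * (z ^ 2 - i ^ 2) * (z ^ 2 - ((1 + i) * r / 2) ^ 2) *
      (z ^ 2 - ((1 - i) * r / 2) ^ 2) = 0 := by
    have e1 : ((1 + i) * r / 2) ^ 2 = i := by
      linear_combination (1 + i) ^ 2 / 4 * hr + hi / 2
    have e2 : ((1 - i) * r / 2) ^ 2 = -i := by
      linear_combination (1 - i) ^ 2 / 4 * hr + hi / 2
    rw [e1, e2, hi]
    linear_combination hz - (z ^ 4 - 1) * hi
  rcases mul_eq_zero.1 h with h | h
  · rcases mul_eq_zero.1 h with h | h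
    · rcases mul_eq_zero.1 h with h | h
      · rcases sq_eq_sq_iff_eq_or_eq_neg.1 (sub_eq_zero.1 h) with h | h <;> simp [h]
      · rcases sq_eq_sq_iff_eq_or_eq_neg.1 (sub_eq_zero.1 h) with h | h <;> simp [h]
    · rcases sq_eq_sq_iff_eq_or_eq_neg.1 (sub_eq_zero.1 h) with h | h <;> simp [h]
  · rcases sq_eq_sq_iff_eq_or_eq_neg.1 (sub_eq_zero.1 h) with h | h <;> simp [h]

lemma Lfield_finite (d : ℤ) : FiniteDimensional ℚ (Lfield 1 d) := by
  have hfin : ({z : ℂ | z ^ 2 ^ (1 + 2) = 1} ∪ {z : ℂ | z ^ 2 = (d : ℂ)}).Finite := by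
    apply Set.Finite.union
    · have := Polynomial.finite_setOf_isRoot
        (p := (Polynomial.X ^ 2 ^ (1 + 2) - Polynomial.C 1 : Polynomial ℂ))
        (Polynomial.X_pow_sub_C_ne_zero (by norm_num) _)
      refine this.subset ?_
      intro z hz
      have hz' : z ^ 8 = 1 := hz
      simp [Polynomial.IsRoot, hz']
    · have := Polynomial.finite_setOf_isRoot
        (p := (Polynomial.X ^ 2 - Polynomial.C (d : ℂ) : Polynomial ℂ))
        (Polynomial.X_pow_sub_C_ne_zero (by norm_num) _)
      refine this.subset ?_
      intro z hz
      have hz' : z ^ 2 = (d : ℂ) := hz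
      simp [Polynomial.IsRoot, hz']
  have := hfin.to_subtype
  refine finiteDimensional_adjoin ?_
  rintro z (hz | hz)
  · refine ⟨Polynomial.X ^ 2 ^ (1 + 2) - Polynomial.C 1,
      Polynomial.monic_X_pow_sub_C _ (by norm_num), ?_⟩
    have hz' : z ^ 8 = 1 := hz
    simp [hz']
  · refine ⟨Polynomial.X ^ 2 - Polynomial.C (d : ℚ),
      Polynomial.monic_X_pow_sub_C _ (by norm_num), ?_⟩
    have hz' : z ^ 2 = (d : ℂ) := hz
    rw [Polynomial.eval₂_sub, Polynomial.eval₂_C, Polynomial.eval₂_X_pow, hz']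
    simp

lemma quadField_eq (m : ℤ) (s : ℂ) (hs : s ^ 2 = (m : ℂ)) : quadField m = ℚ⟮s⟯ := by
  apply le_antisymm
  · refine adjoin_le_iff.2 ?_
    intro z hz
    have hz' : z ^ 2 = (m : ℂ) := hz
    rw [← hs] at hz'
    rcases sq_eq_sq_iff_eq_or_eq_neg.1 hz' with h | h
    · rw [h]; exact mem_adjoin_simple_self ℚ s
    · rw [h]; exact neg_mem (mem_adjoin_simple_self ℚ s)
  · rw [adjoin_simple_le_iff]
    exact subset_adjoin _ _ hs

end final

/-- for primes `p ≡ 5 (mod 8)` and `q ≡ 3 (mod 8)`, the 2-class number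
of `L_{1,pq} = ℚ(ζ₈, √(pq))` equals `2·h₂(-pq)`. -/
theorem twoClassNumber_Lfield_one_pq
    (p q : ℕ) (hp : p.Prime) (hq : q.Prime)
    (hp8 : p % 8 = 5) (hq8 : q % 8 = 3) :
    Nat.card (twoClassGroup (Lfield 1 ((p : ℤ) * q))) = 2 * h2 (-((p : ℤ) * q)) := by
  haveI : Fact p.Prime := ⟨hp⟩
  haveI : Fact q.Prime := ⟨hq⟩
  have D : LegData p q := legData hp8 hq8
  have hpos := pq_pos (p := p) (q := q)
  obtain ⟨r, hr⟩ := IsAlgClosed.exists_pow_nat_eq (2 : ℂ) (n := 2) (by norm_num)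
  obtain ⟨w, hw⟩ := IsAlgClosed.exists_pow_nat_eq ((p : ℂ) * q) (n := 2) (by norm_num)
  have hi : Complex.I ^ 2 = -1 := Complex.I_sq
  -- membership
  have i8 : Complex.I ^ 8 = 1 := by
    rw [show Complex.I ^ 8 = (Complex.I ^ 2) ^ 4 by ring, hi]; norm_num
  have hz8 : ((1 + Complex.I) * r / 2) ^ 8 = 1 := by
    have e1 : ((1 + Complex.I) * r / 2) ^ 2 = Complex.I := by
      linear_combination (1 + Complex.I) ^ 2 / 4 * hr + hi / 2
    rw [show ((1 + Complex.I) * r / 2) ^ 8 = (((1 + Complex.I) * r / 2) ^ 2) ^ 4 by ring, e1,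
      show Complex.I ^ 4 = (Complex.I ^ 2) ^ 2 by ring, hi]
    norm_num
  have hwd : w ^ 2 = (((p : ℤ) * q : ℤ) : ℂ) := by rw [hw]; push_cast; rfl
  have miL : Complex.I ∈ Lfield 1 ((p : ℤ) * q) := subset_adjoin _ _ (Or.inl i8)
  have mzL : (1 + Complex.I) * r / 2 ∈ Lfield 1 ((p : ℤ) * q) := subset_adjoin _ _ (Or.inl hz8)
  have mwL : w ∈ Lfield 1 ((p : ℤ) * q) := subset_adjoin _ _ (Or.inr hwd)
  have mrL : r ∈ Lfield 1 ((p : ℤ) * q) := by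
    have e : r = (1 - Complex.I) * ((1 + Complex.I) * r / 2) := by
      linear_combination r / 2 * hi
    rw [e]
    exact mul_mem (sub_mem (one_mem _) miL) mzL
  haveI : FiniteDimensional ℚ (Lfield 1 ((p : ℤ) * q)) := Lfield_finite _
  haveI : NumberField (Lfield 1 ((p : ℤ) * q)) := @NumberField.mk _ _ inferInstance (by
    convert this)
  -- the quadratic field
  have hs : (Complex.I * w) ^ 2 = ((-((p : ℤ) * q) : ℤ) : ℂ) := by
    rw [mul_pow, hi, hw]; push_cast; ring
  have hqf := quadField_eq _ _ hs
  obtain ⟨κ, hκ, -⟩ := adjoin_sqrt (F := ℚ) (K := ℂ) (Complex.I * w) (-(p * q) : ℚ)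
    (by rw [hs]; simp) (by
      intro x hx
      have h2 : algebraMap ℚ ℂ (x ^ 2) = algebraMap ℚ ℂ (-(p * q)) := by
        rw [map_pow, hx, hs]; simp
      exact neg_ne_sq (by linarith) x ((algebraMap ℚ ℂ).injective h2))
  have hk2 : Module.finrank ℚ (quadField (-((p : ℤ) * q))) = 2 := by rw [hqf]; exact hκ.fin
  haveI : FiniteDimensional ℚ (quadField (-((p : ℤ) * q))) :=
    FiniteDimensional.of_finrank_pos (by omega)
  haveI : NumberField (quadField (-((p : ℤ) * q))) := @NumberField.mk _ _ inferInstance (by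
    convert this)
  have msq : Complex.I * w ∈ quadField (-((p : ℤ) * q)) := subset_adjoin _ _ hs
  refine L_abs D (L := Lfield 1 ((p : ℤ) * q)) ⟨r, mrL⟩ ⟨Complex.I, miL⟩ ⟨w, mwL⟩
    (Subtype.ext hr) (Subtype.ext hi) (Subtype.ext hw) ?_
    (k' := quadField (-((p : ℤ) * q))) ⟨Complex.I * w, msq⟩ (Subtype.ext ?_) ?_
  · intro M mr mi mw
    have hle : Lfield 1 ((p : ℤ) * q) ≤ lift M := by
      have lr : r ∈ lift M := (mem_lift (⟨r, mrL⟩ : Lfield 1 ((p : ℤ) * q))).2 mr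
      have li : Complex.I ∈ lift M :=
        (mem_lift (⟨Complex.I, miL⟩ : Lfield 1 ((p : ℤ) * q))).2 mi
      have lw : w ∈ lift M := (mem_lift (⟨w, mwL⟩ : Lfield 1 ((p : ℤ) * q))).2 mw
      have l2 : (2 : ℂ) ∈ lift M := ofNat_mem _ 2
      refine adjoin_le_iff.2 ?_
      rintro z (hz | hz)
      · have ha := div_mem (mul_mem (add_mem (one_mem (lift M)) li) lr) l2
        have hb := div_mem (mul_mem (sub_mem (one_mem (lift M)) li) lr) l2
        rcases z8_cases z r Complex.I hr hi hz with h | h | h | h | h | h | h | h <;> rw [h]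
        · exact one_mem _
        · exact neg_mem (one_mem _)
        · exact li
        · exact neg_mem li
        · exact ha
        · exact neg_mem ha
        · exact hb
        · exact neg_mem hb
      · have hz' : z ^ 2 = (((p : ℤ) * q : ℤ) : ℂ) := hz
        rw [← hwd] at hz'
        rcases sq_eq_sq_iff_eq_or_eq_neg.1 hz' with h | h <;> rw [h]
        · exact lw
        · exact neg_mem lw
    rw [eq_top_iff]
    intro x _
    exact (mem_lift x).1 (hle x.2)
  · change (Complex.I * w) ^ 2 = -((p : ℂ) * q)
    rw [mul_pow, hi, hw]; ring
  · convert hk2
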